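/- arXiv:math/9609210 — 5 statements merged into one kernel-verified Lean document; each statement's English description precedes it below -/
import Mathlib

section
/- Let n ≥ 2, p > 1, and 0 < a < b. Then the p-capacity of the spherical ring in ℝⁿ satisfies cap_p(closedBall(0,a), B(0,b)) ≤ ( ∫_a^b (ω_{n−1} r^{n−1})^{−1/(p−1)} dr )^{1−p}, where S(r) = ω_{n−1} r^{n−1} is the surface area of the Euclidean sphere of radius r. -/
open MeasureTheory Metric Set

/-- The `p`-capacity of a compact set `C` relative to an open set `D ⊆ ℝⁿ`:
the infimum of `∫_D ‖∇u‖^p` over smooth nonnegative `u` with compact support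
contained in `D` that are `≡ 1` on a neighborhood of `C`. -/
noncomputable def pCapacity (n : ℕ) (p : ℝ)
    (C D : Set (EuclideanSpace ℝ (Fin n))) : ℝ :=
  sInf { I : ℝ | ∃ u : EuclideanSpace ℝ (Fin n) → ℝ,
    ContDiff ℝ (⊤ : ℕ∞) u ∧ HasCompactSupport u ∧ tsupport u ⊆ D ∧
    (∀ x, 0 ≤ u x) ∧ (∃ V, IsOpen V ∧ C ⊆ V ∧ ∀ x ∈ V, u x = 1) ∧
    I = ∫ x in D, ‖fderiv ℝ u x‖ ^ p }

/-- `ω_{n-1}`: the surface measure of the unit sphere `S^{n-1} ⊂ ℝⁿ`. -/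
noncomputable def unitSphereArea (n : ℕ) : ℝ :=
  ((volume : Measure (EuclideanSpace ℝ (Fin n))).toSphere Set.univ).toReal

open Filter Topology

lemma unitSphereArea_eq (n : ℕ) :
    unitSphereArea n = n * volume.real (ball (0 : EuclideanSpace ℝ (Fin n)) 1) := by
  simp [unitSphereArea, Measure.toSphere_apply_univ, Measure.real]

lemma unitSphereArea_pos {n : ℕ} (hn : 0 < n) : 0 < unitSphereArea n := by
  rw [unitSphereArea_eq]
  exact mul_pos (by exact_mod_cast hn)
    (ENNReal.toReal_pos (measure_ball_pos _ _ one_pos).ne' measure_ball_lt_top.ne)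

lemma pCapacity_le_integral (n : ℕ) {p : ℝ} {C D : Set (EuclideanSpace ℝ (Fin n))}
    {u : EuclideanSpace ℝ (Fin n) → ℝ} (hu : ContDiff ℝ (⊤ : ℕ∞) u) (hc : HasCompactSupport u)
    (hD : tsupport u ⊆ D) (h0 : ∀ x, 0 ≤ u x)
    (h1 : ∃ V, IsOpen V ∧ C ⊆ V ∧ ∀ x ∈ V, u x = 1) :
    pCapacity n p C D ≤ ∫ x in D, ‖fderiv ℝ u x‖ ^ p := by
  refine csInf_le ⟨0, ?_⟩ ⟨u, hu, hc, hD, h0, h1, rfl⟩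
  rintro I ⟨v, -, -, -, -, -, rfl⟩
  exact integral_nonneg fun x => by positivity

/-- The radial function `x ↦ ∫_{‖x‖}^b ψ` is a competitor for the capacity of a spherical ring
whenever `ψ` is a smooth probability density supported inside `(a, b)`. -/
lemma pCapacity_ring_le_of_density {n : ℕ} (hn : 0 < n) {p : ℝ} (hp : 0 < p) {a b c d : ℝ}
    (ha : 0 < a) (hab : a < b) (hac : a < c) (hdb : d < b) {ψ : ℝ → ℝ}
    (hψ : ContDiff ℝ (⊤ : ℕ∞) ψ) (hψ0 : ∀ r, 0 ≤ ψ r) (hc : ∀ r ≤ c, ψ r = 0)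
    (hd : ∀ r, d ≤ r → ψ r = 0) (hψ1 : ∫ r in a..b, ψ r = 1) :
    pCapacity n p (closedBall (0 : EuclideanSpace ℝ (Fin n)) a)
        (ball (0 : EuclideanSpace ℝ (Fin n)) b)
      ≤ unitSphereArea n * ∫ r in a..b, r ^ (n - 1) * ψ r ^ p := by
  have hcont : Continuous ψ := hψ.continuous
  have hint (x y : ℝ) : IntervalIntegrable ψ volume x y := hcont.intervalIntegrable x y
  set F : ℝ → ℝ := fun r => ∫ s in r..b, ψ s with hF
  have hderiv (r : ℝ) : HasDerivAt F (-ψ r) r :=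
    intervalIntegral.integral_hasDerivAt_left (hint _ _)
      (hcont.stronglyMeasurableAtFilter _ _) hcont.continuousAt
  have hFsmooth : ContDiff ℝ (⊤ : ℕ∞) F := by
    rw [contDiff_infty_iff_deriv]
    refine ⟨fun r => (hderiv r).differentiableAt, ?_⟩
    rw [show deriv F = fun r => -ψ r from funext fun r => (hderiv r).deriv]
    exact hψ.neg
  have hFd (r : ℝ) (hr : d ≤ r) : F r = 0 := by
    refine intervalIntegral.integral_zero_ae (Eventually.of_forall fun s hs => hd s ?_)
    rw [mem_uIoc] at hs
    rcases hs with hs | hs <;> linarith [hs.1]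
  have hFc (r : ℝ) (hr : r ≤ c) : F r = 1 := by
    have h1 : ∫ s in r..a, ψ s = 0 := by
      refine intervalIntegral.integral_zero_ae (Eventually.of_forall fun s hs => hc s ?_)
      rw [mem_uIoc] at hs
      rcases hs with hs | hs <;> linarith [hs.2]
    rw [hF, ← hψ1]
    simp only
    rw [← intervalIntegral.integral_add_adjacent_intervals (hint r a) (hint a b), h1, zero_add]
  have hF0 (r : ℝ) : 0 ≤ F r := by
    rcases le_total d r with h | h
    · exact (hFd r h).ge
    · exact intervalIntegral.integral_nonneg (by linarith) fun s _ => hψ0 s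
  set u : EuclideanSpace ℝ (Fin n) → ℝ := fun x => F ‖x‖ with hu
  have hu1 : ∀ x ∈ ball (0 : EuclideanSpace ℝ (Fin n)) c, u x = 1 := fun x hx =>
    hFc _ (mem_ball_zero_iff.1 hx).le
  have hucd : ContDiff ℝ (⊤ : ℕ∞) u := by
    rw [contDiff_iff_contDiffAt]
    intro x
    by_cases hx : x = 0
    · refine (contDiffAt_const (c := (1 : ℝ))).congr_of_eventuallyEq ?_
      filter_upwards [ball_mem_nhds x (ha.trans hac)] with y hy
      exact hu1 y (hx ▸ hy)
    · exact hFsmooth.contDiffAt.comp x (contDiffAt_norm ℝ hx)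
  have hts : tsupport u ⊆ closedBall 0 d := by
    refine closure_minimal (fun x hx => ?_) isClosed_closedBall
    rw [mem_closedBall_zero_iff]
    by_contra h
    exact hx (hFd _ (not_le.1 h).le)
  have hgrad (x : EuclideanSpace ℝ (Fin n)) : ‖fderiv ℝ u x‖ ≤ ψ ‖x‖ := by
    by_cases hx : x = 0
    · have : u =ᶠ[𝓝 x] fun _ => (1 : ℝ) := by
        filter_upwards [ball_mem_nhds x (ha.trans hac)] with y hy
        exact hu1 y (hx ▸ hy)
      rw [this.fderiv_eq]
      simpa using hψ0 ‖x‖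
    · have h := (hderiv ‖x‖).comp_hasFDerivAt x
        ((contDiffAt_norm (n := 1) ℝ hx).differentiableAt one_ne_zero).hasFDerivAt
      have hfd : fderiv ℝ u x = -ψ ‖x‖ • fderiv ℝ (fun y => ‖y‖) x := h.fderiv
      rw [hfd, norm_smul, norm_neg, Real.norm_of_nonneg (hψ0 _)]
      refine mul_le_of_le_one_right (hψ0 _) ?_
      simpa using norm_fderiv_le_of_lipschitz ℝ
        (lipschitzWith_one_norm (E := EuclideanSpace ℝ (Fin n)))
  have hpow : Continuous fun r => ψ r ^ p := hcont.rpow_const fun _ => Or.inr hp.le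
  have hbound : Integrable fun x : EuclideanSpace ℝ (Fin n) => ψ ‖x‖ ^ p := by
    refine (hpow.comp continuous_norm).integrable_of_hasCompactSupport ?_
    refine HasCompactSupport.of_support_subset_isCompact (isCompact_closedBall 0 d) fun x hx => ?_
    rw [mem_closedBall_zero_iff]
    by_contra h
    exact hx (by simp [hd _ (not_le.1 h).le, hp.ne'])
  have : Nontrivial (EuclideanSpace ℝ (Fin n)) :=
    Module.nontrivial_of_finrank_pos (R := ℝ) (by simpa using hn)
  calc
    _ ≤ ∫ x in ball 0 b, ‖fderiv ℝ u x‖ ^ p :=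
      pCapacity_le_integral n hucd
        ((isCompact_closedBall 0 d).of_isClosed_subset (isClosed_tsupport u) hts)
        (hts.trans (closedBall_subset_ball hdb)) (fun x => hF0 _)
        ⟨ball 0 c, isOpen_ball, closedBall_subset_ball hac, hu1⟩
    _ ≤ ∫ x in ball (0 : EuclideanSpace ℝ (Fin n)) b, ψ ‖x‖ ^ p :=
      integral_mono_of_nonneg (Eventually.of_forall fun x => by positivity)
        hbound.integrableOn
        (Eventually.of_forall fun x => Real.rpow_le_rpow (norm_nonneg _) (hgrad x) hp.le)
    _ ≤ ∫ x : EuclideanSpace ℝ (Fin n), ψ ‖x‖ ^ p :=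
      setIntegral_le_integral hbound
        (Eventually.of_forall fun x => Real.rpow_nonneg (hψ0 _) _)
    _ = unitSphereArea n * ∫ r in Ioi (0 : ℝ), r ^ (n - 1) * ψ r ^ p := by
      rw [integral_fun_norm_addHaar volume fun r => ψ r ^ p, unitSphereArea_eq]
      simp [mul_assoc]
    _ = unitSphereArea n * ∫ r in a..b, r ^ (n - 1) * ψ r ^ p := by
      rw [intervalIntegral.integral_of_le hab.le]
      congr 1
      refine setIntegral_eq_of_subset_of_forall_sdiff_eq_zero measurableSet_Ioi
        (fun r hr => ha.trans hr.1) fun r hr => ?_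
      have : ψ r = 0 := by
        rcases le_or_gt r a with h | h
        · exact hc r (h.trans hac.le)
        · exact hd r (hdb.le.trans (not_le.1 fun h' => hr.2 ⟨h, h'⟩).le)
      simp [this, hp.ne']

/-- Truncating the extremal density away from the endpoints of `(a, b)`. -/
lemma pCapacity_ring_le_of_truncation {n : ℕ} (hn : 0 < n) {p : ℝ} (hp : 1 < p) {a b t : ℝ}
    (ha : 0 < a) (ht : 0 < t) (htab : a + t < b - t) :
    pCapacity n p (closedBall (0 : EuclideanSpace ℝ (Fin n)) a)
        (ball (0 : EuclideanSpace ℝ (Fin n)) b)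
      ≤ (∫ r in (a + t)..(b - t), (unitSphereArea n * r ^ (n - 1)) ^ (-(1 / (p - 1))))
          ^ (1 - p) := by
  have hω := unitSphereArea_pos hn
  set g : ℝ → ℝ := fun r => (unitSphereArea n * r ^ (n - 1)) ^ (-(1 / (p - 1))) with hg
  have hbase {r : ℝ} (hr : 0 < r) : 0 < unitSphereArea n * r ^ (n - 1) := by positivity
  have hgpos {r : ℝ} (hr : 0 < r) : 0 < g r := Real.rpow_pos_of_pos (hbase hr) _
  have hgsmooth {r : ℝ} (hr : 0 < r) : ContDiffAt ℝ (⊤ : ℕ∞) g r :=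
    (contDiffAt_const.mul (contDiffAt_id.pow _)).rpow_const_of_ne (hbase hr).ne'
  let χ : ContDiffBump ((a + b) / 2) := ⟨(b - a) / 2 - t, (b - a) / 2 - t / 2,
    by linarith, by linarith⟩
  have hχc (r : ℝ) (hr : r ≤ a + t / 2) : χ r = 0 := by
    refine χ.zero_of_le_dist ?_
    rw [Real.dist_eq, abs_sub_comm]
    exact le_trans (by simp only [χ]; linarith) (le_abs_self _)
  have hχd (r : ℝ) (hr : b - t / 2 ≤ r) : χ r = 0 := by
    refine χ.zero_of_le_dist ?_
    rw [Real.dist_eq]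
    exact le_trans (by simp only [χ]; linarith) (le_abs_self _)
  have hχ1 (r : ℝ) (hr : r ∈ Icc (a + t) (b - t)) : χ r = 1 := by
    refine χ.one_of_mem_closedBall ?_
    rw [mem_closedBall, Real.dist_eq, abs_le]
    simp only [χ]
    constructor <;> linarith [hr.1, hr.2]
  have hφ : ContDiff ℝ (⊤ : ℕ∞) fun r => χ r * g r := by
    rw [contDiff_iff_contDiffAt]
    intro r
    rcases lt_or_ge 0 r with hr | hr
    · exact χ.contDiffAt.mul (hgsmooth hr)
    · refine (contDiffAt_const (c := (0 : ℝ))).congr_of_eventuallyEq ?_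
      filter_upwards [Iio_mem_nhds (hr.trans_lt ha)] with s hs
      rw [hχc s (by linarith [mem_Iio.1 hs]), zero_mul]
  have hφ0 (r : ℝ) : 0 ≤ χ r * g r := by
    rcases lt_or_ge 0 r with hr | hr
    · exact mul_nonneg χ.nonneg (hgpos hr).le
    · rw [hχc r (by linarith), zero_mul]
  have hφint (x y : ℝ) : IntervalIntegrable (fun r => χ r * g r) volume x y :=
    hφ.continuous.intervalIntegrable x y
  have hM : 0 < ∫ r in (a + t)..(b - t), g r := by
    refine intervalIntegral.intervalIntegral_pos_of_pos_on ?_ (fun r hr => hgpos ?_) htab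
    · refine ContinuousOn.intervalIntegrable fun r hr => ?_
      rw [uIcc_of_le htab.le] at hr
      exact (hgsmooth (by linarith [hr.1])).continuousAt.continuousWithinAt
    · linarith [hr.1]
  set L := ∫ r in a..b, χ r * g r with hL
  have hML : ∫ r in (a + t)..(b - t), g r ≤ L := by
    calc
      _ = ∫ r in (a + t)..(b - t), χ r * g r := by
        refine intervalIntegral.integral_congr fun r hr => ?_
        rw [uIcc_of_le htab.le] at hr
        simp [hχ1 r hr]
      _ ≤ L := intervalIntegral.integral_mono_interval (by linarith) htab.le (by linarith)
        (Eventually.of_forall hφ0) (hφint a b)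
  have hLpos : 0 < L := hM.trans_le hML
  have hp0 : 0 < p := by linarith
  have hp1 : p - 1 ≠ 0 := by linarith
  have hkey (r : ℝ) (hr : r ∈ Icc a b) :
      unitSphereArea n * (r ^ (n - 1) * (χ r * g r / L) ^ p) ≤ χ r * g r * L ^ (-p) := by
    have hr0 : 0 < r := ha.trans_le hr.1
    have hgp : unitSphereArea n * r ^ (n - 1) * g r ^ p = g r := by
      simp only [hg]
      rw [← Real.rpow_mul (hbase hr0).le]
      nth_rewrite 1 [← Real.rpow_one (unitSphereArea n * r ^ (n - 1))]
      rw [← Real.rpow_add (hbase hr0)]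
      congr 1
      field_simp
      ring
    have hχp : χ r ^ p ≤ χ r := by
      simpa using Real.rpow_le_rpow_of_exponent_ge_of_imp χ.nonneg χ.le_one hp.le
        (fun _ h => absurd h hp0.ne')
    rw [Real.div_rpow (hφ0 r) hLpos.le, Real.mul_rpow χ.nonneg (hgpos hr0).le,
      Real.rpow_neg hLpos.le]
    calc
      _ = χ r ^ p * (unitSphereArea n * r ^ (n - 1) * g r ^ p) * (L ^ p)⁻¹ := by ring
      _ = χ r ^ p * g r * (L ^ p)⁻¹ := by rw [hgp]
      _ ≤ _ := by
        have := hgpos hr0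
        gcongr
  have hab : a < b := by linarith
  calc
    _ ≤ unitSphereArea n * ∫ r in a..b, r ^ (n - 1) * (χ r * g r / L) ^ p :=
      pCapacity_ring_le_of_density hn hp0 ha hab (c := a + t / 2) (d := b - t / 2)
        (by linarith) (by linarith) (hφ.div_const L) (fun r => div_nonneg (hφ0 r) hLpos.le)
        (fun r hr => by simp [hχc r hr]) (fun r hr => by simp [hχd r hr])
        (by rw [intervalIntegral.integral_div, ← hL, div_self hLpos.ne'])
    _ ≤ ∫ r in a..b, χ r * g r * L ^ (-p) := by
      rw [← intervalIntegral.integral_const_mul]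
      refine intervalIntegral.integral_mono_on hab.le ?_ ((hφint a b).mul_const _) hkey
      refine Continuous.intervalIntegrable ?_ _ _
      exact continuous_const.mul ((continuous_pow _).mul
        ((hφ.continuous.div_const L).rpow_const fun _ => Or.inr hp0.le))
    _ = L ^ (1 - p) := by
      rw [intervalIntegral.integral_mul_const, ← hL, sub_eq_add_neg, Real.rpow_add hLpos,
        Real.rpow_one]
    _ ≤ _ := Real.rpow_le_rpow_of_nonpos hM hML (by linarith)

theorem capacity_spherical_ring_upper_bound (n : ℕ) (hn : 2 ≤ n) (p : ℝ)
    (hp : 1 < p) (a b : ℝ) (ha : 0 < a) (hab : a < b) :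
    pCapacity n p (closedBall (0 : EuclideanSpace ℝ (Fin n)) a)
        (ball (0 : EuclideanSpace ℝ (Fin n)) b)
      ≤ (∫ r in a..b, (unitSphereArea n * r ^ (n - 1 : ℕ)) ^ (-(1 / (p - 1))))
          ^ (1 - p) := by
  have hn0 : 0 < n := by omega
  have hω := unitSphereArea_pos hn0
  set g : ℝ → ℝ := fun r => (unitSphereArea n * r ^ (n - 1)) ^ (-(1 / (p - 1))) with hg
  have hbase {r : ℝ} (hr : 0 < r) : 0 < unitSphereArea n * r ^ (n - 1) := by positivity
  have hgcont : ContinuousOn g (Icc a b) :=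
    ContinuousOn.rpow_const (by fun_prop) fun r hr => Or.inl (hbase (ha.trans_le hr.1)).ne'
  have hgint : IntegrableOn g (Icc a b) := hgcont.integrableOn_Icc
  have hgi {x y : ℝ} (hx : x ∈ Icc a b) (hy : y ∈ Icc a b) : IntervalIntegrable g volume x y :=
    (hgcont.mono (uIcc_subset_Icc hx hy)).intervalIntegrable
  have hpos : 0 < ∫ r in a..b, g r :=
    intervalIntegral.intervalIntegral_pos_of_pos_on
      (hgi (left_mem_Icc.2 hab.le) (right_mem_Icc.2 hab.le))
      (fun r hr => Real.rpow_pos_of_pos (hbase (ha.trans hr.1)) _) hab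
  set G : ℝ → ℝ := fun x => ∫ r in a..x, g r with hG
  have hGc : ContinuousOn G (Icc a b) := by
    have := intervalIntegral.continuousOn_primitive_interval (f := g) (μ := volume) (a := a)
      (b := b) (by rwa [uIcc_of_le hab.le])
    rwa [uIcc_of_le hab.le] at this
  have hsmall : ∀ᶠ t in 𝓝[>] (0 : ℝ), 0 < t ∧ a + t < b - t := by
    filter_upwards [Ioo_mem_nhdsGT (show (0 : ℝ) < (b - a) / 2 by linarith)] with t ht
    exact ⟨ht.1, by linarith [ht.2]⟩
  have hleft : Tendsto (fun t => G (a + t)) (𝓝[>] 0) (𝓝 (G a)) := by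
    refine (hGc a (left_mem_Icc.2 hab.le)).tendsto.comp (tendsto_nhdsWithin_iff.2 ⟨?_, ?_⟩)
    · exact (Continuous.tendsto' (by fun_prop) _ _ (by simp)).mono_left nhdsWithin_le_nhds
    · filter_upwards [hsmall] with t ht
      exact ⟨by linarith, by linarith⟩
  have hright : Tendsto (fun t => G (b - t)) (𝓝[>] 0) (𝓝 (G b)) := by
    refine (hGc b (right_mem_Icc.2 hab.le)).tendsto.comp (tendsto_nhdsWithin_iff.2 ⟨?_, ?_⟩)
    · exact (Continuous.tendsto' (by fun_prop) _ _ (by simp)).mono_left nhdsWithin_le_nhds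
    · filter_upwards [hsmall] with t ht
      exact ⟨by linarith, by linarith⟩
  have hlim : Tendsto (fun t => (G (b - t) - G (a + t)) ^ (1 - p)) (𝓝[>] 0)
      (𝓝 ((∫ r in a..b, g r) ^ (1 - p))) := by
    refine Tendsto.rpow_const ?_ (Or.inl hpos.ne')
    simpa [hG] using hright.sub hleft
  refine ge_of_tendsto hlim ?_
  filter_upwards [hsmall] with t ht
  have ha' := left_mem_Icc.2 hab.le
  rw [hG]
  simp only
  rw [intervalIntegral.integral_interval_sub_left
    (hgi ha' ⟨by linarith, by linarith⟩) (hgi ha' ⟨by linarith, by linarith⟩)]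
  exact pCapacity_ring_le_of_truncation hn0 hp ha ht.1 ht.2
end

section
/- The Heisenberg group equipped with a translation-invariant Riemannian metric is conformally hyperbolic. Concretely: on ℝ^{2l+1} with coordinates (x_1,…,x_l, y_1,…,y_l, t) and n = 2l+1 ≥ 3, let X_i = ∂_{x_i} − (y_i/2)∂_t, Y_i = ∂_{y_i} + (x_i/2)∂_t, T = ∂_t, which form a left-invariant orthonormal frame of a Riemannian metric g whose Riemannian volume is Lebesgue measure and whose gradient satisfies ‖∇_g u‖² = Σ_i (X_i u)² + Σ_i (Y_i u)² + (T u)². Then for every compact set C ⊂ ℝⁿ with nonempty interior, inf { ∫_{ℝⁿ} ( Σ_i (X_i u)² + Σ_i (Y_i u)² + (T u)² )^{n/2} dx : u smooth, compactly supported, 0 ≤ u, u ≡ 1 on a neighborhood of C } > 0. -/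
open MeasureTheory Set

/-- The partial derivative `∂u/∂x_j (p)` on `ℝ^{2l+1}`. -/
noncomputable def pderiv' (l : ℕ) (u : EuclideanSpace ℝ (Fin (2 * l + 1)) → ℝ)
    (p : EuclideanSpace ℝ (Fin (2 * l + 1))) (j : Fin (2 * l + 1)) : ℝ :=
  fderiv ℝ u p (EuclideanSpace.single j 1)

/-- Index of the coordinate `x_i`. -/
def xIdx (l : ℕ) (i : Fin l) : Fin (2 * l + 1) := ⟨i, by have := i.isLt; omega⟩
/-- Index of the coordinate `y_i`. -/
def yIdx (l : ℕ) (i : Fin l) : Fin (2 * l + 1) := ⟨l + i, by have := i.isLt; omega⟩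
/-- Index of the coordinate `t`. -/
def tIdx (l : ℕ) : Fin (2 * l + 1) := ⟨2 * l, by omega⟩

/-- The left-invariant Heisenberg vector field `X_i = ∂_{x_i} - (y_i/2) ∂_t`
applied to `u` at `p`. -/
noncomputable def Xfield (l : ℕ) (u : EuclideanSpace ℝ (Fin (2 * l + 1)) → ℝ)
    (p : EuclideanSpace ℝ (Fin (2 * l + 1))) (i : Fin l) : ℝ :=
  pderiv' l u p (xIdx l i) - (p (yIdx l i) / 2) * pderiv' l u p (tIdx l)

/-- The left-invariant Heisenberg vector field `Y_i = ∂_{y_i} + (x_i/2) ∂_t`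
applied to `u` at `p`. -/
noncomputable def Yfield (l : ℕ) (u : EuclideanSpace ℝ (Fin (2 * l + 1)) → ℝ)
    (p : EuclideanSpace ℝ (Fin (2 * l + 1))) (i : Fin l) : ℝ :=
  pderiv' l u p (yIdx l i) + (p (xIdx l i) / 2) * pderiv' l u p (tIdx l)

/-- The vector field `T = ∂_t` applied to `u` at `p`. -/
noncomputable def Tfield (l : ℕ) (u : EuclideanSpace ℝ (Fin (2 * l + 1)) → ℝ)
    (p : EuclideanSpace ℝ (Fin (2 * l + 1))) : ℝ :=
  pderiv' l u p (tIdx l)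

open scoped ENNReal

/-- One-dimensional affine change of variables for the Lebesgue integral. -/
lemma lintegral_mul_comp_affine {a : ℝ} (ha : 0 < a) (b : ℝ) {f : ℝ → ℝ≥0∞} (hf : Measurable f) :
    ∫⁻ x, ENNReal.ofReal a * f (a * x + b) = ∫⁻ x, f x := by
  rw [lintegral_const_mul _ (by fun_prop)]
  have h : ∫⁻ x, f (a * x + b) = ∫⁻ y, f (y + b) ∂(Measure.map (a * ·) volume) := by
    rw [lintegral_map (by fun_prop) (by fun_prop)]
  rw [h, Real.map_volume_mul_left ha.ne', lintegral_smul_measure, lintegral_add_right_eq_self f b,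
    smul_eq_mul, ← mul_assoc, ← ENNReal.ofReal_mul ha.le, abs_of_pos (inv_pos.2 ha),
    mul_inv_cancel₀ ha.ne', ENNReal.ofReal_one, one_mul]

/-- Change of variables for a map acting on the `j`-th coordinate only, affinely in that
coordinate with coefficients depending on the other ones. -/
lemma lintegral_mul_comp_update {ι : Type*} [Fintype ι] [DecidableEq ι] (j : ι)
    {a b : (ι → ℝ) → ℝ} (ha : Measurable a) (hb : Measurable b) (hpos : ∀ x, 0 < a x)
    (haj : ∀ x r, a (Function.update x j r) = a x) (hbj : ∀ x r, b (Function.update x j r) = b x)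
    {f : (ι → ℝ) → ℝ≥0∞} (hf : Measurable f) :
    ∫⁻ x, ENNReal.ofReal (a x) * f (Function.update x j (a x * x j + b x)) = ∫⁻ x, f x := by
  have hu : Measurable fun x : ι → ℝ => Function.update x j (a x * x j + b x) := by
    refine measurable_pi_lambda _ fun i => ?_
    by_cases h : i = j
    · subst h
      simp only [Function.update_self]
      fun_prop
    · simp only [Function.update_of_ne h]
      fun_prop
  refine lintegral_eq_of_lmarginal_eq {j} (by fun_prop) hf ?_
  rw [lmarginal_singleton, lmarginal_singleton]
  funext x
  simp only [haj, hbj, Function.update_self, Function.update_idem]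
  exact lintegral_mul_comp_affine (f := fun r => f (Function.update x j r)) (hpos x) (b x)
    (hf.comp (measurable_update x))

lemma lintegral_comp_smul_euclidean {ι : Type*} [Fintype ι] {r : ℝ} (hr : 0 < r)
    {f : EuclideanSpace ℝ ι → ℝ≥0∞} (hf : Measurable f) :
    ∫⁻ p, f (r • p) = ENNReal.ofReal ((r ^ Fintype.card ι)⁻¹) * ∫⁻ p, f p := by
  have h : ∫⁻ p, f (r • p) = ∫⁻ y, f y ∂(Measure.map (r • ·) volume) := by
    rw [lintegral_map hf (by fun_prop)]
  rw [h, Measure.map_addHaar_smul _ hr.ne', lintegral_smul_measure, finrank_euclideanSpace,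
    smul_eq_mul, abs_of_pos (by positivity)]

/-- A family of horizontal curves `σ ↦ heisFlow l i σ p`, `1 ≤ σ`, starting at `p`. -/
noncomputable def heisFlow (l : ℕ) (i : Fin l) (σ : ℝ) (p : EuclideanSpace ℝ (Fin (2 * l + 1))) :
    EuclideanSpace ℝ (Fin (2 * l + 1)) :=
  σ ^ 2 • p
    + (p (tIdx l) * p (xIdx l i) * (σ ^ 2 - σ)) • EuclideanSpace.single (yIdx l i) 1
    + (p (tIdx l) * (1 + p (xIdx l i) ^ 2 * (σ ^ 3 - 1) / 6 - σ ^ 2)) •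
      EuclideanSpace.single (tIdx l) 1

lemma xIdx_ne_yIdx (l : ℕ) (i j : Fin l) : xIdx l i ≠ yIdx l j := by
  simp only [xIdx, yIdx, ne_eq, Fin.mk.injEq]
  omega

lemma xIdx_ne_tIdx (l : ℕ) (i : Fin l) : xIdx l i ≠ tIdx l := by
  simp only [xIdx, tIdx, ne_eq, Fin.mk.injEq]
  omega

lemma yIdx_ne_tIdx (l : ℕ) (i : Fin l) : yIdx l i ≠ tIdx l := by
  simp only [yIdx, tIdx, ne_eq, Fin.mk.injEq]
  omega

lemma yIdx_injective (l : ℕ) : Function.Injective (yIdx l) := by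
  intro i j h
  simp only [yIdx, Fin.mk.injEq] at h
  omega

lemma heisFlow_one (l : ℕ) (i : Fin l) (p : EuclideanSpace ℝ (Fin (2 * l + 1))) :
    heisFlow l i 1 p = p := by
  ext j
  simp [heisFlow]

lemma heisFlow_xIdx (l : ℕ) (i : Fin l) (σ : ℝ) (p : EuclideanSpace ℝ (Fin (2 * l + 1)))
    (k : Fin l) : heisFlow l i σ p (xIdx l k) = σ ^ 2 * p (xIdx l k) := by
  simp [heisFlow, xIdx_ne_yIdx, xIdx_ne_tIdx]

lemma heisFlow_yIdx (l : ℕ) (i : Fin l) (σ : ℝ) (p : EuclideanSpace ℝ (Fin (2 * l + 1)))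
    (k : Fin l) : heisFlow l i σ p (yIdx l k) = σ ^ 2 * p (yIdx l k)
      + if k = i then p (tIdx l) * p (xIdx l i) * (σ ^ 2 - σ) else 0 := by
  simp [heisFlow, yIdx_ne_tIdx, (yIdx_injective l).eq_iff]

lemma continuous_heisFlow (l : ℕ) (i : Fin l) :
    Continuous fun z : ℝ × EuclideanSpace ℝ (Fin (2 * l + 1)) => heisFlow l i z.1 z.2 := by
  unfold heisFlow
  fun_prop

/-- The Jacobian of `heisFlow l i σ`. -/
lemma lintegral_comp_heisFlow (l : ℕ) (i : Fin l) {σ : ℝ} (hσ : 1 ≤ σ)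
    {f : EuclideanSpace ℝ (Fin (2 * l + 1)) → ℝ≥0∞} (hf : Measurable f) :
    ∫⁻ p, ENNReal.ofReal ((1 + p (xIdx l i) ^ 2 * (σ ^ 3 - 1) / 6) / σ ^ 2) * f (heisFlow l i σ p)
      = ENNReal.ofReal ((σ ^ (4 * l + 2))⁻¹) * ∫⁻ p, f p := by
  have h0 : 0 < σ := by linarith
  have h3 : 1 ≤ σ ^ 3 := one_le_pow₀ hσ
  have hxy := xIdx_ne_yIdx l i i
  have hxt := xIdx_ne_tIdx l i
  have hyt := yIdx_ne_tIdx l i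
  set a : (Fin (2 * l + 1) → ℝ) → ℝ := fun x => (1 + x (xIdx l i) ^ 2 * (σ ^ 3 - 1) / 6) / σ ^ 2
    with ha
  set b : (Fin (2 * l + 1) → ℝ) → ℝ := fun x => x (tIdx l) * x (xIdx l i) * (1 - σ⁻¹) with hb
  set g : (Fin (2 * l + 1) → ℝ) → ℝ≥0∞ := fun x => f (σ ^ 2 • WithLp.toLp 2 x) with hg
  have hgm : Measurable g := by
    have : Measurable fun x : Fin (2 * l + 1) → ℝ => σ ^ 2 • WithLp.toLp 2 x :=
      (((PiLp.continuous_toLp 2 _)).const_smul (σ ^ 2)).measurable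
    exact hf.comp this
  have ham : Measurable a := by fun_prop
  have hbm : Measurable b := by fun_prop
  have hapos : ∀ x, 0 < a x := fun x => by
    have : 0 ≤ x (xIdx l i) ^ 2 * (σ ^ 3 - 1) / 6 :=
      div_nonneg (mul_nonneg (sq_nonneg _) (by linarith)) (by norm_num)
    simp only [ha]
    positivity
  have hG : Measurable fun x : Fin (2 * l + 1) → ℝ =>
      ENNReal.ofReal (a x) * g (Function.update x (tIdx l) (a x * x (tIdx l) + 0)) := by
    refine (by fun_prop : Measurable fun x => ENNReal.ofReal (a x)).mul (hgm.comp ?_)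
    refine measurable_pi_lambda _ fun k => ?_
    by_cases h : k = tIdx l
    · subst h
      simp only [Function.update_self]
      fun_prop
    · simp only [Function.update_of_ne h]
      fun_prop
  have key1 := lintegral_mul_comp_update (tIdx l) (a := a) (b := fun _ => 0) ham
    measurable_const hapos (fun x r => by simp [ha, hxt]) (fun x r => rfl) hgm
  have key2 := lintegral_mul_comp_update (yIdx l i) (a := fun _ => 1) (b := b) measurable_const
    hbm (fun _ => one_pos) (fun x r => rfl) (fun x r => by simp [hb, hxy, hyt.symm]) hG
  have key3 := lintegral_comp_smul_euclidean (ι := Fin (2 * l + 1)) (pow_pos h0 2) hf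
  rw [Fintype.card_fin, ← pow_mul, show 2 * (2 * l + 1) = 4 * l + 2 by ring] at key3
  rw [← key3, ← (PiLp.volume_preserving_toLp _).lintegral_comp_emb
    (MeasurableEquiv.toLp 2 _).measurableEmbedding,
    ← (PiLp.volume_preserving_toLp _).lintegral_comp_emb
    (MeasurableEquiv.toLp 2 _).measurableEmbedding (fun p => f (σ ^ 2 • p))]
  refine Eq.trans ?_ (key2.trans key1)
  refine lintegral_congr fun x => ?_
  simp only [ENNReal.ofReal_one, one_mul]
  congr 1
  · simp [ha, hxy]
  · simp only [hg]
    congr 1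
    ext k
    by_cases hk : k = tIdx l
    · subst hk
      simp [heisFlow, ha, hxy, hyt.symm]
      field_simp
      ring
    · by_cases hk' : k = yIdx l i
      · subst hk'
        simp [heisFlow, hb, hyt]
        field_simp
      · simp [heisFlow, hk, hk']

lemma sum_heisIdx {M : Type*} [AddCommMonoid M] (l : ℕ) (f : Fin (2 * l + 1) → M) :
    ∑ j, f j = ∑ i, f (xIdx l i) + ∑ i, f (yIdx l i) + f (tIdx l) := by
  let F : ℕ → M := fun k => if h : k < 2 * l + 1 then f ⟨k, h⟩ else 0
  have hF : ∀ j : Fin (2 * l + 1), f j = F j := fun j => by simp only [F, dif_pos j.isLt]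
  have hsum : ∑ k ∈ Finset.range (2 * l + 1), F k
      = ∑ i : Fin l, F i + ∑ i : Fin l, F (l + i) + F (2 * l) := by
    rw [Finset.sum_range_succ, two_mul, Finset.sum_range_add, Fin.sum_univ_eq_sum_range F l,
      Fin.sum_univ_eq_sum_range (fun k => F (l + k)) l]
  simp only [hF]
  rw [Fin.sum_univ_eq_sum_range F (2 * l + 1), hsum]
  rfl

/-- The squared Riemannian norm of the gradient of `u`. -/
noncomputable def heisGradSq (l : ℕ) (u : EuclideanSpace ℝ (Fin (2 * l + 1)) → ℝ)
    (p : EuclideanSpace ℝ (Fin (2 * l + 1))) : ℝ :=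
  ∑ i, Xfield l u p i ^ 2 + ∑ i, Yfield l u p i ^ 2 + Tfield l u p ^ 2

lemma heisGradSq_nonneg (l : ℕ) (u : EuclideanSpace ℝ (Fin (2 * l + 1)) → ℝ)
    (p : EuclideanSpace ℝ (Fin (2 * l + 1))) : 0 ≤ heisGradSq l u p := by
  unfold heisGradSq
  positivity

/-- The differential in terms of the left-invariant frame. -/
lemma fderiv_eq_heisFrame (l : ℕ) (u : EuclideanSpace ℝ (Fin (2 * l + 1)) → ℝ)
    (q v : EuclideanSpace ℝ (Fin (2 * l + 1))) :
    fderiv ℝ u q v = ∑ i, v (xIdx l i) * Xfield l u q i + ∑ i, v (yIdx l i) * Yfield l u q i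
      + (v (tIdx l) + ∑ i, (q (yIdx l i) * v (xIdx l i) - q (xIdx l i) * v (yIdx l i)) / 2)
        * Tfield l u q := by
  have h : fderiv ℝ u q v = ∑ j, v j * pderiv' l u q j := by
    conv_lhs => rw [← (EuclideanSpace.basisFun (Fin (2 * l + 1)) ℝ).sum_repr v]
    simp [pderiv']
  rw [h, sum_heisIdx]
  simp only [Xfield, Yfield, Tfield]
  rw [add_mul, Finset.sum_mul]
  have : ∀ a b c d e f : ℝ, d + e + f = a + b → a + b + c = d + e + (c + f) := by
    intros; linarith
  apply this
  rw [← Finset.sum_add_distrib, ← Finset.sum_add_distrib, ← Finset.sum_add_distrib]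
  exact Finset.sum_congr rfl fun i _ => by ring

/-- Cauchy-Schwarz for the derivative along a horizontal vector `v` at `q`, whose horizontal
components are those of `w`. -/
lemma abs_fderiv_le_of_horizontal (l : ℕ) (u : EuclideanSpace ℝ (Fin (2 * l + 1)) → ℝ)
    (q v w : EuclideanSpace ℝ (Fin (2 * l + 1)))
    (hx : ∀ i, w (xIdx l i) = v (xIdx l i)) (hy : ∀ i, w (yIdx l i) = v (yIdx l i))
    (hv : v (tIdx l) = ∑ i, (q (xIdx l i) * v (yIdx l i) - q (yIdx l i) * v (xIdx l i)) / 2) :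
    |fderiv ℝ u q v| ≤ ‖w‖ * √(heisGradSq l u q) := by
  have h0 : v (tIdx l) + ∑ i, (q (yIdx l i) * v (xIdx l i) - q (xIdx l i) * v (yIdx l i)) / 2
      = 0 := by
    rw [hv, ← Finset.sum_add_distrib]
    exact Finset.sum_eq_zero fun i _ => by ring
  have h1 : fderiv ℝ u q v
      = ∑ k : Fin l ⊕ Fin l, Sum.elim (fun i => v (xIdx l i)) (fun i => v (yIdx l i)) k
        * Sum.elim (Xfield l u q) (Yfield l u q) k := by
    rw [fderiv_eq_heisFrame, h0]
    simp
  have h2 := Finset.sum_mul_sq_le_sq_mul_sq Finset.univ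
    (Sum.elim (fun i => v (xIdx l i)) (fun i => v (yIdx l i)))
    (Sum.elim (Xfield l u q) (Yfield l u q))
  rw [← h1] at h2
  simp only [Fintype.sum_sum_type, Sum.elim_inl, Sum.elim_inr] at h2
  refine abs_le_of_sq_le_sq ?_ (by positivity)
  rw [mul_pow, Real.sq_sqrt (heisGradSq_nonneg l u q), EuclideanSpace.norm_sq_eq, sum_heisIdx]
  refine h2.trans (mul_le_mul ?_ ?_ (by positivity) (by positivity))
  · simp only [hx, hy, Real.norm_eq_abs, sq_abs]
    linarith [sq_nonneg (w (tIdx l))]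
  · unfold heisGradSq
    linarith [sq_nonneg (Tfield l u q)]

lemma hasDerivAt_heisFlow (l : ℕ) (i : Fin l) (σ : ℝ) (p : EuclideanSpace ℝ (Fin (2 * l + 1))) :
    HasDerivAt (fun σ => heisFlow l i σ p)
      ((2 * σ) • p + (p (tIdx l) * p (xIdx l i) * (2 * σ - 1)) • EuclideanSpace.single (yIdx l i) 1
        + (p (tIdx l) * (p (xIdx l i) ^ 2 * σ ^ 2 / 2 - 2 * σ)) •
          EuclideanSpace.single (tIdx l) 1) σ := by
  have h2 : HasDerivAt (fun σ : ℝ => σ ^ 2) (2 * σ) σ := by simpa using hasDerivAt_pow 2 σ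
  have h3 : HasDerivAt (fun σ : ℝ => σ ^ 3) (3 * σ ^ 2) σ := by simpa using hasDerivAt_pow 3 σ
  have hT : HasDerivAt
      (fun σ => p (tIdx l) * (1 + p (xIdx l i) ^ 2 * (σ ^ 3 - 1) / 6 - σ ^ 2))
      (p (tIdx l) * (p (xIdx l i) ^ 2 * σ ^ 2 / 2 - 2 * σ)) σ := by
    exact (((((h3.sub_const 1).const_mul (p (xIdx l i) ^ 2)).div_const 6).const_add 1
      |>.sub h2).const_mul (p (tIdx l))).congr_deriv (by ring)
  exact ((h2.smul_const p).add
    (((h2.sub (hasDerivAt_id σ)).const_mul (p (tIdx l) * p (xIdx l i))).smul_const _)).add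
    (hT.smul_const _)

/-- The derivative of `u` along the curve is controlled by the gradient of `u`. -/
lemma abs_deriv_comp_heisFlow_le (l : ℕ) (i : Fin l)
    {u : EuclideanSpace ℝ (Fin (2 * l + 1)) → ℝ} (hu : Differentiable ℝ u)
    {σ R : ℝ} (hσ : 1 ≤ σ) {p : EuclideanSpace ℝ (Fin (2 * l + 1))} (hp : ‖p‖ ≤ R) :
    |deriv (fun σ => u (heisFlow l i σ p)) σ|
      ≤ 2 * (R + R ^ 2) * σ * √(heisGradSq l u (heisFlow l i σ p)) := by
  have hd := ((hu _).hasFDerivAt.comp_hasDerivAt σ (hasDerivAt_heisFlow l i σ p)).deriv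
  simp only [Function.comp_def] at hd
  have hR : 0 ≤ R := (norm_nonneg p).trans hp
  rw [hd]
  set w := (2 * σ) • p
    + (p (tIdx l) * p (xIdx l i) * (2 * σ - 1)) • EuclideanSpace.single (yIdx l i) (1 : ℝ) with hw
  set v := w + (p (tIdx l) * (p (xIdx l i) ^ 2 * σ ^ 2 / 2 - 2 * σ)) •
    EuclideanSpace.single (tIdx l) (1 : ℝ) with hv
  refine (abs_fderiv_le_of_horizontal l u _ _ w ?_ ?_ ?_).trans ?_
  · intro k
    simp [hv, hw, xIdx_ne_tIdx]
  · intro k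
    simp [hv, hw, yIdx_ne_tIdx]
  · have hsum : ∀ k : Fin l, (heisFlow l i σ p (xIdx l k) * v (yIdx l k)
        - heisFlow l i σ p (yIdx l k) * v (xIdx l k)) / 2
        = if k = i then p (tIdx l) * p (xIdx l i) ^ 2 * σ ^ 2 / 2 else 0 := by
      intro k
      rw [heisFlow_xIdx, heisFlow_yIdx]
      by_cases hk : k = i
      · subst hk
        simp [hv, hw, yIdx_ne_tIdx, xIdx_ne_tIdx, xIdx_ne_yIdx]
        ring
      · simp [hv, hw, yIdx_ne_tIdx, xIdx_ne_tIdx, xIdx_ne_yIdx, (yIdx_injective l).eq_iff, hk]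
        ring
    rw [Finset.sum_congr rfl fun k _ => hsum k]
    simp [hv, hw, (yIdx_ne_tIdx l i).symm]
    ring
  · refine mul_le_mul_of_nonneg_right ?_ (Real.sqrt_nonneg _)
    have ht : |p (tIdx l)| ≤ R := (PiLp.norm_apply_le p (tIdx l)).trans hp
    have hx : |p (xIdx l i)| ≤ R := (PiLp.norm_apply_le p (xIdx l i)).trans hp
    have h1 : |p (tIdx l)| * |p (xIdx l i)| ≤ R * R := mul_le_mul ht hx (abs_nonneg _) hR
    calc ‖w‖ ≤ 2 * σ * ‖p‖ + |p (tIdx l)| * |p (xIdx l i)| * (2 * σ - 1) := by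
          refine (norm_add_le _ _).trans (le_of_eq ?_)
          rw [norm_smul, norm_smul, PiLp.norm_single, Real.norm_eq_abs, Real.norm_eq_abs,
            abs_of_pos (by linarith : 0 < 2 * σ), abs_mul, abs_mul,
            abs_of_pos (by linarith : 0 < 2 * σ - 1)]
          simp
      _ ≤ 2 * σ * R + R * R * (2 * σ) := by
          have h2 : 2 * σ - 1 ≤ 2 * σ := by linarith
          have h3 : 0 ≤ 2 * σ - 1 := by linarith
          gcongr
      _ = 2 * (R + R ^ 2) * σ := by ring

lemma mul_sqrt_le_add_rpow {l : ℕ} (hl : 1 ≤ l) {K M σ Q : ℝ} (hK : 0 ≤ K) (hM : 0 < M)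
    (hσ : 1 ≤ σ) (hQ : 0 ≤ Q) :
    K * σ * √Q ≤ K / M * σ ^ (-1 - 1 / (4 * l) : ℝ)
      + K * M ^ (2 * l) * σ ^ (4 * l + 3 / 2 : ℝ) * Q ^ ((2 * l + 1 : ℝ) / 2) := by
  have hσ0 : 0 < σ := by linarith
  have hl0 : (0 : ℝ) < l := by exact_mod_cast hl
  have hQg : Q ^ ((2 * l + 1 : ℝ) / 2) = √Q ^ (2 * l + 1) := by
    rw [Real.sqrt_eq_rpow, ← Real.rpow_natCast, ← Real.rpow_mul hQ]
    congr 1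
    push_cast
    ring
  rw [hQg]
  have hg : 0 ≤ √Q := Real.sqrt_nonneg Q
  generalize √Q = g at hg ⊢
  have hA : 0 ≤ K / M * σ ^ (-1 - 1 / (4 * l) : ℝ) := by positivity
  have hB : 0 ≤ K * M ^ (2 * l) * σ ^ (4 * l + 3 / 2 : ℝ) * g ^ (2 * l + 1) := by positivity
  set ρ : ℝ := σ ^ (2 + 1 / (4 * l) : ℝ) with hρ
  have hρ0 : 0 < ρ := by positivity
  have e1 : σ ^ (-1 - 1 / (4 * l) : ℝ) = σ / ρ := by
    rw [hρ, show (-1 - 1 / (4 * l) : ℝ) = 1 - (2 + 1 / (4 * l)) by ring, Real.rpow_sub hσ0,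
      Real.rpow_one]
  have e2 : σ ^ (4 * l + 3 / 2 : ℝ) = σ * ρ ^ (2 * l) := by
    rw [hρ, ← Real.rpow_natCast, ← Real.rpow_mul hσ0.le]
    nth_rewrite 2 [← Real.rpow_one σ]
    rw [← Real.rpow_add hσ0]
    congr 1
    push_cast
    field_simp
    ring
  rcases le_total (M * ρ * g) 1 with h | h
  · have : K * σ * g ≤ K / M * σ ^ (-1 - 1 / (4 * l) : ℝ) := by
      rw [e1, div_mul_div_comm, le_div_iff₀ (by positivity)]
      calc K * σ * g * (M * ρ) = K * σ * (M * ρ * g) := by ring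
        _ ≤ K * σ * 1 := by gcongr
        _ = K * σ := mul_one _
    linarith
  · have : K * σ * g ≤ K * M ^ (2 * l) * σ ^ (4 * l + 3 / 2 : ℝ) * g ^ (2 * l + 1) := by
      rw [e2]
      calc K * σ * g = K * σ * g * 1 := (mul_one _).symm
        _ ≤ K * σ * g * (M * ρ * g) ^ (2 * l) := by
          gcongr
          exact one_le_pow₀ h
        _ = _ := by ring
    linarith

lemma lintegral_Ioi_one_rpow {a : ℝ} (ha : a < -1) :
    ∫⁻ σ in Ioi (1 : ℝ), ENNReal.ofReal (σ ^ a) = ENNReal.ofReal (-1 / (a + 1)) := by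
  rw [← ofReal_integral_eq_lintegral_ofReal (integrableOn_Ioi_rpow_of_lt ha one_pos),
    integral_Ioi_rpow_of_lt ha one_pos, Real.one_rpow]
  filter_upwards [ae_restrict_mem measurableSet_Ioi] with σ hσ
  exact Real.rpow_nonneg (zero_le_one.trans (le_of_lt hσ)) _

lemma continuous_heisGradSq (l : ℕ) {u : EuclideanSpace ℝ (Fin (2 * l + 1)) → ℝ}
    (hu : ContDiff ℝ 1 u) : Continuous (heisGradSq l u) := by
  have h (j : Fin (2 * l + 1)) : Continuous fun p => pderiv' l u p j :=
    (hu.continuous_fderiv one_ne_zero).clm_apply continuous_const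
  unfold heisGradSq Xfield Yfield Tfield
  fun_prop

lemma contDiff_heisFlow (l : ℕ) (i : Fin l) (p : EuclideanSpace ℝ (Fin (2 * l + 1))) :
    ContDiff ℝ 1 fun σ => heisFlow l i σ p := by
  unfold heisFlow
  fun_prop

/-- A compactly supported function has total variation at least `1` along a curve issued from a
point where it equals `1`. -/
lemma one_le_lintegral_heisFlow {l : ℕ} (i : Fin l)
    {u : EuclideanSpace ℝ (Fin (2 * l + 1)) → ℝ} (hu : ContDiff ℝ 1 u) (hc : HasCompactSupport u)
    {R : ℝ} {p : EuclideanSpace ℝ (Fin (2 * l + 1))}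
    (hp : ‖p‖ ≤ R) (hpx : p (xIdx l i) ≠ 0) (hup : u p = 1) :
    1 ≤ ∫⁻ σ in Ioi (1 : ℝ), ENNReal.ofReal
      (2 * (R + R ^ 2) * σ * √(heisGradSq l u (heisFlow l i σ p))) := by
  obtain ⟨S, hS⟩ := hc.isCompact.isBounded.exists_norm_le
  have hpx' : 0 < |p (xIdx l i)| := abs_pos.2 hpx
  obtain ⟨b, hb1, hb2⟩ : ∃ b : ℝ, 1 ≤ b ∧ (S + 1) / |p (xIdx l i)| ≤ b :=
    ⟨_, le_max_left _ _, le_max_right _ _⟩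
  have hub : u (heisFlow l i b p) = 0 := by
    by_contra h
    have h1 := hS _ (subset_tsupport u h)
    have h2 := PiLp.norm_apply_le (heisFlow l i b p) (xIdx l i)
    rw [heisFlow_xIdx, norm_mul, Real.norm_eq_abs, Real.norm_eq_abs, abs_of_nonneg (sq_nonneg b)]
      at h2
    have h3 : S + 1 ≤ b * |p (xIdx l i)| := (div_le_iff₀ hpx').1 hb2
    have h4 : b * |p (xIdx l i)| ≤ b ^ 2 * |p (xIdx l i)| :=
      mul_le_mul_of_nonneg_right (by nlinarith) hpx'.le
    linarith
  have hcd : ContDiff ℝ 1 fun σ => u (heisFlow l i σ p) := hu.comp (contDiff_heisFlow l i p)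
  have h := enorm_sub_le_lintegral_deriv_of_contDiffOn_Icc (hcd.contDiffOn (s := Icc 1 b)) hb1
  simp only [hub, heisFlow_one, hup, zero_sub, enorm_neg, enorm_one] at h
  refine h.trans ?_
  rw [restrict_Ioc_eq_restrict_Icc.symm]
  refine (lintegral_mono_set Ioc_subset_Ioi_self).trans
    (setLIntegral_mono' measurableSet_Ioi fun σ hσ => ?_)
  rw [Real.enorm_eq_ofReal_abs]
  exact ENNReal.ofReal_le_ofReal
    (abs_deriv_comp_heisFlow_le l i (hu.differentiable one_ne_zero) (le_of_lt hσ) hp)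

/-- Along the curve issued from a point where `u = 1`, the energy density of a compactly supported
`u` has a weighted integral bounded from below. -/
lemma half_le_lintegral_heisFlow {l : ℕ} (hl : 1 ≤ l) (i : Fin l)
    {u : EuclideanSpace ℝ (Fin (2 * l + 1)) → ℝ} (hu : ContDiff ℝ 1 u) (hc : HasCompactSupport u)
    {R K : ℝ} (hR : 0 < R) (hK : K = 2 * (R + R ^ 2)) {p : EuclideanSpace ℝ (Fin (2 * l + 1))}
    (hp : ‖p‖ ≤ R) (hpx : p (xIdx l i) ≠ 0) (hup : u p = 1) :
    ENNReal.ofReal (1 / 2) ≤ ∫⁻ σ in Ioi (1 : ℝ),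
      ENNReal.ofReal (K * (8 * l * K) ^ (2 * l) * σ ^ (4 * l + 3 / 2 : ℝ))
        * ENNReal.ofReal (heisGradSq l u (heisFlow l i σ p) ^ ((2 * l + 1 : ℝ) / 2)) := by
  have hl0 : (0 : ℝ) < l := by exact_mod_cast hl
  have hK0 : 0 < K := by rw [hK]; positivity
  have h1 : (1 : ℝ≥0∞) ≤ ∫⁻ σ in Ioi (1 : ℝ),
      (ENNReal.ofReal (K / (8 * l * K)) * ENNReal.ofReal (σ ^ (-1 - 1 / (4 * l) : ℝ))
      + ENNReal.ofReal (K * (8 * l * K) ^ (2 * l) * σ ^ (4 * l + 3 / 2 : ℝ))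
        * ENNReal.ofReal (heisGradSq l u (heisFlow l i σ p) ^ ((2 * l + 1 : ℝ) / 2))) := by
    refine (one_le_lintegral_heisFlow i hu hc hp hpx hup).trans
      (setLIntegral_mono' measurableSet_Ioi fun σ hσ => ?_)
    have hσ1 : (1 : ℝ) ≤ σ := le_of_lt hσ
    have hσ0 : (0 : ℝ) ≤ σ := by linarith
    have hQ := heisGradSq_nonneg l u (heisFlow l i σ p)
    generalize heisGradSq l u (heisFlow l i σ p) = Q at hQ ⊢
    rw [← ENNReal.ofReal_mul (by positivity), ← ENNReal.ofReal_mul (by positivity),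
      ← ENNReal.ofReal_add (by positivity) (by positivity), ← hK]
    exact ENNReal.ofReal_le_ofReal (mul_sqrt_le_add_rpow hl hK0.le (by positivity) hσ1 hQ)
  have ha : (-1 - 1 / (4 * l) : ℝ) < -1 := by
    have : (0 : ℝ) < 1 / (4 * l) := by positivity
    linarith
  have hm : Measurable fun σ : ℝ => ENNReal.ofReal (σ ^ (-1 - 1 / (4 * l) : ℝ)) := by fun_prop
  rw [lintegral_add_left (hm.const_mul _), lintegral_const_mul _ hm,
    lintegral_Ioi_one_rpow ha, ← ENNReal.ofReal_mul (by positivity)] at h1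
  have h2 : K / (8 * l * K) * (-1 / (-1 - 1 / (4 * l) + 1)) = (1 / 2 : ℝ) := by
    rw [show (-1 - 1 / (4 * l) + 1 : ℝ) = -(1 / (4 * l)) by ring]
    field_simp
    norm_num
  have h3 : (1 : ℝ≥0∞) = ENNReal.ofReal (1 / 2) + ENNReal.ofReal (1 / 2) := by
    rw [← ENNReal.ofReal_add (by norm_num) (by norm_num)]
    norm_num
  rw [h2, h3] at h1
  exact (ENNReal.add_le_add_iff_left ENNReal.ofReal_ne_top).1 h1

/-- A lower bound for the energy of functions equal to `1` on a set `B` away from `x_i = 0`. -/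
lemma measure_le_lintegral_heisGradSq {l : ℕ} (hl : 1 ≤ l) (i : Fin l)
    {u : EuclideanSpace ℝ (Fin (2 * l + 1)) → ℝ} (hu : ContDiff ℝ 1 u) (hc : HasCompactSupport u)
    {R K c : ℝ} (hR : 0 < R) (hK : K = 2 * (R + R ^ 2)) (hc0 : 0 < c) (hc1 : c ≤ 1)
    {B : Set (EuclideanSpace ℝ (Fin (2 * l + 1)))} (hB : MeasurableSet B)
    (hBR : ∀ p ∈ B, ‖p‖ ≤ R) (hBc : ∀ p ∈ B, c ≤ p (xIdx l i) ^ 2 / 6) (huB : ∀ p ∈ B, u p = 1) :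
    ENNReal.ofReal (1 / 2) * volume B ≤ ENNReal.ofReal (2 * (K * (8 * l * K) ^ (2 * l)) / c)
      * ∫⁻ p, ENNReal.ofReal (heisGradSq l u p ^ ((2 * l + 1 : ℝ) / 2)) := by
  have hK0 : 0 < K := by rw [hK]; positivity
  set D := K * (8 * l * K) ^ (2 * l) with hD
  have hD0 : 0 ≤ D := by positivity
  set F : EuclideanSpace ℝ (Fin (2 * l + 1)) → ℝ≥0∞ :=
    fun p => ENNReal.ofReal (heisGradSq l u p ^ ((2 * l + 1 : ℝ) / 2)) with hF
  have hFm : Measurable F :=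
    ((continuous_heisGradSq l hu).measurable.pow_const _).ennreal_ofReal
  calc ENNReal.ofReal (1 / 2) * volume B = ∫⁻ _ in B, ENNReal.ofReal (1 / 2) := by
        rw [setLIntegral_const]
    _ ≤ ∫⁻ p in B, ∫⁻ σ in Ioi (1 : ℝ),
          ENNReal.ofReal (D * σ ^ (4 * l + 3 / 2 : ℝ)) * F (heisFlow l i σ p) := by
        refine setLIntegral_mono' hB fun p hp => ?_
        refine half_le_lintegral_heisFlow hl i hu hc hR hK (hBR p hp) (fun h => ?_) (huB p hp)
        have := hBc p hp
        rw [h] at this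
        norm_num at this
        linarith
    _ = ∫⁻ σ in Ioi (1 : ℝ), ∫⁻ p in B,
          ENNReal.ofReal (D * σ ^ (4 * l + 3 / 2 : ℝ)) * F (heisFlow l i σ p) := by
        refine lintegral_lintegral_swap (Measurable.aemeasurable ?_)
        have h1 : Measurable fun z : EuclideanSpace ℝ (Fin (2 * l + 1)) × ℝ =>
            F (heisFlow l i z.2 z.1) :=
          hFm.comp ((continuous_heisFlow l i).comp continuous_swap).measurable
        have h2 : Measurable fun z : EuclideanSpace ℝ (Fin (2 * l + 1)) × ℝ =>
            ENNReal.ofReal (D * z.2 ^ (4 * l + 3 / 2 : ℝ)) := by fun_prop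
        exact h2.mul h1
    _ ≤ ∫⁻ σ in Ioi (1 : ℝ),
          ENNReal.ofReal (D / c) * ENNReal.ofReal (σ ^ (-3 / 2 : ℝ)) * ∫⁻ p, F p := by
        refine setLIntegral_mono' measurableSet_Ioi fun σ hσ => ?_
        have hσ1 : (1 : ℝ) ≤ σ := le_of_lt hσ
        have hσ0 : (0 : ℝ) < σ := by linarith
        have hσ3 : 1 ≤ σ ^ 3 := one_le_pow₀ hσ1
        have hstep : ∀ p ∈ B, ENNReal.ofReal (D * σ ^ (4 * l + 3 / 2 : ℝ)) * F (heisFlow l i σ p)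
            ≤ ENNReal.ofReal (D * σ ^ (4 * l + 3 / 2 : ℝ) / (c * σ))
              * (ENNReal.ofReal ((1 + p (xIdx l i) ^ 2 * (σ ^ 3 - 1) / 6) / σ ^ 2)
                * F (heisFlow l i σ p)) := by
          intro p hp
          rw [← mul_assoc,
            ← ENNReal.ofReal_mul (p := D * σ ^ (4 * l + 3 / 2 : ℝ) / (c * σ)) (by positivity)]
          refine mul_le_mul' (ENNReal.ofReal_le_ofReal ?_) le_rfl
          rw [div_mul_div_comm, le_div_iff₀ (by positivity)]
          refine mul_le_mul_of_nonneg_left ?_ (by positivity)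
          nlinarith [mul_le_mul_of_nonneg_right (hBc p hp) (sub_nonneg.2 hσ3)]
        refine (setLIntegral_mono' hB hstep).trans ((setLIntegral_le_lintegral _ _).trans ?_)
        have hm : Measurable fun p => F (heisFlow l i σ p) := hFm.comp
          ((continuous_heisFlow l i).comp (by fun_prop : Continuous fun p => (σ, p))).measurable
        have hm' : Measurable fun p : EuclideanSpace ℝ (Fin (2 * l + 1)) =>
            ENNReal.ofReal ((1 + p (xIdx l i) ^ 2 * (σ ^ 3 - 1) / 6) / σ ^ 2)
              * F (heisFlow l i σ p) := Measurable.mul (by fun_prop) hm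
        rw [lintegral_const_mul _ hm', lintegral_comp_heisFlow l i hσ1 hFm, ← mul_assoc,
          ← ENNReal.ofReal_mul (by positivity), ← ENNReal.ofReal_mul (by positivity)]
        refine le_of_eq ?_
        congr 2
        have e : σ ^ (4 * l + 3 / 2 : ℝ) = σ ^ (-3 / 2 : ℝ) * (σ * σ ^ (4 * l + 2)) := by
          rw [← pow_succ', ← Real.rpow_natCast, ← Real.rpow_add hσ0]
          congr 1
          push_cast
          ring
        rw [e]
        field_simp
    _ = ENNReal.ofReal (2 * D / c) * ∫⁻ p, F p := by
        rw [lintegral_mul_const _ (by fun_prop), lintegral_const_mul _ (by fun_prop),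
          lintegral_Ioi_one_rpow (by norm_num), ← ENNReal.ofReal_mul (by positivity)]
        congr 2
        ring

lemma hasCompactSupport_heisGradSq_rpow (l : ℕ) {u : EuclideanSpace ℝ (Fin (2 * l + 1)) → ℝ}
    (hc : HasCompactSupport u) :
    HasCompactSupport fun p => heisGradSq l u p ^ ((2 * l + 1 : ℝ) / 2) := by
  refine (hc.fderiv (𝕜 := ℝ)).mono fun p hp => ?_
  contrapose! hp
  have h : fderiv ℝ u p = 0 := by simpa using hp
  have h0 : heisGradSq l u p = 0 := by
    simp [heisGradSq, Xfield, Yfield, Tfield, pderiv', h]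
  simp only [Function.mem_support, not_not, h0]
  exact Real.zero_rpow (by positivity)

lemma exists_ball_subset_coord_ne_zero {ι : Type*} [Fintype ι] [DecidableEq ι] (j : ι)
    {s : Set (EuclideanSpace ℝ ι)} (hs : IsOpen s) (hne : s.Nonempty) :
    ∃ q, ∃ r > 0, Metric.ball q r ⊆ s ∧ 0 < |q j| - r := by
  obtain ⟨p, hp⟩ := hne
  obtain ⟨ε, hε, hball⟩ := Metric.isOpen_iff.1 hs p hp
  obtain ⟨q, hq, hqj⟩ : ∃ q ∈ s, q j ≠ 0 := by
    by_cases h : p j = 0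
    · refine ⟨p + EuclideanSpace.single j (ε / 2), hball ?_, ?_⟩
      · simp [abs_of_pos hε, hε]
      · simp [h, hε.ne']
    · exact ⟨p, hp, h⟩
  obtain ⟨r, hr, hball'⟩ := Metric.isOpen_iff.1 hs q hq
  have hq0 : 0 < |q j| := abs_pos.2 hqj
  refine ⟨q, min r (|q j| / 2), by positivity,
    (Metric.ball_subset_ball (min_le_left _ _)).trans hball', ?_⟩
  linarith [min_le_right r (|q j| / 2)]

/-- The Heisenberg group with a translation-invariant *Riemannian* metric
(the frame `X_i, Y_i, T` declared orthonormal) is conformally hyperbolic: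
the Riemannian conformal capacity (with `n = 2l+1`) of any compact set with
nonempty interior relative to the whole space is positive. -/
theorem heisenberg_riemannian_conformally_hyperbolic (l : ℕ) (hl : 1 ≤ l)
    (C : Set (EuclideanSpace ℝ (Fin (2 * l + 1)))) (hC : IsCompact C)
    (hCi : (interior C).Nonempty) :
    0 < sInf { I : ℝ | ∃ u : EuclideanSpace ℝ (Fin (2 * l + 1)) → ℝ,
      ContDiff ℝ (⊤ : ℕ∞) u ∧ HasCompactSupport u ∧ (∀ x, 0 ≤ u x) ∧
      (∃ V, IsOpen V ∧ C ⊆ V ∧ ∀ x ∈ V, u x = 1) ∧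
      I = ∫ x, (∑ i, Xfield l u x i ^ 2 + ∑ i, Yfield l u x i ^ 2
                  + Tfield l u x ^ 2) ^ ((2 * l + 1 : ℝ) / 2) } := by
  let i : Fin l := ⟨0, hl⟩
  obtain ⟨q, r, hr, hball, hqr⟩ :=
    exists_ball_subset_coord_ne_zero (xIdx l i) isOpen_interior hCi
  set B := Metric.ball q r with hB
  set R : ℝ := ‖q‖ + r with hR
  have hR0 : 0 < R := by positivity
  set K : ℝ := 2 * (R + R ^ 2) with hK
  have hK0 : 0 < K := by positivity
  set c : ℝ := min 1 ((|q (xIdx l i)| - r) ^ 2 / 6) with hc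
  have hc0 : 0 < c := by positivity
  have hBR : ∀ p ∈ B, ‖p‖ ≤ R := fun p hp => by
    have h1 := norm_le_norm_add_norm_sub' p q
    have h2 : ‖p - q‖ < r := mem_ball_iff_norm.1 hp
    linarith
  have hBc : ∀ p ∈ B, c ≤ p (xIdx l i) ^ 2 / 6 := fun p hp => by
    have h1 : ‖(p - q) (xIdx l i)‖ ≤ ‖p - q‖ := PiLp.norm_apply_le _ _
    have h2 : ‖p - q‖ < r := mem_ball_iff_norm.1 hp
    rw [PiLp.sub_apply, Real.norm_eq_abs, abs_sub_comm] at h1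
    have h3 := abs_sub_abs_le_abs_sub (q (xIdx l i)) (p (xIdx l i))
    have h4 : (|q (xIdx l i)| - r) ^ 2 ≤ p (xIdx l i) ^ 2 := by
      rw [← sq_abs (p (xIdx l i))]
      exact pow_le_pow_left₀ hqr.le (by linarith) 2
    exact (min_le_right _ _).trans (by linarith)
  set A : ℝ := 2 * (K * (8 * l * K) ^ (2 * l)) / c with hA
  have hl0 : (0 : ℝ) < l := by exact_mod_cast hl
  have hA0 : 0 < A := by positivity
  have hvol0 : 0 < volume.real B :=
    ENNReal.toReal_pos (Metric.measure_ball_pos volume q hr).ne' measure_ball_lt_top.ne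
  refine lt_of_lt_of_le (b := volume.real B / (2 * A)) (by positivity) (le_csInf ?_ ?_)
  · obtain ⟨S, hS⟩ := hC.isBounded.exists_norm_le
    let f : ContDiffBump (0 : EuclideanSpace ℝ (Fin (2 * l + 1))) :=
      { rIn := |S| + 1, rOut := |S| + 2, rIn_pos := by positivity, rIn_lt_rOut := by linarith }
    refine ⟨_, f, f.contDiff, f.hasCompactSupport, fun x => f.nonneg,
      ⟨Metric.ball 0 (|S| + 1), Metric.isOpen_ball, fun x hx => ?_, fun x hx => ?_⟩, rfl⟩
    · rw [mem_ball_zero_iff]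
      linarith [hS x hx, le_abs_self S]
    · exact f.one_of_mem_closedBall (Metric.ball_subset_closedBall hx)
  · rintro I ⟨u, hu, huc, -, ⟨V, -, hCV, hV⟩, rfl⟩
    have hu1 : ContDiff ℝ 1 u := hu.of_le (by exact_mod_cast le_top)
    have key := measure_le_lintegral_heisGradSq hl i hu1 huc hR0 hK hc0 (min_le_left _ _)
      measurableSet_ball hBR hBc fun p hp => hV p (hCV (interior_subset (hball hp)))
    have hcont : Continuous fun p => heisGradSq l u p ^ ((2 * l + 1 : ℝ) / 2) :=
      (continuous_heisGradSq l hu1).rpow_const fun _ => Or.inr (by positivity)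
    have hint := hcont.integrable_of_hasCompactSupport (μ := volume)
      (hasCompactSupport_heisGradSq_rpow l huc)
    have hnn : ∀ p, 0 ≤ heisGradSq l u p ^ ((2 * l + 1 : ℝ) / 2) := fun p =>
      Real.rpow_nonneg (heisGradSq_nonneg l u p) _
    rw [← ofReal_integral_eq_lintegral_ofReal hint (ae_of_all _ hnn),
      ← ENNReal.ofReal_mul hA0.le, ← ofReal_measureReal measure_ball_lt_top.ne,
      ← ENNReal.ofReal_mul (by norm_num),
      ENNReal.ofReal_le_ofReal_iff (mul_nonneg hA0.le (integral_nonneg hnn))] at key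
    change volume.real B / (2 * A) ≤ ∫ p, heisGradSq l u p ^ ((2 * l + 1 : ℝ) / 2)
    rw [div_le_iff₀ (by positivity)]
    linarith
end

section
/- The Heisenberg group as a sub-Riemannian (Carnot–Carathéodory) manifold is conformally parabolic. Concretely: on ℝ^{2l+1} with coordinates (x_1,…,x_l, y_1,…,y_l, t), let X_i = ∂_{x_i} − (y_i/2)∂_t and Y_i = ∂_{y_i} + (x_i/2)∂_t span the horizontal bundle, so the horizontal gradient satisfies ‖∇_H u‖² = Σ_i (X_i u)² + Σ_i (Y_i u)², and let m = 2l+2 be the Hausdorff dimension of the Carnot–Carathéodory metric, whose Hausdorff volume is Lebesgue measure. Then for every compact set C ⊂ ℝ^{2l+1}, inf { ∫ ( Σ_i (X_i u)² + Σ_i (Y_i u)² )^{m/2} dx : u smooth, compactly supported, 0 ≤ u, u ≡ 1 on a neighborhood of C } = 0. -/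
open MeasureTheory Set

/-- The diagonal map `p ↦ (w j * p j)_j` of `ℝ^n`. -/
noncomputable def diagCLM {n : ℕ} (w : Fin n → ℝ) :
    EuclideanSpace ℝ (Fin n) →L[ℝ] EuclideanSpace ℝ (Fin n) :=
  Matrix.toEuclideanCLM (𝕜 := ℝ) (Matrix.diagonal w)

lemma diagCLM_apply {n : ℕ} (w : Fin n → ℝ) (p : EuclideanSpace ℝ (Fin n)) (j : Fin n) :
    diagCLM w p j = w j * p j := by
  simp [diagCLM, Matrix.ofLp_toEuclideanCLM, Matrix.mulVec_diagonal]

lemma diagCLM_single {n : ℕ} (w : Fin n → ℝ) (j : Fin n) :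
    diagCLM w (EuclideanSpace.single j 1) = w j • EuclideanSpace.single j (1 : ℝ) := by
  ext i
  by_cases h : i = j
  · subst h; simp [diagCLM_apply]
  · simp [diagCLM_apply, h]

lemma norm_diagCLM_le {n : ℕ} {w v : Fin n → ℝ} {c : ℝ} (hc : 0 ≤ c)
    (h : ∀ j, |w j| ≤ c * |v j|) (p : EuclideanSpace ℝ (Fin n)) :
    ‖diagCLM w p‖ ≤ c * ‖diagCLM v p‖ := by
  rw [← abs_of_nonneg hc, ← Real.norm_eq_abs, ← norm_smul, EuclideanSpace.norm_eq,
    EuclideanSpace.norm_eq]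
  refine Real.sqrt_le_sqrt (Finset.sum_le_sum fun j _ => ?_)
  refine pow_le_pow_left₀ (norm_nonneg _) ?_ 2
  simp only [PiLp.smul_apply, diagCLM_apply, smul_eq_mul, Real.norm_eq_abs, abs_mul,
    abs_of_nonneg hc]
  rw [← mul_assoc]
  exact mul_le_mul_of_nonneg_right (h j) (abs_nonneg _)

lemma det_diagCLM {n : ℕ} (w : Fin n → ℝ) :
    LinearMap.det (diagCLM w : EuclideanSpace ℝ (Fin n) →ₗ[ℝ] EuclideanSpace ℝ (Fin n)) =
      ∏ j, w j := by
  rw [diagCLM, Matrix.coe_toEuclideanCLM_eq_toEuclideanLin, Matrix.toEuclideanLin,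
    Matrix.toLpLin_eq_toLin,
    LinearMap.det_toLin, Matrix.det_diagonal]

/-- The weights of the Heisenberg dilation `(x, y, t) ↦ (r x, r y, r² t)`. -/
def dilationWeight (l : ℕ) (r : ℝ) (j : Fin (2 * l + 1)) : ℝ :=
  if j = tIdx l then r ^ 2 else r

lemma dilationWeight_xIdx (l : ℕ) (r : ℝ) (i : Fin l) : dilationWeight l r (xIdx l i) = r := by
  have : xIdx l i ≠ tIdx l := by
    have := i.isLt
    simp only [xIdx, tIdx, ne_eq, Fin.mk.injEq]; omega
  simp [dilationWeight, this]

lemma dilationWeight_yIdx (l : ℕ) (r : ℝ) (i : Fin l) : dilationWeight l r (yIdx l i) = r := by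
  have : yIdx l i ≠ tIdx l := by
    have := i.isLt
    simp only [yIdx, tIdx, ne_eq, Fin.mk.injEq]; omega
  simp [dilationWeight, this]

lemma dilationWeight_tIdx (l : ℕ) (r : ℝ) : dilationWeight l r (tIdx l) = r ^ 2 := by
  simp [dilationWeight]

lemma prod_dilationWeight (l : ℕ) (r : ℝ) : ∏ j, dilationWeight l r j = r ^ (2 * l + 2) := by
  have : tIdx l = Fin.last (2 * l) := rfl
  rw [Fin.prod_univ_castSucc]
  simp [dilationWeight, this, Fin.castSucc_ne_last, pow_add]

/-- The Heisenberg dilation `(x, y, t) ↦ (r x, r y, r² t)`. -/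
noncomputable def dilation (l : ℕ) (r : ℝ) :
    EuclideanSpace ℝ (Fin (2 * l + 1)) →L[ℝ] EuclideanSpace ℝ (Fin (2 * l + 1)) :=
  diagCLM (dilationWeight l r)

lemma norm_dilation_le {l : ℕ} {r s c : ℝ} (hr : 0 ≤ r) (hs : 0 ≤ s) (hc : 0 ≤ c) (hc1 : c ≤ 1)
    (h : r ≤ c * s) (p : EuclideanSpace ℝ (Fin (2 * l + 1))) :
    ‖dilation l r p‖ ≤ c * ‖dilation l s p‖ := by
  refine norm_diagCLM_le hc (fun j => ?_) p
  unfold dilationWeight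
  split_ifs
  · rw [abs_of_nonneg (by positivity), abs_of_nonneg (by positivity)]
    calc r ^ 2 ≤ (c * s) ^ 2 := pow_le_pow_left₀ hr h 2
      _ = c * (c * s ^ 2) := by ring
      _ ≤ c * (1 * s ^ 2) := by gcongr
      _ = c * s ^ 2 := by ring
  · rwa [abs_of_nonneg hr, abs_of_nonneg hs]

lemma norm_le_dilation {l : ℕ} {r : ℝ} (hr : 0 < r) (hr1 : r ≤ 1)
    (p : EuclideanSpace ℝ (Fin (2 * l + 1))) :
    ‖p‖ ≤ (r ^ 2)⁻¹ * ‖dilation l r p‖ := by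
  have h1 : diagCLM (fun _ => (1 : ℝ)) p = p := by ext; simp [diagCLM_apply]
  conv_lhs => rw [← h1]
  refine norm_diagCLM_le (by positivity) (fun j => ?_) p
  rw [inv_mul_eq_div, le_div_iff₀ (by positivity), abs_one, one_mul]
  unfold dilationWeight
  split_ifs
  · exact le_abs_self _
  · rw [abs_of_pos hr]; nlinarith

lemma norm_dilation_le_mul {l : ℕ} {r : ℝ} (hr : 0 ≤ r) (hr1 : r ≤ 1)
    (p : EuclideanSpace ℝ (Fin (2 * l + 1))) : ‖dilation l r p‖ ≤ r * ‖p‖ := by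
  have h1 : dilation l 1 p = p := by ext; simp [dilation, diagCLM_apply, dilationWeight]
  simpa [h1] using norm_dilation_le hr zero_le_one hr hr1 (by simp) p

/-- The integrand `‖∇_H u‖^{2l+2}` at `p`, as a function of the differential of `u` at `p`. -/
noncomputable def horizontalEnergy (l : ℕ) (p : EuclideanSpace ℝ (Fin (2 * l + 1)))
    (L : EuclideanSpace ℝ (Fin (2 * l + 1)) →L[ℝ] ℝ) : ℝ :=
  (∑ i, (L (EuclideanSpace.single (xIdx l i) 1)
      - p (yIdx l i) / 2 * L (EuclideanSpace.single (tIdx l) 1)) ^ 2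
    + ∑ i, (L (EuclideanSpace.single (yIdx l i) 1)
      + p (xIdx l i) / 2 * L (EuclideanSpace.single (tIdx l) 1)) ^ 2) ^ (l + 1)

lemma horizontalEnergy_zero (l : ℕ) (p : EuclideanSpace ℝ (Fin (2 * l + 1))) :
    horizontalEnergy l p 0 = 0 := by
  simp [horizontalEnergy]

lemma horizontalEnergy_nonneg (l : ℕ) (p : EuclideanSpace ℝ (Fin (2 * l + 1)))
    (L : EuclideanSpace ℝ (Fin (2 * l + 1)) →L[ℝ] ℝ) : 0 ≤ horizontalEnergy l p L := by
  unfold horizontalEnergy; positivity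

lemma horizontalEnergy_smul (l : ℕ) (p : EuclideanSpace ℝ (Fin (2 * l + 1))) (c : ℝ)
    (L : EuclideanSpace ℝ (Fin (2 * l + 1)) →L[ℝ] ℝ) :
    horizontalEnergy l p (c • L) = c ^ (2 * l + 2) * horizontalEnergy l p L := by
  unfold horizontalEnergy
  rw [show 2 * l + 2 = 2 * (l + 1) by ring, pow_mul, ← mul_pow, mul_add, Finset.mul_sum,
    Finset.mul_sum]
  congr 2 <;> refine Finset.sum_congr rfl fun i _ => ?_ <;>
    simp only [smul_apply, smul_eq_mul] <;> ring

lemma horizontalEnergy_comp_dilation (l : ℕ) (p : EuclideanSpace ℝ (Fin (2 * l + 1))) (r : ℝ)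
    (L : EuclideanSpace ℝ (Fin (2 * l + 1)) →L[ℝ] ℝ) :
    horizontalEnergy l p (L.comp (dilation l r)) =
      r ^ (2 * l + 2) * horizontalEnergy l (dilation l r p) L := by
  unfold horizontalEnergy
  rw [show 2 * l + 2 = 2 * (l + 1) by ring, pow_mul, ← mul_pow, mul_add, Finset.mul_sum,
    Finset.mul_sum]
  congr 2 <;> refine Finset.sum_congr rfl fun i _ => ?_ <;>
    simp only [ContinuousLinearMap.comp_apply, dilation, diagCLM_single, diagCLM_apply, map_smul,
      dilationWeight_xIdx, dilationWeight_yIdx, dilationWeight_tIdx, smul_eq_mul] <;> ring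

lemma integrand_eq_horizontalEnergy (l : ℕ) (u : EuclideanSpace ℝ (Fin (2 * l + 1)) → ℝ)
    (x : EuclideanSpace ℝ (Fin (2 * l + 1))) :
    (∑ i, Xfield l u x i ^ 2 + ∑ i, Yfield l u x i ^ 2) ^ ((2 * l + 2 : ℝ) / 2) =
      horizontalEnergy l x (fderiv ℝ u x) := by
  rw [show (2 * l + 2 : ℝ) / 2 = ((l + 1 : ℕ) : ℝ) by push_cast; ring, Real.rpow_natCast]
  rfl

lemma integrable_horizontalEnergy {l : ℕ} {u : EuclideanSpace ℝ (Fin (2 * l + 1)) → ℝ}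
    (hu : ContDiff ℝ (⊤ : ℕ∞) u) (hc : HasCompactSupport u) :
    Integrable fun x => horizontalEnergy l x (fderiv ℝ u x) := by
  have hd : Continuous (fderiv ℝ u) := hu.continuous_fderiv (by simp)
  refine Continuous.integrable_of_hasCompactSupport ?_ ?_
  · unfold horizontalEnergy
    fun_prop
  · refine (hc.fderiv ℝ).mono fun x hx => ?_
    contrapose! hx
    simp only [Function.mem_support, not_not] at hx ⊢
    rw [hx, horizontalEnergy_zero]

lemma integral_horizontalEnergy_comp_dilation {l : ℕ} {r : ℝ} (hr : 0 < r)
    {u : EuclideanSpace ℝ (Fin (2 * l + 1)) → ℝ} (hu : Differentiable ℝ u) :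
    ∫ x, horizontalEnergy l x (fderiv ℝ (u ∘ dilation l r) x) =
      ∫ x, horizontalEnergy l x (fderiv ℝ u x) := by
  have hdet : LinearMap.det (dilation l r : EuclideanSpace ℝ (Fin (2 * l + 1)) →ₗ[ℝ]
      EuclideanSpace ℝ (Fin (2 * l + 1))) = r ^ (2 * l + 2) := by
    rw [dilation, det_diagCLM, prod_dilationWeight]
  have hpos : 0 < r ^ (2 * l + 2) := by positivity
  have hmap := Measure.map_linearMap_addHaar_eq_smul_addHaar
    (volume : Measure (EuclideanSpace ℝ (Fin (2 * l + 1)))) (hdet ▸ hpos.ne')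
  have hemb : MeasurableEmbedding (dilation l r) := by
    refine (dilation l r).continuous.measurableEmbedding ?_
    exact (LinearMap.equivOfDetNeZero _ (hdet ▸ hpos.ne')).injective
  have hfd : ∀ x, fderiv ℝ (u ∘ dilation l r) x =
      (fderiv ℝ u (dilation l r x)).comp (dilation l r) := fun x => by
    rw [fderiv_comp x (hu _) (dilation l r).differentiableAt, ContinuousLinearMap.fderiv]
  simp only [hfd, horizontalEnergy_comp_dilation]
  rw [integral_const_mul,
    ← hemb.integral_map (fun y => horizontalEnergy l y (fderiv ℝ u y))]
  rw [ContinuousLinearMap.coe_coe] at hmap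
  rw [hmap, integral_smul_measure, hdet, ENNReal.toReal_ofReal (abs_nonneg _),
    abs_of_pos (by positivity), smul_eq_mul, ← mul_assoc, mul_inv_cancel₀ hpos.ne', one_mul]

lemma map_sum_of_subsingleton_support {ι M N : Type*} [AddCommMonoid M] [AddCommMonoid N]
    (f : M → N) (hf : f 0 = 0) (s : Finset ι) (a : ι → M)
    (h : ∀ i ∈ s, ∀ j ∈ s, a i ≠ 0 → a j ≠ 0 → i = j) :
    f (∑ i ∈ s, a i) = ∑ i ∈ s, f (a i) := by
  by_cases hne : ∃ i ∈ s, a i ≠ 0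
  · obtain ⟨i, hi, hai⟩ := hne
    have h0 : ∀ j ∈ s, j ≠ i → a j = 0 := fun j hj hji => by
      by_contra haj
      exact hji (h j hj i hi haj hai)
    rw [Finset.sum_eq_single_of_mem i hi h0,
      Finset.sum_eq_single_of_mem i hi fun j hj hji => by rw [h0 j hj hji, hf]]
  · push Not at hne
    rw [Finset.sum_eq_zero hne, hf, Finset.sum_eq_zero fun i hi => by rw [hne i hi, hf]]

lemma fderiv_bump_eq_zero {E : Type*} [NormedAddCommGroup E] [NormedSpace ℝ E]
    [HasContDiffBump E] (φ : ContDiffBump (0 : E)) {q : E} (hq : ‖q‖ < φ.rIn ∨ φ.rOut < ‖q‖) :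
    fderiv ℝ φ q = 0 := by
  rcases hq with hq | hq
  · have : (φ : E → ℝ) =ᶠ[nhds q] fun _ => 1 :=
      φ.eventuallyEq_one_of_mem_ball (by simpa using hq)
    rw [this.fderiv_eq, fderiv_const_apply]
  · refine image_eq_zero_of_notMem_tsupport fun h => ?_
    have := tsupport_fderiv_subset ℝ h
    rw [φ.tsupport_eq] at this
    simp only [mem_closedBall_zero_iff] at this
    linarith

/-- Averages of a bump function over geometrically separated dilations have small energy. -/
lemma exists_cutoff_energy_eq (l : ℕ) (φ : ContDiffBump (0 : EuclideanSpace ℝ (Fin (2 * l + 1))))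
    (hin : φ.rIn = 1) (hout : φ.rOut = 2) {R : ℝ} (hR : 1 ≤ R) (n : ℕ) :
    ∃ u : EuclideanSpace ℝ (Fin (2 * l + 1)) → ℝ,
      ContDiff ℝ (⊤ : ℕ∞) u ∧ HasCompactSupport u ∧ (∀ x, 0 ≤ u x) ∧
      (∀ x ∈ Metric.ball 0 R, u x = 1) ∧
      ∫ x, horizontalEnergy l x (fderiv ℝ u x) =
        (((n : ℝ) + 1)⁻¹) ^ (2 * l + 1) * ∫ x, horizontalEnergy l x (fderiv ℝ φ x) := by
  set r : ℕ → ℝ := fun k => R⁻¹ * (1 / 3) ^ k with hr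
  have hR0 : 0 < R := by linarith
  have hr0 : ∀ k, 0 < r k := fun k => by positivity
  have hrR : ∀ k, r k ≤ R⁻¹ := fun k =>
    mul_le_of_le_one_right (by positivity) (pow_le_one₀ (by norm_num) (by norm_num))
  have hr1 : ∀ k, r k ≤ 1 := fun k => (hrR k).trans (inv_le_one_of_one_le₀ hR)
  have hsep : ∀ j k, j < k → r k ≤ 1 / 3 * r j := fun j k hjk => by
    have : ((1 : ℝ) / 3) ^ k ≤ (1 / 3) ^ (j + 1) :=
      pow_le_pow_of_le_one (by norm_num) (by norm_num) hjk
    calc r k ≤ R⁻¹ * (1 / 3) ^ (j + 1) := by simp only [hr]; gcongr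
      _ = 1 / 3 * r j := by simp only [hr]; ring
  have hφ : ContDiff ℝ (⊤ : ℕ∞) φ := φ.contDiff
  have hcd : ∀ k, ContDiff ℝ (⊤ : ℕ∞) (φ ∘ dilation l (r k)) := fun k =>
    hφ.comp (dilation l (r k)).contDiff
  have hdiff : ∀ k, Differentiable ℝ (φ ∘ dilation l (r k)) := fun k =>
    (hcd k).differentiable (by simp)
  have hsupp : ∀ k, HasCompactSupport (φ ∘ dilation l (r k)) := fun k => by
    refine HasCompactSupport.intro (isCompact_closedBall 0 ((r k ^ 2)⁻¹ * 2)) fun x hx => ?_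
    refine φ.zero_of_le_dist ?_
    rw [mem_closedBall_zero_iff, not_le] at hx
    rw [dist_zero_right, hout]
    exact (lt_of_mul_lt_mul_left (hx.trans_le (norm_le_dilation (hr0 k) (hr1 k) x))
      (by have := hr0 k; positivity)).le
  have hn : (0 : ℝ) < (n : ℝ) + 1 := by positivity
  have hsum : ContDiff ℝ (⊤ : ℕ∞) fun x => ∑ k ∈ Finset.range (n + 1), φ (dilation l (r k) x) :=
    ContDiff.sum fun k _ => hcd k
  set u : EuclideanSpace ℝ (Fin (2 * l + 1)) → ℝ := fun x =>
    ((n : ℝ) + 1)⁻¹ * ∑ k ∈ Finset.range (n + 1), φ (dilation l (r k) x) with hu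
  have hfd : ∀ x, fderiv ℝ u x = ((n : ℝ) + 1)⁻¹ •
      ∑ k ∈ Finset.range (n + 1), fderiv ℝ (φ ∘ dilation l (r k)) x := fun x => by
    rw [hu, fderiv_const_mul (hsum.differentiable (by simp) x)]
    exact congrArg _ (fderiv_fun_sum fun k _ => hdiff k x)
  have hzero : ∀ k x, fderiv ℝ (φ ∘ dilation l (r k)) x ≠ 0 →
      1 ≤ ‖dilation l (r k) x‖ ∧ ‖dilation l (r k) x‖ ≤ 2 := fun k x hx => by
    rw [fderiv_comp x (hφ.differentiable (by simp) _) (dilation l (r k)).differentiableAt] at hx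
    have h0 : ¬(‖dilation l (r k) x‖ < φ.rIn ∨ φ.rOut < ‖dilation l (r k) x‖) := fun h =>
      hx (by rw [fderiv_bump_eq_zero φ h, ContinuousLinearMap.zero_comp])
    rwa [hin, hout, not_or, not_lt, not_lt] at h0
  have henergy : ∀ x, horizontalEnergy l x (fderiv ℝ u x) =
      (((n : ℝ) + 1)⁻¹) ^ (2 * l + 2) * ∑ k ∈ Finset.range (n + 1),
        horizontalEnergy l x (fderiv ℝ (φ ∘ dilation l (r k)) x) := fun x => by
    rw [hfd, horizontalEnergy_smul, map_sum_of_subsingleton_support (horizontalEnergy l x)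
      (horizontalEnergy_zero l x)]
    have hlt : ∀ j k, j < k → fderiv ℝ (φ ∘ dilation l (r j)) x ≠ 0 →
        fderiv ℝ (φ ∘ dilation l (r k)) x ≠ 0 → False := fun j k hjk hj hk => by
      have := norm_dilation_le (l := l) (hr0 k).le (hr0 j).le (by norm_num) (by norm_num)
        (hsep j k hjk) x
      linarith [(hzero j x hj).2, (hzero k x hk).1]
    intro j _ k _ hj hk
    rcases lt_trichotomy j k with h | h | h
    · exact (hlt j k h hj hk).elim
    · exact h
    · exact (hlt k j h hk hj).elim
  refine ⟨u, contDiff_const.mul hsum, ?_, fun x => ?_, fun x hx => ?_, ?_⟩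
  · have : HasCompactSupport
        fun x => ∑ k ∈ Finset.range (n + 1), φ (dilation l (r k) x) := by
      refine HasCompactSupport.intro
        ((Finset.range (n + 1)).isCompact_biUnion fun k _ => hsupp k) fun x hx => ?_
      refine Finset.sum_eq_zero fun k hk => ?_
      exact image_eq_zero_of_notMem_tsupport (f := φ ∘ dilation l (r k))
        fun h => hx (mem_biUnion hk h)
    exact this.mul_left
  · have : ∀ k, 0 ≤ φ (dilation l (r k) x) := fun k => φ.nonneg
    exact mul_nonneg (by positivity) (Finset.sum_nonneg fun k _ => this k)
  · have hone : ∀ k ∈ Finset.range (n + 1), φ (dilation l (r k) x) = 1 := fun k _ => by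
      refine φ.one_of_mem_closedBall ?_
      rw [mem_ball_zero_iff] at hx
      rw [mem_closedBall_zero_iff, hin]
      calc ‖dilation l (r k) x‖ ≤ r k * ‖x‖ := norm_dilation_le_mul (hr0 k).le (hr1 k) x
        _ ≤ R⁻¹ * R := by gcongr; exact hrR k
        _ = 1 := inv_mul_cancel₀ hR0.ne'
    simp only [hu]
    rw [Finset.sum_congr rfl hone]
    simp [hn.ne']
  · simp only [henergy]
    rw [integral_const_mul,
      integral_finsetSum _ fun k _ => integrable_horizontalEnergy (hcd k) (hsupp k),
      Finset.sum_congr rfl fun k _ => integral_horizontalEnergy_comp_dilation (hr0 k)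
        (hφ.differentiable (by simp))]
    simp only [Finset.sum_const, Finset.card_range, nsmul_eq_mul, Nat.cast_add, Nat.cast_one]
    rw [pow_succ, mul_assoc, inv_mul_cancel_left₀ hn.ne']

/-- The Heisenberg group as a sub-Riemannian (Carnot–Carathéodory) manifold is
conformally parabolic: the horizontal conformal capacity (with `m = 2l+2`, the
Hausdorff dimension) of every compact set relative to the whole space is zero. -/
theorem heisenberg_subriemannian_conformally_parabolic (l : ℕ) (hl : 1 ≤ l)
    (C : Set (EuclideanSpace ℝ (Fin (2 * l + 1)))) (hC : IsCompact C) :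
    sInf { I : ℝ | ∃ u : EuclideanSpace ℝ (Fin (2 * l + 1)) → ℝ,
      ContDiff ℝ (⊤ : ℕ∞) u ∧ HasCompactSupport u ∧ (∀ x, 0 ≤ u x) ∧
      (∃ V, IsOpen V ∧ C ⊆ V ∧ ∀ x ∈ V, u x = 1) ∧
      I = ∫ x, (∑ i, Xfield l u x i ^ 2 + ∑ i, Yfield l u x i ^ 2)
            ^ ((2 * l + 2 : ℝ) / 2) } = 0 := by
  simp only [integrand_eq_horizontalEnergy]
  obtain ⟨R, hR, hCR⟩ := hC.isBounded.subset_ball_lt 1 0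
  let φ : ContDiffBump (0 : EuclideanSpace ℝ (Fin (2 * l + 1))) :=
    ⟨1, 2, zero_lt_one, one_lt_two⟩
  have hnonneg : ∀ u : EuclideanSpace ℝ (Fin (2 * l + 1)) → ℝ,
      0 ≤ ∫ x, horizontalEnergy l x (fderiv ℝ u x) := fun u =>
    integral_nonneg fun x => horizontalEnergy_nonneg l x _
  refine le_antisymm ?_ (Real.sInf_nonneg ?_)
  · have hlim : Filter.Tendsto (fun n : ℕ => (((n : ℝ) + 1)⁻¹) ^ (2 * l + 1) *
        ∫ x, horizontalEnergy l x (fderiv ℝ φ x)) Filter.atTop (nhds 0) := by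
      have h := ((tendsto_one_div_add_atTop_nhds_zero_nat (𝕜 := ℝ)).pow (2 * l + 1)).mul_const
        (∫ x, horizontalEnergy l x (fderiv ℝ φ x))
      simpa using h
    refine ge_of_tendsto' hlim fun n => csInf_le ⟨0, ?_⟩ ?_
    · rintro _ ⟨u, -, -, -, -, rfl⟩
      exact hnonneg u
    · obtain ⟨u, hu, hc, h0, h1, hI⟩ := exists_cutoff_energy_eq l φ rfl rfl hR.le n
      exact ⟨u, hu, hc, h0, ⟨_, Metric.isOpen_ball, hCR, h1⟩, hI.symm⟩
  · rintro _ ⟨u, -, -, -, -, rfl⟩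
    exact hnonneg u
end

section
/- The n-Dirichlet integral and hence the conformal capacity are conformal invariants: let n ≥ 2, let Ω, Ω′ ⊆ ℝⁿ be open, and let φ : Ω → Ω′ be a C¹ diffeomorphism that is conformal at every point of Ω (its derivative at each point is a nonzero conformal linear map). Then (a) for every smooth u : ℝⁿ → ℝ with compact support contained in Ω′, ∫_Ω ‖∇(u∘φ)(x)‖ⁿ dx = ∫_{Ω′} ‖∇u(y)‖ⁿ dy; and (b) for every compact C and open D with C ⊂ D ⊆ Ω′, cap_n(φ⁻¹(C), φ⁻¹(D)) = cap_n(C, D). -/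
open MeasureTheory Metric Set

open Filter Topology Convolution

/-- `u` is an admissible function of class `C^m` for the capacity of `C` relative to `D`. -/
structure IsCapacityTest {E : Type*} [NormedAddCommGroup E] [NormedSpace ℝ E]
    (m : WithTop ℕ∞) (C D : Set E) (u : E → ℝ) : Prop where
  contDiff : ContDiff ℝ m u
  hasCompactSupport : HasCompactSupport u
  tsupport_subset : tsupport u ⊆ D
  nonneg : ∀ x, 0 ≤ u x
  eq_one : ∃ V, IsOpen V ∧ C ⊆ V ∧ ∀ x ∈ V, u x = 1

/-- The set of energies defining `pCapacity` consists of the energies of the admissible functions. -/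
theorem pCapacity_eq_sInf (n : ℕ) (p : ℝ) (C D : Set (EuclideanSpace ℝ (Fin n))) :
    pCapacity n p C D = sInf {I : ℝ | ∃ u : EuclideanSpace ℝ (Fin n) → ℝ,
      IsCapacityTest (⊤ : ℕ∞) C D u ∧ I = ∫ x in D, ‖fderiv ℝ u x‖ ^ p} := by
  unfold pCapacity
  congr 1
  ext I
  constructor
  · rintro ⟨u, h₁, h₂, h₃, h₄, h₅, h₆⟩
    exact ⟨u, ⟨h₁, h₂, h₃, h₄, h₅⟩, h₆⟩
  · rintro ⟨u, ⟨h₁, h₂, h₃, h₄, h₅⟩, h₆⟩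
    exact ⟨u, h₁, h₂, h₃, h₄, h₅, h₆⟩

section Conformal

variable {E : Type*} [NormedAddCommGroup E] [InnerProductSpace ℝ E] [FiniteDimensional ℝ E]

/-- The pointwise identity behind conformal invariance of the Dirichlet integral. -/
theorem IsConformalMap.abs_det_mul_norm_pow_finrank {A : E →L[ℝ] E} (hA : IsConformalMap A)
    (L : E →L[ℝ] ℝ) :
    |A.det| * ‖L‖ ^ Module.finrank ℝ E = ‖L.comp A‖ ^ Module.finrank ℝ E := by
  obtain ⟨c, -, li, rfl⟩ := hA
  have hdet : |LinearMap.det li.toLinearMap| = 1 := by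
    rw [← LinearMap.normDet_eq_abs_det, li.normDet_eq_one]
  have hcomp : ‖L.comp li.toContinuousLinearMap‖ = ‖L‖ :=
    L.opNorm_comp_linearIsometryEquiv (li.toLinearIsometryEquiv rfl)
  have hsmul : (c • li.toContinuousLinearMap).det
      = c ^ Module.finrank ℝ E * LinearMap.det li.toLinearMap :=
    LinearMap.det_smul c li.toLinearMap
  rw [hsmul, abs_mul, hdet, ContinuousLinearMap.comp_smul, norm_smul, hcomp, mul_pow, abs_pow,
    Real.norm_eq_abs, mul_one]

variable [MeasurableSpace E] [BorelSpace E]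

/-- Conformal invariance of the Dirichlet integral with exponent the dimension. -/
theorem setIntegral_norm_fderiv_comp_pow_finrank (μ : Measure E) [μ.IsAddHaarMeasure]
    {s : Set E} (hs : IsOpen s) {φ : E → E} (hφ : DifferentiableOn ℝ φ s) (hinj : InjOn φ s)
    (hconf : ∀ x ∈ s, IsConformalMap (fderiv ℝ φ x)) {u : E → ℝ}
    (hu : ∀ x ∈ s, DifferentiableAt ℝ u (φ x)) :
    ∫ x in s, ‖fderiv ℝ (u ∘ φ) x‖ ^ Module.finrank ℝ E ∂μ
      = ∫ y in φ '' s, ‖fderiv ℝ u y‖ ^ Module.finrank ℝ E ∂μ := by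
  have hd : ∀ x ∈ s, DifferentiableAt ℝ φ x := fun x hx => hφ.differentiableAt (hs.mem_nhds hx)
  rw [integral_image_eq_integral_abs_det_fderiv_smul μ hs.measurableSet
    (fun x hx => (hd x hx).hasFDerivAt.hasFDerivWithinAt) hinj]
  refine setIntegral_congr_fun hs.measurableSet fun x hx => ?_
  rw [fderiv_comp x (hu x hx) (hd x hx), smul_eq_mul,
    (hconf x hx).abs_det_mul_norm_pow_finrank]

end Conformal

section Mollification

variable {E : Type*} [NormedAddCommGroup E] [NormedSpace ℝ E] [FiniteDimensional ℝ E]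
  [MeasurableSpace E] [BorelSpace E]

/-- The derivative of a mollified `C¹` function is the mollified derivative. -/
theorem fderiv_normed_convolution (μ : Measure E) [μ.IsAddHaarMeasure] (b : ContDiffBump (0 : E))
    {v : E → ℝ} (hv : ContDiff ℝ 1 v) (hc : HasCompactSupport v) (x : E) :
    fderiv ℝ (b.normed μ ⋆[ContinuousLinearMap.lsmul ℝ ℝ, μ] v) x
      = (b.normed μ ⋆[ContinuousLinearMap.lsmul ℝ ℝ, μ] fderiv ℝ v) x := by
  have hloc : LocallyIntegrable (b.normed μ) μ := b.continuous_normed.locallyIntegrable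
  rw [(hc.hasFDerivAt_convolution_right (ContinuousLinearMap.lsmul ℝ ℝ) hloc hv x).fderiv]
  congr 1

/-- Mollification with a small radius turns a `C¹` admissible function into a smooth one, supported
in a prescribed neighborhood of the original support. -/
theorem IsCapacityTest.normed_convolution (μ : Measure E) [μ.IsAddHaarMeasure]
    {C D : Set E} {v : E → ℝ} (hv : IsCapacityTest 1 C D v) {δ η : ℝ}
    (hδ : cthickening δ (tsupport v) ⊆ D)
    (hη : ∀ x ∈ thickening (η + η) C, v x = 1) (hη₀ : 0 < η)
    (b : ContDiffBump (0 : E)) (hbδ : b.rOut ≤ δ) (hbη : b.rOut ≤ η) :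
    IsCapacityTest (⊤ : ℕ∞) C D (b.normed μ ⋆[ContinuousLinearMap.lsmul ℝ ℝ, μ] v) ∧
      tsupport (b.normed μ ⋆[ContinuousLinearMap.lsmul ℝ ℝ, μ] v)
        ⊆ cthickening δ (tsupport v) := by
  have hsupp : tsupport (b.normed μ ⋆[ContinuousLinearMap.lsmul ℝ ℝ, μ] v)
      ⊆ cthickening δ (tsupport v) := by
    refine closure_minimal (fun x hx => ?_) isClosed_cthickening
    by_contra hxn
    have hzero : ∀ y ∈ ball x b.rOut, v y = 0 := by
      intro y hy
      by_contra hvy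
      refine hxn (thickening_subset_cthickening _ _ (mem_thickening_iff.2
        ⟨y, subset_tsupport v hvy, ?_⟩))
      rw [dist_comm]
      exact (mem_ball.1 hy).trans_le hbδ
    have hx0 := hzero x (mem_ball_self b.rOut_pos)
    refine hx ?_
    rw [b.normed_convolution_eq_right fun y hy => (hzero y hy).trans hx0.symm, hx0]
  refine ⟨⟨?_, ?_, hsupp.trans hδ, fun x => ?_, thickening η C, isOpen_thickening,
    self_subset_thickening hη₀ C, fun x hx => ?_⟩, hsupp⟩
  · exact b.hasCompactSupport_normed.contDiff_convolution_left _ b.contDiff_normed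
      hv.contDiff.continuous.locallyIntegrable
  · exact hv.hasCompactSupport.isCompact.cthickening.of_isClosed_subset isClosed_closure hsupp
  · exact integral_nonneg fun t => mul_nonneg (b.nonneg_normed t) (hv.nonneg _)
  · have hone : ∀ y ∈ ball x b.rOut, v y = 1 := by
      intro y hy
      obtain ⟨z, hz, hxz⟩ := mem_thickening_iff.1 hx
      refine hη y (mem_thickening_iff.2 ⟨z, hz, ?_⟩)
      have := dist_triangle y x z
      have := mem_ball.1 hy
      linarith
    have hx1 := hone x (mem_ball_self b.rOut_pos)
    rw [b.normed_convolution_eq_right fun y hy => (hone y hy).trans hx1.symm, hx1]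

/-- The energy of a `C¹` admissible function is approximated by energies of smooth ones. -/
theorem IsCapacityTest.exists_smooth_energy_lt (μ : Measure E) [μ.IsAddHaarMeasure]
    {C D : Set E} (hC : IsCompact C) (hD : IsOpen D) {v : E → ℝ} (hv : IsCapacityTest 1 C D v)
    {p : ℕ} (hp : p ≠ 0) {ε : ℝ} (hε : 0 < ε) :
    ∃ u, IsCapacityTest (⊤ : ℕ∞) C D u ∧
      ∫ x in D, ‖fderiv ℝ u x‖ ^ p ∂μ < (∫ x in D, ‖fderiv ℝ v x‖ ^ p ∂μ) + ε := by
  obtain ⟨V, hVo, hCV, hV⟩ := hv.eq_one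
  obtain ⟨δ, hδ₀, hδ⟩ :=
    hv.hasCompactSupport.isCompact.exists_cthickening_subset_open hD hv.tsupport_subset
  obtain ⟨η', hη'₀, hη'⟩ := hC.exists_thickening_subset_open hVo hCV
  set r : ℝ := min δ (η' / 2) with hr
  have hr₀ : 0 < r := by positivity
  have hradius : ∀ k : ℕ, r / ((k : ℝ) + 1) ≤ r := fun k =>
    div_le_self hr₀.le (by linarith [k.cast_nonneg (α := ℝ)])
  let b : ℕ → ContDiffBump (0 : E) := fun k =>
    { rIn := r / ((k : ℝ) + 1) / 2
      rOut := r / ((k : ℝ) + 1)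
      rIn_pos := by positivity
      rIn_lt_rOut := half_lt_self (by positivity) }
  have hb : Tendsto (fun k => (b k).rOut) atTop (𝓝 0) := by
    simpa [b, div_eq_mul_inv] using (tendsto_one_div_add_atTop_nhds_zero_nat (𝕜 := ℝ)).const_mul r
  let w : ℕ → E → ℝ := fun k => (b k).normed μ ⋆[ContinuousLinearMap.lsmul ℝ ℝ, μ] v
  have hw : ∀ k, IsCapacityTest (⊤ : ℕ∞) C D (w k) ∧
      tsupport (w k) ⊆ cthickening δ (tsupport v) := fun k =>
    hv.normed_convolution μ hδ (η := η' / 2)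
      (fun x hx => hV x (hη' (by rwa [add_halves] at hx))) (by positivity) (b k)
      ((hradius k).trans (min_le_left _ _)) ((hradius k).trans (min_le_right _ _))
  have hfc : Continuous (fderiv ℝ v) := hv.contDiff.continuous_fderiv one_ne_zero
  obtain ⟨M, hM⟩ := (hv.hasCompactSupport.fderiv ℝ).exists_bound_of_continuous hfc
  have hM₀ : 0 ≤ M := (norm_nonneg _).trans (hM 0)
  have hbound : ∀ k x, ‖fderiv ℝ (w k) x‖ ≤ M := fun k x => by
    rw [fderiv_normed_convolution μ (b k) hv.contDiff hv.hasCompactSupport x]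
    simpa [dist_zero_right] using dist_convolution_le (z₀ := (0 : E →L[ℝ] ℝ)) (x₀ := x) hM₀
      (b k).support_normed_eq.subset (b k).nonneg_normed (b k).integral_normed
      hfc.aestronglyMeasurable fun y _ => by simpa using hM y
  have hK : IsCompact (cthickening δ (tsupport v)) := hv.hasCompactSupport.isCompact.cthickening
  have hlim : Tendsto (fun k => ∫ x in D, ‖fderiv ℝ (w k) x‖ ^ p ∂μ) atTop
      (𝓝 (∫ x in D, ‖fderiv ℝ v x‖ ^ p ∂μ)) := by
    refine tendsto_integral_of_dominated_convergence
      ((cthickening δ (tsupport v)).indicator fun _ => M ^ p) (fun k => ?_) ?_ (fun k => ?_) ?_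
    · exact (((hw k).1.contDiff.continuous_fderiv (by simp)).norm.pow p).aestronglyMeasurable
    · exact ((integrable_indicator_iff hK.measurableSet).2
        (integrableOn_const hK.measure_lt_top.ne)).integrableOn
    · refine Eventually.of_forall fun x => ?_
      by_cases hx : x ∈ cthickening δ (tsupport v)
      · rw [indicator_of_mem hx, norm_pow, norm_norm]
        exact pow_le_pow_left₀ (norm_nonneg _) (hbound k x) p
      · have : fderiv ℝ (w k) x = 0 := by
          by_contra h
          exact hx ((hw k).2 (support_fderiv_subset ℝ h))
        rw [indicator_of_notMem hx, this]
        simp [hp]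
    · refine Eventually.of_forall fun x => ?_
      simp only [w, fderiv_normed_convolution μ _ hv.contDiff hv.hasCompactSupport]
      exact ((ContDiffBump.convolution_tendsto_right_of_continuous hb hfc x).norm).pow p
  obtain ⟨k, hk⟩ := (hlim.eventually_lt_const (lt_add_of_pos_right _ hε)).exists
  exact ⟨w k, (hw k).1, hk⟩

end Mollification

section Pullback

variable {E : Type*} [NormedAddCommGroup E] [NormedSpace ℝ E]

/-- The pullback of an admissible function by a `C¹` diffeomorphism, extended by zero, is a `C¹`
admissible function. -/
theorem IsCapacityTest.indicator_comp {C D D' : Set E} {m : WithTop ℕ∞} (hm : 1 ≤ m)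
    {u : E → ℝ} (hu : IsCapacityTest m C D u) (hD' : IsOpen D') {φ ψ : E → E}
    (hφ : ContDiffOn ℝ 1 φ D') (hψ : ContinuousOn ψ D) (hψmaps : MapsTo ψ D D')
    (hleft : ∀ x ∈ D', ψ (φ x) = x) (hright : ∀ y ∈ D, φ (ψ y) = y) (hCD : C ⊆ D) :
    IsCapacityTest 1 (ψ '' C) D' (D'.indicator (u ∘ φ)) := by
  have hK : IsCompact (ψ '' tsupport u) :=
    hu.hasCompactSupport.isCompact.image_of_continuousOn (hψ.mono hu.tsupport_subset)
  have hKD : ψ '' tsupport u ⊆ D' := (hψmaps.mono_left hu.tsupport_subset).image_subset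
  have hsupp : tsupport (D'.indicator (u ∘ φ)) ⊆ ψ '' tsupport u := by
    refine closure_minimal (fun x hx => ?_) hK.isClosed
    have hxD : x ∈ D' := by
      by_contra h
      exact hx (indicator_of_notMem h _)
    refine ⟨φ x, subset_tsupport u fun h => hx ?_, hleft x hxD⟩
    rw [indicator_of_mem hxD, Function.comp_apply, h]
  refine ⟨?_, hK.of_isClosed_subset isClosed_closure hsupp, hsupp.trans hKD,
    fun x => indicator_nonneg (fun x _ => hu.nonneg _) x, ?_⟩
  · refine contDiff_iff_contDiffAt.2 fun x => ?_
    by_cases hx : x ∈ tsupport (D'.indicator (u ∘ φ))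
    swap
    · exact contDiffAt_const.congr_of_eventuallyEq (notMem_tsupport_iff_eventuallyEq.1 hx)
    have hxD : D' ∈ 𝓝 x := hD'.mem_nhds (hKD (hsupp hx))
    refine ((hu.contDiff.of_le hm).contDiffAt.comp x (hφ.contDiffAt hxD)).congr_of_eventuallyEq ?_
    filter_upwards [hxD] with y hy using indicator_of_mem hy _
  · obtain ⟨V, hVo, hCV, hV⟩ := hu.eq_one
    refine ⟨D' ∩ φ ⁻¹' V, hφ.continuousOn.isOpen_inter_preimage hD' hVo, ?_, fun x hx => ?_⟩
    · rintro _ ⟨y, hy, rfl⟩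
      refine ⟨hψmaps (hCD hy), ?_⟩
      rw [mem_preimage, hright y (hCD hy)]
      exact hCV hy
    · rw [indicator_of_mem hx.1]
      exact hV _ hx.2

end Pullback

/-- A `C¹` diffeomorphism pulling back energies to energies does not increase the capacity, up to
an arbitrarily small error on the level of admissible functions. -/
theorem IsCapacityTest.exists_pullback_energy_lt {E : Type*} [NormedAddCommGroup E]
    [NormedSpace ℝ E] [FiniteDimensional ℝ E] [MeasurableSpace E] [BorelSpace E]
    (μ : Measure E) [μ.IsAddHaarMeasure] {C D D' : Set E} (hC : IsCompact C) (hCD : C ⊆ D)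
    (hD' : IsOpen D') {φ ψ : E → E}
    (hφ : ContDiffOn ℝ 1 φ D') (hψ : ContinuousOn ψ D) (hψmaps : MapsTo ψ D D')
    (hleft : ∀ x ∈ D', ψ (φ x) = x) (hright : ∀ y ∈ D, φ (ψ y) = y) {p : ℕ} (hp : p ≠ 0)
    {u : E → ℝ} (hu : IsCapacityTest (⊤ : ℕ∞) C D u)
    (henergy : ∫ x in D', ‖fderiv ℝ (u ∘ φ) x‖ ^ p ∂μ = ∫ y in D, ‖fderiv ℝ u y‖ ^ p ∂μ)
    {ε : ℝ} (hε : 0 < ε) :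
    ∃ w, IsCapacityTest (⊤ : ℕ∞) (ψ '' C) D' w ∧
      ∫ x in D', ‖fderiv ℝ w x‖ ^ p ∂μ < (∫ y in D, ‖fderiv ℝ u y‖ ^ p ∂μ) + ε := by
  have hv := hu.indicator_comp (by exact_mod_cast le_top) hD' hφ hψ hψmaps hleft hright hCD
  obtain ⟨w, hw, hlt⟩ := hv.exists_smooth_energy_lt μ
    (hC.image_of_continuousOn (hψ.mono hCD)) hD' hp hε
  refine ⟨w, hw, hlt.trans_eq ?_⟩
  rw [← henergy]
  congr 1
  refine setIntegral_congr_fun hD'.measurableSet fun x hx => ?_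
  have : D'.indicator (u ∘ φ) =ᶠ[𝓝 x] u ∘ φ := by
    filter_upwards [hD'.mem_nhds hx] with y hy using indicator_of_mem hy _
  simp only [this.fderiv_eq]

/-- Two sets of nonnegative reals have the same infimum if each element of one is approximated from
above by elements of the other. -/
theorem Real.sInf_eq_sInf_of_forall_exists_lt_add {S T : Set ℝ} (hS : ∀ a ∈ S, 0 ≤ a)
    (hT : ∀ a ∈ T, 0 ≤ a) (hST : ∀ a ∈ S, ∀ ε > 0, ∃ c ∈ T, c < a + ε)
    (hTS : ∀ a ∈ T, ∀ ε > 0, ∃ c ∈ S, c < a + ε) : sInf S = sInf T := by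
  have key : ∀ {S T : Set ℝ}, (∀ a ∈ T, 0 ≤ a) → S.Nonempty →
      (∀ a ∈ S, ∀ ε > 0, ∃ c ∈ T, c < a + ε) → sInf T ≤ sInf S := fun hT hne h =>
    le_csInf hne fun a ha => le_of_forall_pos_le_add fun ε hε => by
      obtain ⟨c, hc, hlt⟩ := h a ha ε hε
      exact (csInf_le ⟨0, hT⟩ hc).trans hlt.le
  rcases S.eq_empty_or_nonempty with rfl | hSne
  · rcases T.eq_empty_or_nonempty with rfl | ⟨a, ha⟩
    · rfl
    · obtain ⟨c, hc, -⟩ := hTS a ha 1 one_pos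
      exact hc.elim
  · obtain ⟨a, ha⟩ := hSne
    obtain ⟨c, hc, -⟩ := hST a ha 1 one_pos
    exact le_antisymm (key hS ⟨c, hc⟩ hTS) (key hT ⟨a, ha⟩ hST)

/-- The `n`-Dirichlet integral and the conformal capacity are invariant under
`C¹`-conformal diffeomorphisms `φ : Ω → Ω′` (with `C¹` inverse `ψ`). -/
theorem conformal_invariance_of_dirichlet_integral_and_capacity
    (n : ℕ) (hn : 2 ≤ n)
    (Ω Ω' : Set (EuclideanSpace ℝ (Fin n))) (hΩ : IsOpen Ω) (hΩ' : IsOpen Ω')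
    (φ ψ : EuclideanSpace ℝ (Fin n) → EuclideanSpace ℝ (Fin n))
    (hφ : ContDiffOn ℝ 1 φ Ω) (hψ : ContDiffOn ℝ 1 ψ Ω')
    (hφmaps : Set.MapsTo φ Ω Ω') (hψmaps : Set.MapsTo ψ Ω' Ω)
    (hleft : ∀ x ∈ Ω, ψ (φ x) = x) (hright : ∀ y ∈ Ω', φ (ψ y) = y)
    (hconf : ∀ x ∈ Ω, IsConformalMap (fderiv ℝ φ x)) :
    (∀ u : EuclideanSpace ℝ (Fin n) → ℝ, ContDiff ℝ (⊤ : ℕ∞) u →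
        HasCompactSupport u → tsupport u ⊆ Ω' →
        ∫ x in Ω, ‖fderiv ℝ (u ∘ φ) x‖ ^ (n : ℝ)
          = ∫ y in Ω', ‖fderiv ℝ u y‖ ^ (n : ℝ)) ∧
    (∀ C D : Set (EuclideanSpace ℝ (Fin n)), IsCompact C → IsOpen D →
        C ⊆ D → D ⊆ Ω' →
        pCapacity n n (ψ '' C) (ψ '' D) = pCapacity n n C D) := by
  have henergy : ∀ s ⊆ Ω, IsOpen s → ∀ u : EuclideanSpace ℝ (Fin n) → ℝ,
      (∀ x ∈ s, DifferentiableAt ℝ u (φ x)) →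
      ∫ x in s, ‖fderiv ℝ (u ∘ φ) x‖ ^ n = ∫ y in φ '' s, ‖fderiv ℝ u y‖ ^ n := by
    intro s hs hso u hu
    simpa only [finrank_euclideanSpace_fin] using
      setIntegral_norm_fderiv_comp_pow_finrank volume hso
        ((hφ.differentiableOn one_ne_zero).mono hs)
        ((LeftInvOn.injOn (f₁' := ψ) hleft).mono hs) (fun x hx => hconf x (hs hx)) hu
  constructor
  · intro u hu _ _
    have himage : φ '' Ω = Ω' :=
      hφmaps.image_subset.antisymm fun y hy => ⟨ψ y, hψmaps hy, hright y hy⟩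
    simp only [Real.rpow_natCast]
    rw [henergy Ω subset_rfl hΩ u fun x _ => hu.differentiable (by simp) _, himage]
  · intro C D hC hD hCD hDΩ
    have hn0 : n ≠ 0 := by omega
    have hD'Ω : ψ '' D ⊆ Ω := (hψmaps.mono_left hDΩ).image_subset
    have hD'eq : ψ '' D = Ω ∩ φ ⁻¹' D := by
      ext x
      constructor
      · rintro ⟨y, hy, rfl⟩
        exact ⟨hψmaps (hDΩ hy), by rwa [mem_preimage, hright y (hDΩ hy)]⟩
      · rintro ⟨hx, hxD⟩
        exact ⟨φ x, hxD, hleft x hx⟩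
    have hD'o : IsOpen (ψ '' D) := hD'eq ▸ hφ.continuousOn.isOpen_inter_preimage hΩ hD
    have hrightD : ∀ y ∈ D, φ (ψ y) = y := fun y hy => hright y (hDΩ hy)
    have hleftD : ∀ x ∈ ψ '' D, ψ (φ x) = x := fun x hx => hleft x (hD'Ω hx)
    have himageD : φ '' (ψ '' D) = D := LeftInvOn.image_image hrightD
    have himageC : φ '' (ψ '' C) = C := LeftInvOn.image_image fun y hy => hrightD y (hCD hy)
    have hφmapsD : MapsTo φ (ψ '' D) D := fun x hx => himageD ▸ mem_image_of_mem φ hx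
    simp only [pCapacity_eq_sInf, Real.rpow_natCast]
    refine Real.sInf_eq_sInf_of_forall_exists_lt_add ?_ ?_ ?_ ?_
    · rintro _ ⟨u, -, rfl⟩
      exact integral_nonneg fun x => by positivity
    · rintro _ ⟨u, -, rfl⟩
      exact integral_nonneg fun x => by positivity
    · rintro _ ⟨u, hu, rfl⟩ ε hε
      have hud : Differentiable ℝ u := hu.contDiff.differentiable (by simp)
      have hpull : ∫ y in D, ‖fderiv ℝ (u ∘ ψ) y‖ ^ n = ∫ x in ψ '' D, ‖fderiv ℝ u x‖ ^ n := by
        have h := henergy (ψ '' D) hD'Ω hD'o (u ∘ ψ) fun x hx =>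
          (hud _).comp _ ((hψ.differentiableOn one_ne_zero).differentiableAt
            (hΩ'.mem_nhds (hφmaps (hD'Ω hx))))
        rw [himageD] at h
        rw [← h]
        refine setIntegral_congr_fun hD'o.measurableSet fun x hx => ?_
        have : (u ∘ ψ) ∘ φ =ᶠ[𝓝 x] u := by
          filter_upwards [hD'o.mem_nhds hx] with z hz
          simp only [Function.comp_apply, hleftD z hz]
        simp only [this.fderiv_eq]
      obtain ⟨w, hw, hlt⟩ := hu.exists_pullback_energy_lt volume
        (hC.image_of_continuousOn (hψ.continuousOn.mono (hCD.trans hDΩ))) (image_mono hCD)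
        hD (hψ.mono hDΩ) (hφ.continuousOn.mono hD'Ω) hφmapsD hrightD hleftD hn0 hpull hε
      rw [himageC] at hw
      exact ⟨_, ⟨w, hw, rfl⟩, hlt⟩
    · rintro _ ⟨u, hu, rfl⟩ ε hε
      have hud : Differentiable ℝ u := hu.contDiff.differentiable (by simp)
      have hpull := henergy (ψ '' D) hD'Ω hD'o u fun x _ => hud _
      rw [himageD] at hpull
      obtain ⟨w, hw, hlt⟩ := hu.exists_pullback_energy_lt volume hC hCD hD'o (hφ.mono hD'Ω)
        (hψ.continuousOn.mono hDΩ) (mapsTo_image ψ D) hleftD hrightD hn0 hpull hε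
      exact ⟨_, ⟨w, hw, rfl⟩, hlt⟩
end

section
/- Star Lemma, part (i), Euclidean case: let n ≥ 2 and let D ⊊ ℝⁿ be an open connected set containing 0 which is star-like with respect to 0 (for every x ∈ D the segment [0,x] lies in D). Let Δ := { x ∈ ∂D : the half-open segment [0,x) is contained in D } be the part of ∂D visible from 0, let ε > 0 with closedBall(0,ε) ⊂ D, and let Γ_ε be the family of all piecewise C¹ curves γ : [0,1] → ℝⁿ with γ(0) ∈ closedBall(0,ε), γ(1) ∈ Δ, and γ([0,1)) ⊂ D. If mod_n Γ_ε = 0, then the radial projection π(x) = ε·x/‖x‖ maps Δ to a subset of the sphere of radius ε all of whose connected components are single points. -/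
open MeasureTheory Metric Set
open scoped ENNReal

/-- A path `γ : [0,1] → ℝⁿ` is piecewise `C¹` if it is continuous on `[0,1]`
and, off a finite set of parameters, differentiable with continuous
derivative. -/
def IsPiecewiseC1 {n : ℕ} (γ : ℝ → EuclideanSpace ℝ (Fin n)) : Prop :=
  ContinuousOn γ (Set.Icc 0 1) ∧
  ∃ s : Finset ℝ, ∀ t ∈ Set.Icc (0 : ℝ) 1, t ∉ s →
    DifferentiableAt ℝ γ t ∧ ContinuousAt (deriv γ) t

/-- The line integral `∫_γ ρ ds = ∫_0^1 ρ(γ(t)) ‖γ′(t)‖ dt` of a Borel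
function `ρ : ℝⁿ → [0,∞]` along a path `γ`. -/
noncomputable def lineLIntegral {n : ℕ} (ρ : EuclideanSpace ℝ (Fin n) → ℝ≥0∞)
    (γ : ℝ → EuclideanSpace ℝ (Fin n)) : ℝ≥0∞ :=
  ∫⁻ t in Set.Icc (0 : ℝ) 1, ρ (γ t) * ENNReal.ofReal ‖deriv γ t‖

/-- The conformal modulus `mod_n Γ` of a family `Γ` of piecewise `C¹` curves
in `ℝⁿ`: the infimum of `∫ ρⁿ dx` over Borel `ρ : ℝⁿ → [0,∞]` with
`∫_γ ρ ds ≥ 1` for every `γ ∈ Γ`. -/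
noncomputable def conformalModulus (n : ℕ)
    (Γ : Set (ℝ → EuclideanSpace ℝ (Fin n))) : ℝ≥0∞ :=
  ⨅ (ρ : EuclideanSpace ℝ (Fin n) → ℝ≥0∞) (_ : Measurable ρ)
    (_ : ∀ γ ∈ Γ, 1 ≤ lineLIntegral ρ γ), ∫⁻ x, ρ x ^ n

/-- The part `Δ` of `∂D` visible from `0`: boundary points `x` such that the
half-open segment `[0,x)` is contained in `D`. -/
def visibleBoundary {n : ℕ} (D : Set (EuclideanSpace ℝ (Fin n))) :
    Set (EuclideanSpace ℝ (Fin n)) :=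
  {x | x ∈ frontier D ∧ ∀ s ∈ Set.Ico (0 : ℝ) 1, s • x ∈ D}

/-- The family `Γ_ε` of piecewise `C¹` curves joining `closedBall 0 ε` to the
visible boundary `Δ` within `D`. -/
def starCurves {n : ℕ} (D : Set (EuclideanSpace ℝ (Fin n))) (ε : ℝ) :
    Set (ℝ → EuclideanSpace ℝ (Fin n)) :=
  {γ | IsPiecewiseC1 γ ∧ γ 0 ∈ closedBall (0 : EuclideanSpace ℝ (Fin n)) ε ∧
    γ 1 ∈ visibleBoundary D ∧ ∀ t ∈ Set.Ico (0 : ℝ) 1, γ t ∈ D}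

section Gauge

variable {E : Type*} [NormedAddCommGroup E] [NormedSpace ℝ E] {D : Set E} {ε : ℝ}

lemma StarConvex.gauge_lt_one_iff (hst : StarConvex ℝ 0 D) (hD : IsOpen D) (h0 : (0 : E) ∈ D)
    {x : E} : gauge D x < 1 ↔ x ∈ D := by
  refine ⟨fun h => ?_, fun h => gauge_lt_one_of_mem_of_isOpen hD h⟩
  by_contra hx
  exact absurd (one_le_gauge_of_notMem hst
    ((absorbent_nhds_zero (hD.mem_nhds h0)).absorbs_finite (finite_singleton x)) hx) (not_le.2 h)

lemma StarConvex.upperSemicontinuous_gauge (hst : StarConvex ℝ 0 D) (hD : IsOpen D)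
    (h0 : (0 : E) ∈ D) : UpperSemicontinuous (gauge D) := by
  intro x c hc
  have hcpos : 0 < c := (gauge_nonneg x).trans_lt hc
  have key : ∀ y, gauge D y < c ↔ c⁻¹ • y ∈ D := fun y => by
    rw [← hst.gauge_lt_one_iff hD h0, gauge_smul_of_nonneg (inv_nonneg.2 hcpos.le), smul_eq_mul,
      inv_mul_lt_iff₀ hcpos, mul_one]
  have : IsOpen {y : E | c⁻¹ • y ∈ D} := hD.preimage (continuous_const_smul _)
  filter_upwards [this.mem_nhds ((key x).1 hc)] with y hy using (key y).2 hy

lemma gauge_le_norm_div (hε : 0 < ε) (hball : closedBall (0 : E) ε ⊆ D) (x : E) :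
    gauge D x ≤ ‖x‖ / ε := by
  rw [le_div_iff₀ hε, mul_comm]
  exact mul_gauge_le_norm (ball_subset_closedBall.trans hball)

end Gauge

section Curves

variable {n : ℕ} {D : Set (EuclideanSpace ℝ (Fin n))} {ε : ℝ}

lemma mem_visibleBoundary_iff (hst : StarConvex ℝ 0 D) (hD : IsOpen D)
    (h0 : (0 : EuclideanSpace ℝ (Fin n)) ∈ D) {x : EuclideanSpace ℝ (Fin n)} :
    x ∈ visibleBoundary D ↔ gauge D x = 1 := by
  constructor
  · rintro ⟨hx, hs⟩
    refine le_antisymm (le_of_forall_gt_imp_ge_of_dense fun c hc => ?_) ?_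
    · have hc0 : 0 < c := one_pos.trans hc
      have := hs c⁻¹ ⟨by positivity, inv_lt_one_of_one_lt₀ hc⟩
      rw [← hst.gauge_lt_one_iff hD h0, gauge_smul_of_nonneg (by positivity), smul_eq_mul,
        inv_mul_lt_iff₀ hc0, mul_one] at this
      exact this.le
    · by_contra h
      rw [not_le, hst.gauge_lt_one_iff hD h0] at h
      rw [hD.frontier_eq] at hx
      exact hx.2 h
  · intro hx
    have hs : ∀ s ∈ Ico (0 : ℝ) 1, s • x ∈ D := fun s hs => by
      rw [← hst.gauge_lt_one_iff hD h0, gauge_smul_of_nonneg hs.1, hx]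
      simpa using hs.2
    refine ⟨?_, hs⟩
    rw [hD.frontier_eq]
    refine ⟨?_, fun h => ?_⟩
    · have hcl : (1 : ℝ) ∈ closure (Ico (0 : ℝ) 1) := by
        rw [closure_Ico (by norm_num)]; simp
      have hcont : Continuous fun s : ℝ => s • x := by fun_prop
      have := map_mem_closure hcont hcl hs
      simpa using this
    · exact absurd hx ((hst.gauge_lt_one_iff hD h0).2 h).ne

/-- A straight segment which stays inside `D` until it first touches the graph of the gauge of `D`
is a curve of the family, whence a lower bound for the integral of an admissible density.
The segment is parametrized projectively. -/
lemma one_le_lintegral_segment (hst : StarConvex ℝ 0 D) (hD : IsOpen D)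
    (h0 : (0 : EuclideanSpace ℝ (Fin n)) ∈ D)
    {ρ : EuclideanSpace ℝ (Fin n) → ℝ≥0∞}
    (hρ : ∀ γ ∈ starCurves D ε, 1 ≤ lineLIntegral ρ γ)
    {z q : EuclideanSpace ℝ (Fin n)} {c a τ B δ : ℝ} (hτ : 0 < τ) (hδ : 0 < δ) (hc : 0 < c)
    (hδc : ∀ t ∈ Icc 0 τ, δ ≤ c - a * t)
    (hlt : ∀ t ∈ Ico 0 τ, gauge D (AffineMap.lineMap z q t) < c - a * t)
    (heq : gauge D (AffineMap.lineMap z q τ) = c - a * τ)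
    (hz : ‖z‖ ≤ ε * c)
    (hB : ∀ t ∈ Icc 0 τ, |a| * ‖AffineMap.lineMap z q t‖ + (c - a * t) * ‖q - z‖ ≤ B) :
    1 ≤ ENNReal.ofReal (B / δ ^ 2) *
      ∫⁻ t in Ioo 0 τ, ρ ((c - a * t)⁻¹ • AffineMap.lineMap z q t) := by
  set X : ℝ → EuclideanSpace ℝ (Fin n) := fun t => (c - a * t)⁻¹ • AffineMap.lineMap z q t with hX
  have hmem : ∀ s ∈ Icc (0 : ℝ) 1, τ * s ∈ Icc 0 τ := fun s hs =>
    ⟨mul_nonneg hτ.le hs.1, mul_le_of_le_one_right hτ.le hs.2⟩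
  have hpos : ∀ t ∈ Icc 0 τ, 0 < c - a * t := fun t ht => hδ.trans_le (hδc t ht)
  have hgX : ∀ t ∈ Icc 0 τ, gauge D (X t) = (c - a * t)⁻¹ * gauge D (AffineMap.lineMap z q t) :=
    fun t ht => by
      rw [hX]; simp only
      rw [gauge_smul_of_nonneg (inv_nonneg.2 (hpos t ht).le), smul_eq_mul]
  have hline : ContDiff ℝ 2 (fun t : ℝ => AffineMap.lineMap z q t) := by
    simp only [AffineMap.lineMap_apply, vsub_eq_sub, vadd_eq_add]
    fun_prop
  have hsmooth : ∀ s ∈ Icc (0 : ℝ) 1, ContDiffAt ℝ 2 (fun s => X (τ * s)) s := fun s hs => by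
    have h1 : ContDiffAt ℝ 2 (fun s : ℝ => (c - a * (τ * s))⁻¹) s :=
      ContDiffAt.inv (by fun_prop) (hpos _ (hmem s hs)).ne'
    have h2 : ContDiffAt ℝ 2 (fun s : ℝ => AffineMap.lineMap z q (τ * s)) s :=
      (hline.comp (by fun_prop : ContDiff ℝ 2 fun s : ℝ => τ * s)).contDiffAt
    exact h1.smul h2
  have hderiv : ∀ s ∈ Icc (0 : ℝ) 1, ‖deriv (fun s => X (τ * s)) s‖ ≤ τ * (B / δ ^ 2) :=
    fun s hs => by
      have hp := hpos _ (hmem s hs)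
      have h1 : HasDerivAt (fun t : ℝ => c - a * t) (-a) (τ * s) := by
        simpa using ((hasDerivAt_id (τ * s)).const_mul a).const_sub c
      have h2 : HasDerivAt X _ (τ * s) :=
        (h1.inv hp.ne').smul (AffineMap.hasDerivAt_lineMap (a := z) (b := q) (x := τ * s))
      have h3 : HasDerivAt (fun s : ℝ => τ * s) τ s := by
        simpa using (hasDerivAt_id s).const_mul τ
      have h4 : deriv (fun s => X (τ * s)) s = _ := (h2.scomp s h3).deriv
      rw [h4, norm_smul, Real.norm_of_nonneg hτ.le]
      gcongr
      have hbound := hB _ (hmem s hs)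
      set e := AffineMap.lineMap z q (τ * s)
      set w := c - a * (τ * s) with hw
      have hδw : δ ≤ w := hδc _ (hmem s hs)
      refine (norm_add_le _ _).trans ?_
      have hn : ‖(fun t : ℝ => c - a * t)⁻¹ (τ * s) • (q - z)‖ + ‖(- -a / w ^ 2) • e‖
          = (|a| * ‖e‖ + w * ‖q - z‖) / w ^ 2 := by
        simp only [Pi.inv_apply, norm_smul, norm_inv, norm_div, neg_neg, Real.norm_eq_abs,
          abs_pow, ← hw, abs_of_pos hp]
        field_simp
        ring
      refine hn.trans_le ?_
      have hB0 : 0 ≤ B := le_trans (by positivity) hbound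
      gcongr
  have hγ : (fun s => X (τ * s)) ∈ starCurves D ε := by
    refine ⟨⟨fun s hs => (hsmooth s hs).continuousAt.continuousWithinAt, ∅, fun s hs _ =>
      ⟨(hsmooth s hs).differentiableAt (by norm_num),
        ((hsmooth s hs).derivWithin (m := 1) (by norm_num)).continuousAt⟩⟩, ?_, ?_, ?_⟩
    · simp only [mul_zero, hX, sub_zero, AffineMap.lineMap_apply_zero, mem_closedBall,
        dist_zero_right, norm_smul, norm_inv, Real.norm_of_nonneg hc.le]
      rw [inv_mul_le_iff₀ hc, mul_comm]
      exact hz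
    · rw [mem_visibleBoundary_iff hst hD h0]
      have hm : τ ∈ Icc 0 τ := ⟨hτ.le, le_rfl⟩
      simp only [mul_one]
      rw [hgX τ hm, heq, inv_mul_cancel₀ (hpos τ hm).ne']
    · intro s hs
      have hm := hmem s ⟨hs.1, hs.2.le⟩
      rw [← hst.gauge_lt_one_iff hD h0, hgX _ hm, inv_mul_lt_iff₀ (hpos _ hm), mul_one]
      exact hlt _ ⟨hm.1, mul_lt_of_lt_one_right hτ hs.2⟩
  calc (1 : ℝ≥0∞) ≤ lineLIntegral ρ (fun s => X (τ * s)) := hρ _ hγ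
    _ ≤ ∫⁻ s in Icc (0 : ℝ) 1, ENNReal.ofReal (B / δ ^ 2) *
          (ENNReal.ofReal |τ| * ρ (X (τ * s))) := by
        refine setLIntegral_mono' measurableSet_Icc fun s hs => ?_
        rw [← mul_assoc, ← ENNReal.ofReal_mul' (abs_nonneg _), mul_comm, abs_of_pos hτ,
          mul_comm (B / δ ^ 2)]
        gcongr
        exact hderiv s hs
    _ = ENNReal.ofReal (B / δ ^ 2) *
        ∫⁻ s in Ioo (0 : ℝ) 1, ENNReal.ofReal |τ| * ρ (X (τ * s)) := by
        rw [lintegral_const_mul' _ _ ENNReal.ofReal_ne_top, setLIntegral_congr Ioo_ae_eq_Icc]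
    _ = _ := by
        rw [← lintegral_image_eq_lintegral_abs_deriv_mul (f := fun s => τ * s) (f' := fun _ => τ)
          measurableSet_Ioo
          (fun s _ => by simpa using ((hasDerivAt_id s).const_mul τ).hasDerivWithinAt)
          (fun s _ t _ h => mul_left_cancel₀ hτ.ne' h) (fun t => ρ (X t))]
        rw [image_mul_left_Ioo hτ, mul_zero, mul_one]

end Curves

section SupportLines

lemma exists_monotone_first_argmax {H : ℝ → ℝ} (hH : UpperSemicontinuousOn H (Icc 0 1)) :
    ∃ τ : ℝ → ℝ, Monotone τ ∧ ∀ a, τ a ∈ Icc (0 : ℝ) 1 ∧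
      (∀ t ∈ Icc (0 : ℝ) 1, H t + a * t ≤ H (τ a) + a * τ a) ∧
      ∀ t ∈ Ico 0 (τ a), H t + a * t < H (τ a) + a * τ a := by
  have key : ∀ a : ℝ, ∃ s ∈ Icc (0 : ℝ) 1, (∀ t ∈ Icc (0 : ℝ) 1, H t + a * t ≤ H s + a * s) ∧
      ∀ t ∈ Ico 0 s, H t + a * t < H s + a * s := by
    intro a
    have husc : UpperSemicontinuousOn (fun t => H t + a * t) (Icc 0 1) :=
      hH.add ((by fun_prop : Continuous fun t : ℝ => a * t).upperSemicontinuous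
        |>.upperSemicontinuousOn _)
    obtain ⟨m, hm, hmax⟩ := husc.exists_isMaxOn (nonempty_Icc.2 zero_le_one) isCompact_Icc
    obtain ⟨C, hC, hCeq⟩ := upperSemicontinuousOn_iff_preimage_Ici.1 husc (H m + a * m)
    have hcpt : IsCompact (Icc (0 : ℝ) 1 ∩ C) := isCompact_Icc.inter_right hC
    have hiff : ∀ t, t ∈ Icc (0 : ℝ) 1 ∩ C ↔ t ∈ Icc (0 : ℝ) 1 ∧ H m + a * m ≤ H t + a * t :=
      fun t => by rw [← hCeq]; rfl
    obtain ⟨s, hs, hleast⟩ := hcpt.exists_isLeast ⟨m, (hiff m).2 ⟨hm, le_rfl⟩⟩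
    have hs' := (hiff s).1 hs
    refine ⟨s, hs'.1, fun t ht => (hmax ht).trans hs'.2, fun t ht => ?_⟩
    by_contra hcon
    rw [not_lt] at hcon
    exact absurd (hleast ((hiff t).2 ⟨⟨ht.1, ht.2.le.trans hs'.1.2⟩, hs'.2.trans hcon⟩))
      (not_le.2 ht.2)
  choose τ h1 h2 h3 using key
  refine ⟨τ, fun a b hab => ?_, fun a => ⟨h1 a, h2 a, h3 a⟩⟩
  rcases hab.eq_or_lt with rfl | hab
  · exact le_rfl
  have e1 := h2 a _ (h1 b)
  have e2 := h2 b _ (h1 a)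
  by_contra hcon
  rw [not_le] at hcon
  nlinarith

variable {H τ : ℝ → ℝ}

lemma argmax_value_sub_bounds (hτ : ∀ a, τ a ∈ Icc (0 : ℝ) 1)
    (hmax : ∀ a, ∀ t ∈ Icc (0 : ℝ) 1, H t + a * t ≤ H (τ a) + a * τ a) (a b : ℝ) :
    (b - a) * τ a ≤ (H (τ b) + b * τ b) - (H (τ a) + a * τ a) ∧
      (H (τ b) + b * τ b) - (H (τ a) + a * τ a) ≤ (b - a) * τ b := by
  have e1 := hmax a _ (hτ b)
  have e2 := hmax b _ (hτ a)
  constructor <;> linarith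

lemma hasDerivAt_argmax_value (hτ : ∀ a, τ a ∈ Icc (0 : ℝ) 1)
    (hmax : ∀ a, ∀ t ∈ Icc (0 : ℝ) 1, H t + a * t ≤ H (τ a) + a * τ a) {a : ℝ}
    (ha : ContinuousAt τ a) :
    HasDerivAt (fun b => H (τ b) + b * τ b) (τ a) a := by
  rw [hasDerivAt_iff_isLittleO, Asymptotics.isLittleO_iff]
  intro κ hκ
  filter_upwards [Metric.continuousAt_iff'.1 ha κ hκ] with b hb
  obtain ⟨e1, e2⟩ := argmax_value_sub_bounds hτ hmax a b
  rw [Real.dist_eq] at hb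
  rw [smul_eq_mul, Real.norm_eq_abs, Real.norm_eq_abs, abs_of_nonneg (by linarith)]
  calc _ ≤ (b - a) * (τ b - τ a) := by linarith
    _ ≤ |b - a| * |τ b - τ a| := by rw [← abs_mul]; exact le_abs_self _
    _ ≤ κ * |b - a| := by rw [mul_comm]; gcongr

lemma continuous_argmax_value (hτ : ∀ a, τ a ∈ Icc (0 : ℝ) 1)
    (hmax : ∀ a, ∀ t ∈ Icc (0 : ℝ) 1, H t + a * t ≤ H (τ a) + a * τ a) :
    Continuous (fun b => H (τ b) + b * τ b) := by
  refine (LipschitzWith.of_dist_le_mul (K := 1) fun b a => ?_).continuous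
  obtain ⟨e1, e2⟩ := argmax_value_sub_bounds hτ hmax a b
  have ha := hτ a
  have hb := hτ b
  rw [Real.dist_eq, Real.dist_eq, NNReal.coe_one, one_mul, abs_le]
  have hneg : -|b - a| ≤ b - a := neg_abs_le _
  have hpos : b - a ≤ |b - a| := le_abs_self _
  have h0 : 0 ≤ |b - a| := abs_nonneg _
  constructor
  · nlinarith [ha.1, ha.2]
  · nlinarith [hb.1, hb.2]

/-- Change of variables from the slope of a support line to its height above `t`. -/
lemma lintegral_support_line_le (hmono : Monotone τ) (hτ : ∀ a, τ a ∈ Icc (0 : ℝ) 1)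
    (hmax : ∀ a, ∀ t ∈ Icc (0 : ℝ) 1, H t + a * t ≤ H (τ a) + a * τ a)
    {I J : Set ℝ} (hI : MeasurableSet I) (t : ℝ)
    (hJ : ∀ a ∈ I, t < τ a → H (τ a) + a * τ a - a * t ∈ J) (g : ℝ → ℝ≥0∞) :
    ∫⁻ a in I, ENNReal.ofReal (τ a - t) * g (H (τ a) + a * τ a - a * t)
      ≤ ∫⁻ w in J, g w := by
  have hSt : MeasurableSet {a | t < τ a} := measurableSet_lt measurable_const hmono.measurable
  have hzero : ∫⁻ a in I \ {a | t < τ a}, ENNReal.ofReal (τ a - t) *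
      g (H (τ a) + a * τ a - a * t) = 0 :=
    setLIntegral_eq_zero (hI.diff hSt) fun a ha => by
      have : τ a ≤ t := not_lt.1 ha.2
      simp [ENNReal.ofReal_of_nonpos (sub_nonpos.2 this)]
  rw [← lintegral_inter_add_sdiff _ I hSt, hzero, add_zero]
  set N : Set ℝ := {a | ¬ ContinuousAt τ a} with hN
  have hNc : N.Countable := hmono.countable_not_continuousAt
  set S : Set ℝ := (I ∩ {a | t < τ a}) \ N with hS
  have hSm : MeasurableSet S :=
    (hI.inter hSt).diff hNc.measurableSet
  have hae : (I ∩ {a | t < τ a} : Set ℝ) =ᵐ[volume] S :=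
    (sdiff_null_ae_eq_self (hNc.measure_zero volume)).symm
  set φ : ℝ → ℝ := fun a => H (τ a) + a * τ a - a * t with hφ
  have hd : ∀ a ∈ S, HasDerivWithinAt φ (τ a - t) S a := fun a ha => by
    have hc : ContinuousAt τ a := not_not.1 ha.2
    exact ((hasDerivAt_argmax_value hτ hmax hc).sub
      (by simpa using (hasDerivAt_id a).mul_const t)).hasDerivWithinAt
  have hinj : InjOn φ S := by
    have hsm : StrictMonoOn φ S := fun a ha b _ hab => by
      have e1 := (argmax_value_sub_bounds hτ hmax a b).1
      have hta : t < τ a := ha.1.2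
      simp only [hφ]
      nlinarith
    exact hsm.injOn
  rw [setLIntegral_congr hae]
  calc ∫⁻ a in S, ENNReal.ofReal (τ a - t) * g (φ a)
      = ∫⁻ a in S, ENNReal.ofReal |τ a - t| * g (φ a) := by
        refine setLIntegral_congr_fun hSm fun a ha => ?_
        have hta : t < τ a := ha.1.2
        simp only [abs_of_pos (sub_pos.2 hta)]
    _ = ∫⁻ w in φ '' S, g w := (lintegral_image_eq_lintegral_abs_deriv_mul hSm hd hinj g).symm
    _ ≤ ∫⁻ w in J, g w := by
        refine lintegral_mono_set ?_
        rintro _ ⟨a, ha, rfl⟩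
        exact hJ a ha.1.1 ha.1.2

end SupportLines

section Potential

lemma ENNReal.le_add_inv_pow_mul_pow (x : ℝ≥0∞) {A : ℝ≥0∞} (hA : A ≠ 0) (hA' : A ≠ ∞) (k : ℕ) :
    x ≤ A + (A ^ k)⁻¹ * x ^ (k + 1) := by
  rcases le_total x A with h | h
  · exact h.trans le_self_add
  · refine le_trans ?_ le_add_self
    calc x = (A ^ k)⁻¹ * A ^ k * x := by
          rw [ENNReal.inv_mul_cancel (pow_ne_zero _ hA) (ENNReal.pow_ne_top hA'), one_mul]
      _ ≤ (A ^ k)⁻¹ * x ^ k * x := by gcongr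
      _ = _ := by rw [pow_succ, mul_assoc]

lemma lintegral_Ioo_sub_left (τ : ℝ) (g : ℝ → ℝ≥0∞) :
    ∫⁻ t in Ioo 0 τ, g (τ - t) = ∫⁻ t in Ioo 0 τ, g t := by
  have h := lintegral_image_eq_lintegral_abs_deriv_mul (s := Ioo 0 τ) (f := fun t => τ - t)
    (f' := fun _ => -1) measurableSet_Ioo
    (fun t _ => ((hasDerivAt_id t).const_sub τ).hasDerivWithinAt)
    (fun s _ t _ h => sub_right_injective h) g
  simpa using h.symm

lemma lintegral_Ioo_rpow_le {τ p : ℝ} (h0 : 0 ≤ τ) (h1 : τ ≤ 1) (hp : -1 < p) :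
    ∫⁻ t in Ioo 0 τ, ENNReal.ofReal (t ^ p) ≤ ENNReal.ofReal (1 / (p + 1)) := by
  have hbound := (intervalIntegrable_iff_integrableOn_Ioo_of_le h0).1
    (intervalIntegral.intervalIntegrable_rpow' hp (a := 0) (b := τ))
  have hnn : 0 ≤ᵐ[volume.restrict (Ioo 0 τ)] fun t : ℝ => t ^ p :=
    (ae_restrict_iff' measurableSet_Ioo).2 (.of_forall fun t ht => Real.rpow_nonneg ht.1.le _)
  rw [← ofReal_integral_eq_lintegral_ofReal hbound hnn, ← integral_Ioc_eq_integral_Ioo,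
    ← intervalIntegral.integral_of_le h0, integral_rpow (Or.inl hp),
    Real.zero_rpow (by linarith), sub_zero]
  gcongr
  · linarith
  · exact Real.rpow_le_one h0 h1 (by linarith)

/-- The integral of `ρ ^ n` along the part of the ray through `x` at which the heights `w` lie in
`[w₀, w₁]`. -/
noncomputable def rayIntegral {n : ℕ} (ρ : EuclideanSpace ℝ (Fin n) → ℝ≥0∞) (w₀ w₁ : ℝ)
    (x : EuclideanSpace ℝ (Fin n)) : ℝ≥0∞ :=
  ∫⁻ w in Icc w₀ w₁, ρ (w⁻¹ • x) ^ n

variable {n : ℕ} {D : Set (EuclideanSpace ℝ (Fin n))} {ε : ℝ}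

lemma measurable_rayIntegral {ρ : EuclideanSpace ℝ (Fin n) → ℝ≥0∞} (hρ : Measurable ρ)
    (w₀ w₁ : ℝ) : Measurable (rayIntegral ρ w₀ w₁) := by
  unfold rayIntegral
  refine Measurable.lintegral_prod_right' (f := fun p : EuclideanSpace ℝ (Fin n) × ℝ =>
    ρ (p.2⁻¹ • p.1) ^ n) ?_
  fun_prop

lemma lintegral_rayIntegral_le {ρ : EuclideanSpace ℝ (Fin n) → ℝ≥0∞} (hρ : Measurable ρ)
    {w₀ w₁ : ℝ} (hw₀ : 0 < w₀) :
    ∫⁻ x, rayIntegral ρ w₀ w₁ x ≤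
      ENNReal.ofReal (w₁ ^ n) * ENNReal.ofReal (w₁ - w₀) * ∫⁻ x, ρ x ^ n := by
  unfold rayIntegral
  rw [lintegral_lintegral_swap (by fun_prop)]
  calc ∫⁻ w in Icc w₀ w₁, ∫⁻ x, ρ (w⁻¹ • x) ^ n
      ≤ ∫⁻ _ in Icc w₀ w₁, ENNReal.ofReal (w₁ ^ n) * ∫⁻ x, ρ x ^ n := by
        refine setLIntegral_mono' measurableSet_Icc fun w hw => ?_
        have hw0 : 0 < w := hw₀.trans_le hw.1
        have hm := Measure.map_addHaar_smul (volume : Measure (EuclideanSpace ℝ (Fin n)))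
          (inv_ne_zero hw0.ne')
        rw [← lintegral_map (f := fun x => ρ x ^ n) (g := fun x => w⁻¹ • x) (by fun_prop)
          (by fun_prop), hm, lintegral_smul_measure, finrank_euclideanSpace_fin, inv_pow, inv_inv,
          abs_of_pos (by positivity), smul_eq_mul]
        gcongr
        exact hw.2
    _ = _ := by
        rw [lintegral_const, Measure.restrict_apply_univ, Real.volume_Icc]
        ring

/-- The integral bound along a support line with contact parameter `τ`, passed from `f` to a
weighted integral of `f ^ n`. -/
lemma half_le_lintegral_support_line (hn : 3 ≤ n) {f : ℝ → ℝ≥0∞} (hf : Measurable f)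
    {τ C θ : ℝ} (h0 : 0 < τ) (h1 : τ ≤ 1)
    (hC : 0 < C) (hθ : 0 < θ) (hθC : C * θ * (2 * (n - 1)) ≤ 1 / 2)
    (h : 1 ≤ ENNReal.ofReal C * ∫⁻ t in Ioo 0 τ, f t) :
    ENNReal.ofReal (1 / 2) ≤ ENNReal.ofReal (C * (θ ^ (n - 1))⁻¹) * ∫⁻ t in Ioo 0 1,
      ENNReal.ofReal (τ - t) * (ENNReal.ofReal ((1 - t) ^ ((n : ℝ) - 5 / 2)) * f t ^ n) := by
  have hn' : (3 : ℝ) ≤ n := by exact_mod_cast hn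
  have hn1 : (n : ℝ) - 1 ≠ 0 := by linarith
  set σ : ℝ := (n - 3 / 2) / (n - 1) with hσ
  have hσ1 : -σ + 1 = 1 / (2 * (n - 1)) := by rw [hσ]; field_simp; ring
  have hσ1' : -1 < -σ := by
    have : 0 < 1 / (2 * ((n : ℝ) - 1)) := by apply one_div_pos.2; linarith
    linarith
  have hcast : ((n - 1 : ℕ) : ℝ) = n - 1 := by rw [Nat.cast_sub (by lia)]; simp
  have hpt : ∀ t ∈ Ioo 0 τ, f t ≤ ENNReal.ofReal θ * ENNReal.ofReal ((τ - t) ^ (-σ)) +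
      ENNReal.ofReal (θ ^ (n - 1))⁻¹ *
      (ENNReal.ofReal (τ - t) * (ENNReal.ofReal ((1 - t) ^ ((n : ℝ) - 5 / 2)) * f t ^ n)) := by
    intro t ht
    have htp : 0 < τ - t := sub_pos.2 ht.2
    have hA : 0 < θ * (τ - t) ^ (-σ) := by positivity
    have hle := ENNReal.le_add_inv_pow_mul_pow (f t)
      (A := ENNReal.ofReal (θ * (τ - t) ^ (-σ))) (by simpa using hA) ENNReal.ofReal_ne_top (n - 1)
    rw [Nat.sub_add_cancel (by lia)] at hle
    refine hle.trans ?_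
    rw [← ENNReal.ofReal_mul hθ.le]
    refine add_le_add le_rfl ?_
    rw [← ENNReal.ofReal_pow hA.le,
      ← ENNReal.ofReal_inv_of_pos (by positivity), ← mul_assoc, ← mul_assoc,
      ← ENNReal.ofReal_mul (by positivity), ← ENNReal.ofReal_mul (by positivity)]
    gcongr
    have hpow : ((τ - t) ^ (-σ)) ^ (n - 1) = ((τ - t) ^ ((n : ℝ) - 3 / 2))⁻¹ := by
      rw [← Real.rpow_natCast, ← Real.rpow_mul htp.le, ← Real.rpow_neg htp.le, hcast, hσ]
      congr 1
      field_simp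
    rw [mul_pow, hpow, mul_inv, inv_inv, mul_assoc]
    gcongr
    have : (n : ℝ) - 3 / 2 = 1 + (n - 5 / 2) := by ring
    rw [this, Real.rpow_add htp, Real.rpow_one]
    gcongr
    linarith
  have hsing : ∫⁻ t in Ioo 0 τ, ENNReal.ofReal ((τ - t) ^ (-σ)) ≤
      ENNReal.ofReal (2 * (n - 1)) := by
    rw [lintegral_Ioo_sub_left τ (fun t => ENNReal.ofReal (t ^ (-σ)))]
    refine (lintegral_Ioo_rpow_le h0.le h1 hσ1').trans_eq ?_
    rw [hσ1, one_div_one_div]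
  have hfin : (1 : ℝ≥0∞) ≤ ENNReal.ofReal (1 / 2) + ENNReal.ofReal (C * (θ ^ (n - 1))⁻¹) *
      ∫⁻ t in Ioo 0 1, ENNReal.ofReal (τ - t) *
        (ENNReal.ofReal ((1 - t) ^ ((n : ℝ) - 5 / 2)) * f t ^ n) := by
    refine h.trans ?_
    calc ENNReal.ofReal C * ∫⁻ t in Ioo 0 τ, f t
        ≤ ENNReal.ofReal C * (ENNReal.ofReal θ * ENNReal.ofReal (2 * (n - 1)) +
          ENNReal.ofReal (θ ^ (n - 1))⁻¹ * ∫⁻ t in Ioo 0 1, ENNReal.ofReal (τ - t) *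
            (ENNReal.ofReal ((1 - t) ^ ((n : ℝ) - 5 / 2)) * f t ^ n)) := by
          gcongr
          refine (setLIntegral_mono' measurableSet_Ioo hpt).trans ?_
          rw [lintegral_add_left (by fun_prop), lintegral_const_mul _ (by fun_prop),
            lintegral_const_mul _ (by fun_prop)]
          gcongr
      _ ≤ _ := by
          rw [mul_add, ← mul_assoc, ← mul_assoc, ← ENNReal.ofReal_mul hC.le,
            ← ENNReal.ofReal_mul (by positivity), ← ENNReal.ofReal_mul hC.le]
          gcongr
  have h2 : (1 : ℝ≥0∞) = ENNReal.ofReal (1 / 2) + ENNReal.ofReal (1 / 2) := by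
    rw [← ENNReal.ofReal_add (by norm_num) (by norm_num)]; norm_num
  rw [h2] at hfin
  exact (ENNReal.add_le_add_iff_left ENNReal.ofReal_ne_top).1 hfin

/-- Lower bound for a weighted average of `rayIntegral` over a segment ending at a point `q` with
`δ ≤ gauge D q`, obtained by averaging over the support lines of slope in a unit interval of the
gauge along that segment. -/
lemma exists_le_lintegral_rayIntegral_lineMap (hn : 3 ≤ n) (hst : StarConvex ℝ 0 D)
    (hD : IsOpen D) (h0 : (0 : EuclideanSpace ℝ (Fin n)) ∈ D) (hε : 0 < ε)
    (hball : closedBall (0 : EuclideanSpace ℝ (Fin n)) ε ⊆ D) {r δ : ℝ} (hr : 0 < r) (hδ : 0 < δ) :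
    ∃ κ : ℝ≥0∞, κ ≠ 0 ∧ ∃ w₁ : ℝ, ∀ ρ : EuclideanSpace ℝ (Fin n) → ℝ≥0∞, Measurable ρ →
      (∀ γ ∈ starCurves D ε, 1 ≤ lineLIntegral ρ γ) → ∀ z q : EuclideanSpace ℝ (Fin n),
      ‖z‖ ≤ r → ‖q‖ ≤ r → δ ≤ gauge D q →
      κ ≤ ∫⁻ t in Ioo (0 : ℝ) 1, ENNReal.ofReal ((1 - t) ^ ((n : ℝ) - 5 / 2)) *
        rayIntegral ρ δ w₁ (AffineMap.lineMap z q t) := by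
  have hn' : (3 : ℝ) ≤ n := by exact_mod_cast hn
  set A : ℝ := r / ε with hA
  have hA0 : 0 < A := by positivity
  set w₁ : ℝ := 2 * A + 1 with hw₁
  set B : ℝ := (A + 1) * r + w₁ * (2 * r) with hB
  have hB0 : 0 < B := by positivity
  set C : ℝ := B / δ ^ 2 with hC
  have hC0 : 0 < C := by positivity
  set θ : ℝ := 1 / (4 * C * (n - 1)) with hθ
  have hθ0 : 0 < θ := by
    have : (0 : ℝ) < n - 1 := by linarith
    positivity
  set L : ℝ := C * (θ ^ (n - 1))⁻¹ with hL
  have hL0 : 0 < L := by positivity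
  refine ⟨(ENNReal.ofReal L)⁻¹ * ENNReal.ofReal (1 / 2), by simp, w₁, ?_⟩
  intro ρ hρm hρ z q hz hq hδq
  set e : ℝ → EuclideanSpace ℝ (Fin n) := fun t => AffineMap.lineMap z q t with he
  have hecont : Continuous e := AffineMap.lineMap_continuous
  have her : ∀ t ∈ Icc (0 : ℝ) 1, ‖e t‖ ≤ r := fun t ht => by
    have := (convex_closedBall (0 : EuclideanSpace ℝ (Fin n)) r).lineMap_mem (x := z) (y := q)
      (by simpa using hz) (by simpa using hq) ht
    simpa using this
  set H : ℝ → ℝ := fun t => gauge D (e t) with hH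
  have hHA : ∀ t ∈ Icc (0 : ℝ) 1, H t ≤ A := fun t ht =>
    (gauge_le_norm_div hε hball _).trans (by rw [hA]; gcongr; exact her t ht)
  have husc : UpperSemicontinuousOn H (Icc 0 1) :=
    ((hst.upperSemicontinuous_gauge hD h0).comp hecont).upperSemicontinuousOn _
  obtain ⟨τ, hmono, hτ⟩ := exists_monotone_first_argmax husc
  have hτ01 := fun a => (hτ a).1
  have hmax := fun a => (hτ a).2.1
  set c : ℝ → ℝ := fun a => H (τ a) + a * τ a with hc
  have hccont : Continuous c := continuous_argmax_value hτ01 hmax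
  have hH1 : δ ≤ H 1 := by simpa [hH, he] using hδq
  have hcge : ∀ a, δ + a ≤ c a := fun a => by
    have := hmax a 1 (by simp)
    simp only [hc]; linarith
  have hcle : ∀ a ∈ Icc A (A + 1), c a ≤ w₁ := fun a ha => by
    have h1 := hHA _ (hτ01 a)
    have h2 : a * τ a ≤ a := mul_le_of_le_one_right (hA0.le.trans ha.1) (hτ01 a).2
    simp only [hc, hw₁]; linarith [ha.2]
  have hheight : ∀ a ∈ Icc A (A + 1), ∀ t ∈ Icc 0 (τ a), c a - a * t ∈ Icc δ w₁ :=
    fun a ha t ht => by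
      have ha0 : 0 ≤ a := hA0.le.trans ha.1
      have ht1 : a * t ≤ a * 1 := by gcongr; exact ht.2.trans (hτ01 a).2
      have ht0 : 0 ≤ a * t := mul_nonneg ha0 ht.1
      exact ⟨by linarith [hcge a], by linarith [hcle a ha]⟩
  have hτpos : ∀ a ∈ Icc A (A + 1), 0 < τ a := fun a ha => by
    by_contra hcon
    have hzero : τ a = 0 := le_antisymm (not_lt.1 hcon) (hτ01 a).1
    have h1 := hcge a
    have h2 := hHA _ (hτ01 a)
    simp only [hc, hzero] at h1 h2
    linarith [ha.1]
  have hslope : ∀ a ∈ Icc A (A + 1), ENNReal.ofReal (1 / 2) ≤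
      ENNReal.ofReal L * ∫⁻ t in Ioo 0 1, ENNReal.ofReal (τ a - t) *
        (ENNReal.ofReal ((1 - t) ^ ((n : ℝ) - 5 / 2)) * ρ ((c a - a * t)⁻¹ • e t) ^ n) := by
    intro a ha
    have ha0 : 0 ≤ a := hA0.le.trans ha.1
    refine half_le_lintegral_support_line hn (f := fun t => ρ ((c a - a * t)⁻¹ • e t)) (by fun_prop)
      (hτpos a ha) (hτ01 a).2 hC0 hθ0 (le_of_eq ?_) ?_
    · have : (n : ℝ) - 1 ≠ 0 := by linarith
      rw [hθ]; field_simp; norm_num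
    · refine one_le_lintegral_segment hst hD h0 hρ (hτpos a ha) hδ (by linarith [hcge a])
        (fun t ht => (hheight a ha t ht).1) (fun t ht => ?_) ?_ ?_ fun t ht => ?_
      · have := (hτ a).2.2 t ht
        simp only [hc, hH, he] at this ⊢; linarith
      · simp only [hc, hH, he]; ring
      · have hAc : A ≤ c a := by linarith [hcge a, ha.1]
        calc ‖z‖ ≤ r := hz
          _ = ε * A := by rw [hA]; field_simp
          _ ≤ ε * c a := by gcongr
      · rw [abs_of_nonneg ha0, hB]
        have h2 : ‖q - z‖ ≤ 2 * r := (norm_sub_le _ _).trans (by linarith)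
        have h3 := hheight a ha t ht
        have h4 := her t ⟨ht.1, ht.2.trans (hτ01 a).2⟩
        gcongr
        · exact ha.2
        · exact h3.2
  have hmeas : Measurable (Function.uncurry fun a t : ℝ => ENNReal.ofReal (τ a - t) *
      (ENNReal.ofReal ((1 - t) ^ ((n : ℝ) - 5 / 2)) * ρ ((c a - a * t)⁻¹ • e t) ^ n)) := by
    have hτm := hmono.measurable
    have hcm := hccont.measurable
    have hem := hecont.measurable
    unfold Function.uncurry
    fun_prop
  have hbound : ENNReal.ofReal (1 / 2) ≤ ENNReal.ofReal L * ∫⁻ t in Ioo (0 : ℝ) 1,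
      ENNReal.ofReal ((1 - t) ^ ((n : ℝ) - 5 / 2)) * rayIntegral ρ δ w₁ (e t) := by
    calc ENNReal.ofReal (1 / 2) = ∫⁻ _ in Icc A (A + 1), ENNReal.ofReal (1 / 2) := by
          simp
      _ ≤ ∫⁻ a in Icc A (A + 1), ENNReal.ofReal L * ∫⁻ t in Ioo 0 1, ENNReal.ofReal (τ a - t) *
          (ENNReal.ofReal ((1 - t) ^ ((n : ℝ) - 5 / 2)) * ρ ((c a - a * t)⁻¹ • e t) ^ n) :=
          setLIntegral_mono' measurableSet_Icc hslope
      _ = ENNReal.ofReal L * ∫⁻ t in Ioo 0 1, ∫⁻ a in Icc A (A + 1), ENNReal.ofReal (τ a - t) *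
          (ENNReal.ofReal ((1 - t) ^ ((n : ℝ) - 5 / 2)) * ρ ((c a - a * t)⁻¹ • e t) ^ n) := by
          rw [lintegral_const_mul' _ _ ENNReal.ofReal_ne_top,
            lintegral_lintegral_swap hmeas.aemeasurable]
      _ ≤ _ := by
          gcongr ENNReal.ofReal L * ?_
          refine setLIntegral_mono' measurableSet_Ioo fun t ht => ?_
          refine (lintegral_support_line_le hmono hτ01 hmax (J := Icc δ w₁) measurableSet_Icc t
            (fun a ha hta => hheight a ha t ⟨ht.1.le, hta.le⟩)
            (fun w => ENNReal.ofReal ((1 - t) ^ ((n : ℝ) - 5 / 2)) * ρ (w⁻¹ • e t) ^ n)).trans_eq ?_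
          rw [lintegral_const_mul' _ _ ENNReal.ofReal_ne_top]
          rfl
  rw [ENNReal.inv_mul_le_iff (by simpa using hL0) ENNReal.ofReal_ne_top]
  exact hbound

/-- A number `v` such that `κ * v` is at most `C` times the energy of every admissible density
vanishes when the modulus does. -/
lemma eq_zero_of_forall_mul_le {Γ : Set (ℝ → EuclideanSpace ℝ (Fin n))}
    (hmod : conformalModulus n Γ = 0) {κ C v : ℝ≥0∞} (hκ : κ ≠ 0) (hC : C ≠ ∞)
    (h : ∀ ρ : EuclideanSpace ℝ (Fin n) → ℝ≥0∞, Measurable ρ →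
      (∀ γ ∈ Γ, 1 ≤ lineLIntegral ρ γ) → κ * v ≤ C * ∫⁻ x, ρ x ^ n) : v = 0 := by
  have hle : κ * v / C ≤ conformalModulus n Γ :=
    le_iInf fun ρ => le_iInf fun hρ => le_iInf fun hadm => ENNReal.div_le_of_le_mul' (h ρ hρ hadm)
  rw [hmod, nonpos_iff_eq_zero, ENNReal.div_eq_zero_iff] at hle
  exact (mul_eq_zero.1 (hle.resolve_right hC)).resolve_left hκ

lemma exists_le_rayIntegral (hn : n ≠ 0) (hst : StarConvex ℝ 0 D)
    (hD : IsOpen D) (h0 : (0 : EuclideanSpace ℝ (Fin n)) ∈ D) (hε : 0 < ε)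
    (hball : closedBall (0 : EuclideanSpace ℝ (Fin n)) ε ⊆ D) {r δ : ℝ} (hr : 0 < r) (hδ : 0 < δ) :
    ∃ κ : ℝ≥0∞, κ ≠ 0 ∧ ∃ w₁ : ℝ, ∀ ρ : EuclideanSpace ℝ (Fin n) → ℝ≥0∞, Measurable ρ →
      (∀ γ ∈ starCurves D ε, 1 ≤ lineLIntegral ρ γ) → ∀ q : EuclideanSpace ℝ (Fin n),
      ‖q‖ ≤ r → δ ≤ gauge D q → κ ≤ rayIntegral ρ δ w₁ q := by
  set A : ℝ := r / ε with hA
  have hA0 : 0 < A := by positivity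
  set w₁ : ℝ := A + 1 with hw₁
  set C : ℝ := w₁ * r / δ ^ 2 with hC
  have hC0 : 0 < C := by positivity
  set θ : ℝ := 1 / (2 * C) with hθ
  have hθ0 : 0 < θ := by positivity
  set L : ℝ≥0∞ := ENNReal.ofReal C * (ENNReal.ofReal θ ^ (n - 1))⁻¹ with hL
  have hθne : ENNReal.ofReal θ ≠ 0 := by simpa using hθ0
  have hL0 : L ≠ 0 := mul_ne_zero (by simpa using hC0) (by simp)
  have hLt : L ≠ ∞ := ENNReal.mul_ne_top ENNReal.ofReal_ne_top
    (ENNReal.inv_ne_top.2 (pow_ne_zero _ hθne))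
  refine ⟨L⁻¹ * ENNReal.ofReal (1 / 2), by simp [hLt], w₁, ?_⟩
  intro ρ hρm hρ q hq hδq
  have hgA : gauge D q ≤ A := (gauge_le_norm_div hε hball _).trans (by rw [hA]; gcongr)
  set a : ℝ := w₁ - gauge D q with ha
  have ha1 : 1 ≤ a := by linarith
  have hheight : ∀ t ∈ Icc (0 : ℝ) 1, w₁ - a * t ∈ Icc (gauge D q) w₁ := fun t ht =>
    ⟨by nlinarith [ht.2], by nlinarith [ht.1]⟩
  have hone : 1 ≤ ENNReal.ofReal C * ∫⁻ t in Ioo (0 : ℝ) 1, ρ ((w₁ - a * t)⁻¹ • q) := by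
    have := one_le_lintegral_segment hst hD h0 hρ (z := q) (q := q) (c := w₁) (a := a)
      (B := w₁ * r) one_pos hδ (by positivity) (fun t ht => hδq.trans (hheight t ht).1)
      (fun t ht => ?_) ?_ ?_ fun t ht => ?_
    · simpa using this
    · rw [AffineMap.lineMap_same_apply]
      nlinarith [ht.2]
    · rw [AffineMap.lineMap_same_apply]
      linarith
    · calc ‖q‖ ≤ r := hq
        _ = ε * A := by rw [hA]; field_simp
        _ ≤ ε * w₁ := by gcongr; linarith
    · rw [AffineMap.lineMap_same_apply, sub_self, norm_zero, mul_zero, add_zero,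
        abs_of_nonneg (by linarith)]
      gcongr
      linarith
  have hsubst : ∫⁻ t in Ioo (0 : ℝ) 1, ρ ((w₁ - a * t)⁻¹ • q) ^ n ≤ rayIntegral ρ δ w₁ q := by
    calc ∫⁻ t in Ioo (0 : ℝ) 1, ρ ((w₁ - a * t)⁻¹ • q) ^ n
        ≤ ∫⁻ t in Ioo (0 : ℝ) 1, ENNReal.ofReal |-a| * ρ ((w₁ - a * t)⁻¹ • q) ^ n := by
          gcongr with t
          refine le_mul_of_one_le_left zero_le ?_
          rw [abs_neg, abs_of_pos (by linarith), ENNReal.one_le_ofReal]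
          exact ha1
      _ = ∫⁻ w in (fun t => w₁ - a * t) '' Ioo 0 1, ρ (w⁻¹ • q) ^ n := by
          rw [lintegral_image_eq_lintegral_abs_deriv_mul (f' := fun _ => -a) measurableSet_Ioo
            (fun t _ => by
              simpa using (((hasDerivAt_id t).const_mul a).const_sub w₁).hasDerivWithinAt)
            (fun s _ t _ h => by
              have h' : a * s = a * t := sub_right_injective h
              exact mul_left_cancel₀ (by linarith) h')]
      _ ≤ _ := by
          refine lintegral_mono_set ?_
          rintro _ ⟨t, ht, rfl⟩
          have := hheight t ⟨ht.1.le, ht.2.le⟩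
          exact ⟨hδq.trans this.1, this.2⟩
  have h2 : (1 : ℝ≥0∞) = ENNReal.ofReal (1 / 2) + ENNReal.ofReal (1 / 2) := by
    rw [← ENNReal.ofReal_add (by norm_num) (by norm_num)]; norm_num
  have hfin : (1 : ℝ≥0∞) ≤ ENNReal.ofReal (1 / 2) + L * rayIntegral ρ δ w₁ q := by
    refine hone.trans ?_
    calc ENNReal.ofReal C * ∫⁻ t in Ioo (0 : ℝ) 1, ρ ((w₁ - a * t)⁻¹ • q)
        ≤ ENNReal.ofReal C * ∫⁻ t in Ioo (0 : ℝ) 1, (ENNReal.ofReal θ +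
          (ENNReal.ofReal θ ^ (n - 1))⁻¹ * ρ ((w₁ - a * t)⁻¹ • q) ^ n) := by
          gcongr with t
          have := ENNReal.le_add_inv_pow_mul_pow (ρ ((w₁ - a * t)⁻¹ • q)) hθne
            ENNReal.ofReal_ne_top (n - 1)
          rwa [Nat.sub_add_cancel (Nat.one_le_iff_ne_zero.2 hn)] at this
      _ ≤ ENNReal.ofReal C * (ENNReal.ofReal θ +
          (ENNReal.ofReal θ ^ (n - 1))⁻¹ * rayIntegral ρ δ w₁ q) := by
          rw [lintegral_add_left (by fun_prop), lintegral_const_mul _ (by fun_prop)]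
          gcongr
          simp
      _ = _ := by
          rw [mul_add, ← mul_assoc, ← ENNReal.ofReal_mul hC0.le]
          congr 2
          rw [hθ]; field_simp
  rw [h2] at hfin
  rw [ENNReal.inv_mul_le_iff hL0 hLt]
  exact (ENNReal.add_le_add_iff_left ENNReal.ofReal_ne_top).1 hfin

lemma volume_gauge_ge_eq_zero (hn : n ≠ 0) (hst : StarConvex ℝ 0 D)
    (hD : IsOpen D) (h0 : (0 : EuclideanSpace ℝ (Fin n)) ∈ D) (hε : 0 < ε)
    (hball : closedBall (0 : EuclideanSpace ℝ (Fin n)) ε ⊆ D)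
    (hmod : conformalModulus n (starCurves D ε) = 0) {r δ : ℝ} (hr : 0 < r) (hδ : 0 < δ) :
    volume {q : EuclideanSpace ℝ (Fin n) | ‖q‖ ≤ r ∧ δ ≤ gauge D q} = 0 := by
  obtain ⟨κ, hκ, w₁, h⟩ := exists_le_rayIntegral hn hst hD h0 hε hball hr hδ
  refine eq_zero_of_forall_mul_le (C := ENNReal.ofReal (w₁ ^ n) * ENNReal.ofReal (w₁ - δ)) hmod hκ
    (ENNReal.mul_ne_top ENNReal.ofReal_ne_top ENNReal.ofReal_ne_top) fun ρ hρ hadm => ?_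
  calc κ * volume {q : EuclideanSpace ℝ (Fin n) | ‖q‖ ≤ r ∧ δ ≤ gauge D q}
      ≤ κ * volume {q | κ ≤ rayIntegral ρ δ w₁ q} := by
        gcongr
        exact fun hq => h ρ hρ hadm _ hq.1 hq.2
    _ ≤ ∫⁻ q, rayIntegral ρ δ w₁ q :=
        mul_meas_ge_le_lintegral₀ (measurable_rayIntegral hρ _ _).aemeasurable κ
    _ ≤ _ := lintegral_rayIntegral_le hρ hδ

lemma LipschitzWith.volume_image_eq_zero_of_fin_two {f : EuclideanSpace ℝ (Fin 2) → Fin 2 → ℝ}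
    {K : NNReal} (hf : LipschitzWith K f) {s : Set (EuclideanSpace ℝ (Fin 2))}
    (hs : volume s = 0) : volume (f '' s) = 0 := by
  have hpre : volume ((WithLp.toLp 2 : (Fin 2 → ℝ) → EuclideanSpace ℝ (Fin 2)) ⁻¹' s) = 0 :=
    (PiLp.volume_preserving_toLp (Fin 2)).quasiMeasurePreserving.preimage_null hs
  have hcomp := hf.comp (PiLp.lipschitzWith_toLp 2 fun _ : Fin 2 => ℝ)
  have himg : f '' s = (f ∘ WithLp.toLp 2) '' (WithLp.toLp 2 ⁻¹' s) := by
    rw [image_comp, image_preimage_eq _ (WithLp.toLp_surjective 2)]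
  have hle := hcomp.hausdorffMeasure_image_le (d := (Fintype.card (Fin 2) : ℝ)) (by positivity)
    (WithLp.toLp 2 ⁻¹' s)
  rw [hausdorffMeasure_pi_real, hpre, mul_zero] at hle
  rw [himg]
  exact nonpos_iff_eq_zero.1 hle

lemma lintegral_lineMap_left_le {Φ : EuclideanSpace ℝ (Fin n) → ℝ≥0∞} (hΦ : Measurable Φ)
    (q : EuclideanSpace ℝ (Fin n)) {r t : ℝ} (hq : ‖q‖ ≤ r) (ht : t < 1) :
    ∫⁻ z in closedBall 0 r, Φ (AffineMap.lineMap z q t) ≤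
      ENNReal.ofReal (((1 - t) ^ n)⁻¹) * ∫⁻ x in closedBall q (2 * r * (1 - t)), Φ x := by
  have ht' : 0 < 1 - t := sub_pos.2 ht
  set g : EuclideanSpace ℝ (Fin n) → ℝ≥0∞ := (closedBall q (2 * r * (1 - t))).indicator Φ with hg
  have hgm : Measurable g := hΦ.indicator isClosed_closedBall.measurableSet
  calc ∫⁻ z in closedBall 0 r, Φ (AffineMap.lineMap z q t)
      ≤ ∫⁻ z in closedBall 0 r, g ((1 - t) • z + t • q) := by
        refine setLIntegral_mono' isClosed_closedBall.measurableSet fun z hz => ?_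
        rw [← AffineMap.lineMap_apply_module, hg, indicator_of_mem]
        rw [mem_closedBall, dist_lineMap_right, Real.norm_of_nonneg ht'.le, mul_comm]
        gcongr
        rw [mem_closedBall_zero_iff] at hz
        exact (dist_le_norm_add_norm _ _).trans (by linarith)
    _ ≤ ∫⁻ z, g ((1 - t) • z + t • q) := setLIntegral_le_lintegral _ _
    _ = ENNReal.ofReal (((1 - t) ^ n)⁻¹) * ∫⁻ x, g (x + t • q) := by
        rw [← lintegral_map (f := fun x => g (x + t • q)) (g := fun z => (1 - t) • z)
          (by fun_prop) (by fun_prop), Measure.map_addHaar_smul _ ht'.ne', lintegral_smul_measure,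
          finrank_euclideanSpace_fin, abs_of_pos (by positivity), smul_eq_mul]
    _ = _ := by
        rw [lintegral_add_right_eq_self g (t • q), hg,
          lintegral_indicator isClosed_closedBall.measurableSet]


/-- The Riesz type potential of the image under `f` of the measure with density `Φ`. -/
noncomputable def imagePotential (Φ : EuclideanSpace ℝ (Fin n) → ℝ≥0∞)
    (f : EuclideanSpace ℝ (Fin n) → Fin 2 → ℝ) (R : ℝ) (σ : Fin 2 → ℝ) : ℝ≥0∞ :=
  ∫⁻ u in Ioo (0 : ℝ) 1, ∫⁻ x, {x | dist (f x) σ ≤ R * u}.indicator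
    (fun x => ENNReal.ofReal (u ^ (-5 / 2 : ℝ)) * Φ x) x

section ImagePotential

variable {Φ : EuclideanSpace ℝ (Fin n) → ℝ≥0∞} {f : EuclideanSpace ℝ (Fin n) → Fin 2 → ℝ}

lemma measurable_imagePotential_integrand (hΦ : Measurable Φ) (hf : Continuous f) (R : ℝ) :
    Measurable fun p : ((Fin 2 → ℝ) × ℝ) × EuclideanSpace ℝ (Fin n) =>
      {x | dist (f x) p.1.1 ≤ R * p.1.2}.indicator
        (fun x => ENNReal.ofReal (p.1.2 ^ (-5 / 2 : ℝ)) * Φ x) p.2 := by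
  have hS : IsClosed {p : ((Fin 2 → ℝ) × ℝ) × EuclideanSpace ℝ (Fin n) |
      dist (f p.2) p.1.1 ≤ R * p.1.2} := isClosed_le (by fun_prop) (by fun_prop)
  have hm : Measurable fun p : ((Fin 2 → ℝ) × ℝ) × EuclideanSpace ℝ (Fin n) =>
      ENNReal.ofReal (p.1.2 ^ (-5 / 2 : ℝ)) * Φ p.2 := by fun_prop
  exact hm.indicator hS.measurableSet

lemma measurable_imagePotential (hΦ : Measurable Φ) (hf : Continuous f) (R : ℝ) :
    Measurable (imagePotential Φ f R) :=
  (measurable_imagePotential_integrand hΦ hf R).lintegral_prod_right'.lintegral_prod_right'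

lemma lintegral_imagePotential_le (hΦ : Measurable Φ) (hf : Continuous f) {R : ℝ} (hR : 0 ≤ R) :
    ∫⁻ σ, imagePotential Φ f R σ ≤ ENNReal.ofReal (2 * (2 * R) ^ 2) * ∫⁻ x, Φ x := by
  have hm := measurable_imagePotential_integrand hΦ hf R
  calc ∫⁻ σ, imagePotential Φ f R σ
      = ∫⁻ u in Ioo (0 : ℝ) 1, ∫⁻ x, ∫⁻ σ, {x | dist (f x) σ ≤ R * u}.indicator
          (fun x => ENNReal.ofReal (u ^ (-5 / 2 : ℝ)) * Φ x) x := by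
        simp only [imagePotential]
        rw [lintegral_lintegral_swap hm.lintegral_prod_right'.aemeasurable]
        refine lintegral_congr fun u => lintegral_lintegral_swap ?_
        exact (hm.comp (f := fun p : (Fin 2 → ℝ) × EuclideanSpace ℝ (Fin n) => ((p.1, u), p.2))
          (by fun_prop)).aemeasurable
    _ = ∫⁻ u in Ioo (0 : ℝ) 1, ENNReal.ofReal (u ^ (-1 / 2 : ℝ)) *
          (ENNReal.ofReal ((2 * R) ^ 2) * ∫⁻ x, Φ x) := by
        refine setLIntegral_congr_fun measurableSet_Ioo fun u hu => ?_
        rw [← lintegral_const_mul _ hΦ, ← lintegral_const_mul _ (by fun_prop)]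
        refine lintegral_congr fun x => ?_
        have : ∀ σ, {x | dist (f x) σ ≤ R * u}.indicator
            (fun x => ENNReal.ofReal (u ^ (-5 / 2 : ℝ)) * Φ x) x =
            (closedBall (f x) (R * u)).indicator
              (fun _ => ENNReal.ofReal (u ^ (-5 / 2 : ℝ)) * Φ x) σ := fun σ => by
          simp only [indicator, mem_closedBall, mem_ofPred_eq, dist_comm]
        simp only [this]
        rw [lintegral_indicator_const isClosed_closedBall.measurableSet,
          Real.volume_pi_closedBall _ (mul_nonneg hR hu.1.le), mul_right_comm,
          ← ENNReal.ofReal_mul (Real.rpow_nonneg hu.1.le _),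
          ← mul_assoc (ENNReal.ofReal (u ^ (-1 / 2 : ℝ))),
          ← ENNReal.ofReal_mul (Real.rpow_nonneg hu.1.le _)]
        congr 2
        have : u ^ (-1 / 2 : ℝ) = u ^ (-5 / 2 : ℝ) * u ^ 2 := by
          rw [← Real.rpow_natCast, ← Real.rpow_add hu.1]
          norm_num
        rw [this, Fintype.card_fin]
        ring
    _ ≤ ENNReal.ofReal 2 * (ENNReal.ofReal ((2 * R) ^ 2) * ∫⁻ x, Φ x) := by
        rw [lintegral_mul_const _ (by fun_prop)]
        gcongr
        have := lintegral_Ioo_rpow_le zero_le_one le_rfl (by norm_num : (-1 : ℝ) < -1 / 2)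
        rwa [show (1 : ℝ) / (-1 / 2 + 1) = 2 by norm_num] at this
    _ = _ := by rw [ENNReal.ofReal_mul zero_le_two, mul_assoc]

lemma mul_volume_le_imagePotential (hΦ : Measurable Φ) {K : NNReal} (hf : LipschitzWith K f)
    {r : ℝ} {κ : ℝ≥0∞} {q : EuclideanSpace ℝ (Fin n)} (hq : ‖q‖ ≤ r)
    (h : ∀ z : EuclideanSpace ℝ (Fin n), ‖z‖ ≤ r → κ ≤ ∫⁻ t in Ioo (0 : ℝ) 1,
      ENNReal.ofReal ((1 - t) ^ ((n : ℝ) - 5 / 2)) * Φ (AffineMap.lineMap z q t)) :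
    κ * volume (closedBall (0 : EuclideanSpace ℝ (Fin n)) r) ≤
      imagePotential Φ f (K * (2 * r)) (f q) := by
  have hline : Continuous fun p : EuclideanSpace ℝ (Fin n) × ℝ =>
      (AffineMap.lineMap p.1 q p.2 : EuclideanSpace ℝ (Fin n)) := by
    simp only [AffineMap.lineMap_apply_module]
    fun_prop
  calc κ * volume (closedBall (0 : EuclideanSpace ℝ (Fin n)) r)
      = ∫⁻ _ in closedBall (0 : EuclideanSpace ℝ (Fin n)) r, κ := by
        rw [setLIntegral_const]
    _ ≤ ∫⁻ z in closedBall (0 : EuclideanSpace ℝ (Fin n)) r, ∫⁻ t in Ioo (0 : ℝ) 1,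
          ENNReal.ofReal ((1 - t) ^ ((n : ℝ) - 5 / 2)) * Φ (AffineMap.lineMap z q t) :=
        setLIntegral_mono' isClosed_closedBall.measurableSet fun z hz =>
          h z (mem_closedBall_zero_iff.1 hz)
    _ = ∫⁻ t in Ioo (0 : ℝ) 1, ENNReal.ofReal ((1 - t) ^ ((n : ℝ) - 5 / 2)) *
          ∫⁻ z in closedBall (0 : EuclideanSpace ℝ (Fin n)) r, Φ (AffineMap.lineMap z q t) := by
        have hΦl := hΦ.comp hline.measurable
        rw [lintegral_lintegral_swap]
        · refine lintegral_congr fun t => lintegral_const_mul _ ?_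
          exact hΦl.comp (f := fun z => (z, t)) (by fun_prop)
        · exact (Measurable.mul (by fun_prop) hΦl).aemeasurable
    _ ≤ ∫⁻ t in Ioo (0 : ℝ) 1, (fun u => ∫⁻ x, {x | dist (f x) (f q) ≤ K * (2 * r) * u}.indicator
          (fun x => ENNReal.ofReal (u ^ (-5 / 2 : ℝ)) * Φ x) x) (1 - t) := by
        refine setLIntegral_mono' measurableSet_Ioo fun t ht => ?_
        have ht' : 0 < 1 - t := sub_pos.2 ht.2
        have hpow : (1 - t) ^ ((n : ℝ) - 5 / 2) * ((1 - t) ^ n)⁻¹ = (1 - t) ^ (-5 / 2 : ℝ) := by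
          rw [← Real.rpow_natCast, ← Real.rpow_neg ht'.le, ← Real.rpow_add ht']
          ring_nf
        grw [lintegral_lineMap_left_le hΦ q hq ht.2]
        rw [← mul_assoc, ← ENNReal.ofReal_mul (Real.rpow_nonneg ht'.le _), hpow,
          ← lintegral_const_mul _ hΦ, ← lintegral_indicator isClosed_closedBall.measurableSet]
        refine lintegral_mono fun x => indicator_le_indicator_of_subset (fun x hx => ?_)
          (fun _ => zero_le) x
        rw [mem_ofPred_eq, mul_assoc]
        exact (hf.dist_le_mul x q).trans (mul_le_mul_of_nonneg_left hx K.2)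
    _ = _ := lintegral_Ioo_sub_left 1 fun u =>
        ∫⁻ x, {x | dist (f x) (f q) ≤ K * (2 * r) * u}.indicator
          (fun x => ENNReal.ofReal (u ^ (-5 / 2 : ℝ)) * Φ x) x

end ImagePotential

lemma volume_image_gauge_ge_eq_zero_of_three_le (hn : 3 ≤ n) (hst : StarConvex ℝ 0 D)
    (hD : IsOpen D) (h0 : (0 : EuclideanSpace ℝ (Fin n)) ∈ D) (hε : 0 < ε)
    (hball : closedBall (0 : EuclideanSpace ℝ (Fin n)) ε ⊆ D)
    (hmod : conformalModulus n (starCurves D ε) = 0) {r δ : ℝ} (hr : 0 < r) (hδ : 0 < δ)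
    {f : EuclideanSpace ℝ (Fin n) → Fin 2 → ℝ} {K : NNReal} (hf : LipschitzWith K f) :
    volume (f '' {q | ‖q‖ ≤ r ∧ δ ≤ gauge D q}) = 0 := by
  obtain ⟨κ, hκ, w₁, h⟩ := exists_le_lintegral_rayIntegral_lineMap hn hst hD h0 hε hball hr hδ
  set c := κ * volume (closedBall (0 : EuclideanSpace ℝ (Fin n)) r) with hc
  have hc0 : c ≠ 0 := mul_ne_zero hκ (measure_closedBall_pos _ _ hr).ne'
  set R : ℝ := K * (2 * r) with hR
  have hR0 : 0 ≤ R := by positivity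
  refine eq_zero_of_forall_mul_le (C := ENNReal.ofReal (2 * (2 * R) ^ 2) *
    (ENNReal.ofReal (w₁ ^ n) * ENNReal.ofReal (w₁ - δ))) hmod hc0
    (by finiteness) fun ρ hρ hadm => ?_
  have hm := measurable_rayIntegral hρ δ w₁
  calc c * volume (f '' {q | ‖q‖ ≤ r ∧ δ ≤ gauge D q})
      ≤ c * volume {σ | c ≤ imagePotential (rayIntegral ρ δ w₁) f R σ} := by
        gcongr
        rintro _ ⟨q, ⟨hq, hδq⟩, rfl⟩
        exact mul_volume_le_imagePotential hm hf hq fun z hz => h ρ hρ hadm z q hz hq hδq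
    _ ≤ ∫⁻ σ, imagePotential (rayIntegral ρ δ w₁) f R σ :=
        mul_meas_ge_le_lintegral₀ (measurable_imagePotential hm hf.continuous R).aemeasurable c
    _ ≤ ENNReal.ofReal (2 * (2 * R) ^ 2) * ∫⁻ x, rayIntegral ρ δ w₁ x :=
        lintegral_imagePotential_le hm hf.continuous hR0
    _ ≤ _ := by
        rw [mul_assoc]
        gcongr
        exact lintegral_rayIntegral_le hρ hδ

/-- If the modulus vanishes, then Lipschitz images in the plane of the cone over the visible
boundary are null. -/
lemma volume_image_gauge_ge_eq_zero (hn : 2 ≤ n) (hst : StarConvex ℝ 0 D)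
    (hD : IsOpen D) (h0 : (0 : EuclideanSpace ℝ (Fin n)) ∈ D) (hε : 0 < ε)
    (hball : closedBall (0 : EuclideanSpace ℝ (Fin n)) ε ⊆ D)
    (hmod : conformalModulus n (starCurves D ε) = 0) {r δ : ℝ} (hr : 0 < r) (hδ : 0 < δ)
    {f : EuclideanSpace ℝ (Fin n) → Fin 2 → ℝ} {K : NNReal} (hf : LipschitzWith K f) :
    volume (f '' {q | ‖q‖ ≤ r ∧ δ ≤ gauge D q}) = 0 := by
  obtain rfl | hn := hn.eq_or_lt
  · exact hf.volume_image_eq_zero_of_fin_two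
      (volume_gauge_ge_eq_zero two_ne_zero hst hD h0 hε hball hmod hr hδ)
  · exact volume_image_gauge_ge_eq_zero_of_three_le hn hst hD h0 hε hball hmod hr hδ hf

lemma lipschitzWith_norm_inner (y : EuclideanSpace ℝ (Fin n)) :
    LipschitzWith (max 1 ‖y‖₊) fun x : EuclideanSpace ℝ (Fin n) => ![‖x‖, inner ℝ x y] := by
  refine LipschitzWith.of_dist_le_mul fun x x' => (dist_pi_le_iff (by positivity)).2 fun i => ?_
  have h1 : (1 : ℝ) ≤ (max 1 ‖y‖₊ : NNReal) := by exact_mod_cast le_max_left _ _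
  have h2 : ‖y‖ ≤ (max 1 ‖y‖₊ : NNReal) := by exact_mod_cast le_max_right 1 ‖y‖₊
  fin_cases i
  · simp only [Fin.zero_eta, Matrix.cons_val_zero, dist_eq_norm]
    exact (abs_norm_sub_norm_le x x').trans (le_mul_of_one_le_left (norm_nonneg _) h1)
  · simp only [Fin.mk_one, Matrix.cons_val_one, Matrix.cons_val_fin_one, dist_eq_norm,
      ← inner_sub_left]
    calc |inner ℝ (x - x') y| ≤ ‖x - x'‖ * ‖y‖ := abs_real_inner_le_norm _ _
      _ ≤ _ := by rw [mul_comm]; gcongr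

/-- A planar domain swept out by the cone over a connected set which is not a singleton. -/
lemma IsPreconnected.exists_smul_norm_inner {s : Set (EuclideanSpace ℝ (Fin n))}
    (hs : IsPreconnected s) (hε : 0 < ε) (hnorm : ∀ x ∈ s, ‖x‖ = ε)
    {y y' : EuclideanSpace ℝ (Fin n)} (hy : y ∈ s) (hy' : y' ∈ s) {σ : Fin 2 → ℝ}
    (h₁ : ε < σ 0) (h₂ : inner ℝ y' y * σ 0 < ε * σ 1) (h₃ : σ 1 < ε * σ 0) :
    ∃ x ∈ s, ∃ c : ℝ, 0 < c ∧ ‖c • x‖ = σ 0 ∧ inner ℝ (c • x) y = σ 1 := by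
  have hσ : 0 < σ 0 := hε.trans h₁
  have hyy : inner ℝ y y = ε ^ 2 := by rw [real_inner_self_eq_norm_sq, hnorm y hy]
  obtain ⟨x, hx, hxg⟩ := hs.intermediate_value hy' hy (f := fun x => inner ℝ x y)
    (by fun_prop) (show ε * σ 1 / σ 0 ∈ Icc _ _ from
      ⟨by rw [le_div_iff₀ hσ]; exact h₂.le, by
        rw [hyy, div_le_iff₀ hσ]; nlinarith⟩)
  refine ⟨x, hx, σ 0 / ε, by positivity, ?_, ?_⟩
  · rw [norm_smul, hnorm x hx, Real.norm_of_nonneg (by positivity)]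
    field_simp
  · rw [real_inner_smul_left, show inner ℝ x y = _ from hxg]
    field_simp

end Potential

/-- Star lemma, part (i), Euclidean case: if `mod_n Γ_ε = 0`, then the radial
projection of the visible boundary `Δ` to the sphere of radius `ε` is totally
disconnected (all its connected components are singletons). -/
theorem star_lemma_i (n : ℕ) (hn : 2 ≤ n)
    (D : Set (EuclideanSpace ℝ (Fin n))) (hD : IsOpen D)
    (hDconn : IsConnected D) (hDne : D ≠ Set.univ)
    (h0 : (0 : EuclideanSpace ℝ (Fin n)) ∈ D)
    (hstar : ∀ x ∈ D, segment ℝ (0 : EuclideanSpace ℝ (Fin n)) x ⊆ D)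
    (ε : ℝ) (hε : 0 < ε)
    (hball : closedBall (0 : EuclideanSpace ℝ (Fin n)) ε ⊆ D)
    (hmod : conformalModulus n (starCurves D ε) = 0) :
    ∀ y ∈ (fun x : EuclideanSpace ℝ (Fin n) => (ε / ‖x‖) • x) ''
        visibleBoundary D,
      connectedComponentIn
        ((fun x : EuclideanSpace ℝ (Fin n) => (ε / ‖x‖) • x) ''
          visibleBoundary D) y = {y} := by
  have hst : StarConvex ℝ 0 D := starConvex_iff_segment_subset.2 fun x hx => hstar x hx
  set F := (fun x : EuclideanSpace ℝ (Fin n) => (ε / ‖x‖) • x) '' visibleBoundary D with hF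
  have hFprop : ∀ x ∈ F, ‖x‖ = ε ∧ 0 < gauge D x := by
    rintro _ ⟨x, hx, rfl⟩
    rw [mem_visibleBoundary_iff hst hD h0] at hx
    have hx0 : 0 < ‖x‖ := norm_pos_iff.2 fun h => by simp [h] at hx
    have hc : 0 < ε / ‖x‖ := by positivity
    refine ⟨?_, ?_⟩
    · rw [norm_smul, Real.norm_of_nonneg hc.le, div_mul_cancel₀ _ hx0.ne']
    · rw [gauge_smul_of_nonneg hc.le, hx, smul_eq_mul, mul_one]
      exact hc
  intro y hy
  have hsub := connectedComponentIn_subset F y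
  have hymem := mem_connectedComponentIn hy
  refine Subset.antisymm (fun y' hy' => ?_) (singleton_subset_iff.2 hymem)
  by_contra hne
  have hyn := (hFprop y hy).1
  have hyn' := (hFprop y' (hsub hy')).1
  have hlt : inner ℝ y' y < ε ^ 2 := by
    have h := inner_lt_norm_mul_iff_real (x := y') (y := y)
    rw [hyn, hyn'] at h
    rw [sq]
    exact h.2 fun h' => hne (smul_right_injective _ hε.ne' h')
  set f : EuclideanSpace ℝ (Fin n) → Fin 2 → ℝ := fun x => ![‖x‖, inner ℝ x y] with hf
  have hnull : volume (⋃ m : ℕ, f '' {q | ‖q‖ ≤ 2 * ε ∧ 1 / ((m : ℝ) + 1) ≤ gauge D q}) = 0 :=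
    measure_iUnion_null fun m => volume_image_gauge_ge_eq_zero hn hst hD h0 hε hball hmod
      (by positivity) (by positivity) (lipschitzWith_norm_inner y)
  set O : Set (Fin 2 → ℝ) := {σ | (ε < σ 0 ∧ σ 0 < 2 * ε) ∧
    inner ℝ y' y * σ 0 < ε * σ 1 ∧ σ 1 < ε * σ 0} with hO
  have hOopen : IsOpen O := by
    simp only [hO, ofPred_and]
    refine ((isOpen_lt ?_ ?_).inter (isOpen_lt ?_ ?_)).inter
      ((isOpen_lt ?_ ?_).inter (isOpen_lt ?_ ?_)) <;> fun_prop
  have hOne : O.Nonempty := by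
    refine ⟨![3 / 2 * ε, 3 / 4 * (inner ℝ y' y + ε ^ 2)], ⟨?_, ?_⟩, ?_, ?_⟩ <;>
      simp only [Matrix.cons_val_zero, Matrix.cons_val_one, Matrix.cons_val_fin_one] <;> nlinarith
  refine (hOopen.measure_pos volume hOne).ne' (measure_mono_null ?_ hnull)
  rintro σ ⟨⟨h₁, h₁'⟩, h₂, h₃⟩
  obtain ⟨x, hx, c, hc, hcn, hci⟩ := isPreconnected_connectedComponentIn.exists_smul_norm_inner hε
    (fun x hx => (hFprop x (hsub hx)).1) hymem hy' h₁ h₂ h₃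
  have hg : 0 < gauge D (c • x) := by
    rw [gauge_smul_of_nonneg hc.le]
    exact mul_pos hc (hFprop x (hsub hx)).2
  obtain ⟨m, hm⟩ := exists_nat_one_div_lt hg
  refine mem_iUnion.2 ⟨m, c • x, ⟨by rw [hcn]; exact h₁'.le, hm.le⟩, ?_⟩
  ext i
  fin_cases i
  · exact hcn
  · exact hci
end
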